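/- Let q be an odd prime power and let ρ₀,…,ρ_{k-1} be pairwise non-isomorphic cuspidal irreducible complex representations, ρ_i a representation of GL_{r_i}(𝔽_q). For each i let π_i be a ρ_i-primary irreducible representation of GL_{m_i}(𝔽_q), and let π be an irreducible representation of GL_n(𝔽_q), n = m₀ + ⋯ + m_{k-1}, occurring in the parabolic induction π₀ × ⋯ × π_{k-1}. Let A ∈ GL_n(𝔽_q) satisfy A² = I, with centralizer H_A. If the parabolic induction π₀ × ⋯ × π_{k-1} has a nonzero H_A-invariant vector, then each π_i is either self-dual (π_i ≅ π_i*) or dual to some π_j with i ≠ j (π_i* ≅ π_j), and consequently (π₀ × ⋯ × π_{k-1})* ≅ π₀ × ⋯ × π_{k-1}. -/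

import Mathlib

open Matrix

noncomputable section

namespace Paper

/-- nonzero vector invariant under a set of group elements -/
def HasInvVec {G V : Type*} [Group G] [AddCommGroup V] [Module ℂ V]
    (π : Representation ℂ G V) (S : Set G) : Prop :=
  ∃ v : V, v ≠ 0 ∧ ∀ g ∈ S, π g v = v

/-- nonzero invariant linear functional -/
def HasInvFunctional {G V : Type*} [Group G] [AddCommGroup V] [Module ℂ V]
    (π : Representation ℂ G V) (S : Set G) : Prop :=
  ∃ ℓ : Module.Dual ℂ V, ℓ ≠ 0 ∧ ∀ g ∈ S, ∀ v : V, ℓ (π g v) = ℓ v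

/-- isomorphism of representations -/
def RepIso {G V W : Type*} [Group G] [AddCommGroup V] [Module ℂ V] [AddCommGroup W] [Module ℂ W]
    (π : Representation ℂ G V) (π' : Representation ℂ G W) : Prop :=
  ∃ e : V ≃ₗ[ℂ] W, ∀ (g : G) (v : V), e (π g v) = π' g (e v)

/-- irreducibility -/
def IsIrred {G V : Type*} [Group G] [AddCommGroup V] [Module ℂ V]
    (π : Representation ℂ G V) : Prop :=
  (∃ v : V, v ≠ 0) ∧
    ∀ W : Submodule ℂ V, (∀ (g : G), ∀ v ∈ W, π g v ∈ W) → W = ⊥ ∨ W = ⊤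

/-- membership in the "unipotent radical" pattern for the partition function `f`:
the matrix agrees with the identity except at entries `(i,j)` with `f i < f j`. -/
def unipMem {F : Type*} [Field F] {n m : ℕ} (f : Fin n → Fin m)
    (A : Matrix (Fin n) (Fin n) F) : Prop :=
  ∀ i j, ¬ f i < f j → A i j = (1 : Matrix (Fin n) (Fin n) F) i j

/-- a representation of `GL_n(F)` is cuspidal if for every proper standard parabolic
(given by a monotone surjection onto `Fin m`, `m ≥ 2`), the only vector invariant under the
corresponding unipotent radical is zero. -/
def IsCuspidal {F : Type*} [Field F] {n : ℕ} {V : Type*} [AddCommGroup V] [Module ℂ V]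
    (π : Representation ℂ (GL (Fin n) F) V) : Prop :=
  ∀ (m : ℕ) (f : Fin n → Fin m), 2 ≤ m → Monotone f → Function.Surjective f →
    ∀ v : V, (∀ A : GL (Fin n) F, unipMem f (A : Matrix (Fin n) (Fin n) F) → π A v = v) → v = 0

/-- the standard parabolic subgroup attached to a partition function `f` (block
upper-triangular invertible matrices). -/
def parabolic {F : Type*} [Field F] {n m : ℕ} (f : Fin n → Fin m) : Subgroup (GL (Fin n) F) where
  carrier := {A | BlockTriangular (A : Matrix (Fin n) (Fin n) F) f}
  one_mem' := by simpa using blockTriangular_one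
  mul_mem' := fun ha hb => by simpa using Matrix.BlockTriangular.mul ha hb
  inv_mem' := by
    intro A hA
    have h : ((A⁻¹ : GL (Fin n) F) : Matrix (Fin n) (Fin n) F)
        = ((A : Matrix (Fin n) (Fin n) F))⁻¹ := by
      simp [Matrix.coe_units_inv]
    simp only [Set.mem_setOf_eq] at hA ⊢
    rw [h]
    haveI : Invertible (A : Matrix (Fin n) (Fin n) F) := A.invertible
    exact blockTriangular_inv_of_blockTriangular hA


variable {F : Type*} [Field F] {n m k : ℕ}

def leviMem {α : Type*} (f : Fin n → α) (A : Matrix (Fin n) (Fin n) F) : Prop :=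
  ∀ i j, f i ≠ f j → A i j = 0

/-- the standard Levi subgroup attached to a partition function `f`
(block-diagonal invertible matrices). -/
def levi (f : Fin n → Fin m) : Subgroup (GL (Fin n) F) where
  carrier := {A | leviMem f (A : Matrix (Fin n) (Fin n) F)}
  one_mem' := by
    intro i j hij
    have : i ≠ j := fun h => hij (by rw [h])
    simp [Matrix.one_apply, this]
  mul_mem' := by
    intro A B hA hB
    intro i j hij
    show (((A : Matrix (Fin n) (Fin n) F)) * B) i j = 0
    rw [Matrix.mul_apply]
    apply Finset.sum_eq_zero
    intro x _
    by_cases h : f i = f x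
    · rw [hB x j (by rw [← h]; exact hij), mul_zero]
    · rw [hA i x h, zero_mul]
  inv_mem' := by
    intro A hA
    simp only [Set.mem_setOf_eq] at hA ⊢
    haveI : Invertible (A : Matrix (Fin n) (Fin n) F) := A.invertible
    have h1 : BlockTriangular (A : Matrix (Fin n) (Fin n) F) f := fun i j h => hA i j (ne_of_gt h)
    have h2 : BlockTriangular ((A : Matrix (Fin n) (Fin n) F))ᵀ f :=
      fun i j h => hA j i (ne_of_lt h)
    have h1' := blockTriangular_inv_of_blockTriangular h1
    haveI : Invertible ((A : Matrix (Fin n) (Fin n) F))ᵀ := Matrix.invertibleTranspose _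
    have h2' := blockTriangular_inv_of_blockTriangular h2
    have hcoe : ((A⁻¹ : GL (Fin n) F) : Matrix (Fin n) (Fin n) F)
        = ((A : Matrix (Fin n) (Fin n) F))⁻¹ := by simp [Matrix.coe_units_inv]
    rw [hcoe]
    intro i j hij
    rcases lt_or_gt_of_ne hij with h | h
    · have := h2' h
      rw [← Matrix.transpose_nonsing_inv] at this
      simpa using this
    · exact h1' h

theorem submatrix_mul_block (f : Fin n → Fin m) (a : Fin m) (e : Fin k → Fin n)
    (he : Function.Injective e) (hmem : ∀ i, f (e i) = a)
    (hsurj : ∀ j, f j = a → ∃ i, e i = j)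
    {A B : Matrix (Fin n) (Fin n) F} (hA : BlockTriangular A f) (hB : BlockTriangular B f) :
    (A * B).submatrix e e = A.submatrix e e * B.submatrix e e := by
  ext i j
  rw [Matrix.submatrix_apply, Matrix.mul_apply, Matrix.mul_apply]
  rw [show (∑ x : Fin n, A (e i) x * B x (e j))
      = ∑ x ∈ Finset.univ.image e, A (e i) x * B x (e j) from ?_]
  · rw [Finset.sum_image (fun x _ y _ h => he h)]
    simp
  · symm
    apply Finset.sum_subset (Finset.subset_univ _)
    intro x _ hx
    have hxa : f x ≠ a := by
      intro hfa
      obtain ⟨i', hi'⟩ := hsurj x hfa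
      exact hx (Finset.mem_image.mpr ⟨i', Finset.mem_univ _, hi'⟩)
    rcases lt_or_gt_of_ne hxa with h | h
    · rw [hA (show f x < f (e i) by rw [hmem]; exact h), zero_mul]
    · rw [hB (show f (e j) < f x by rw [hmem]; exact h), mul_zero]


theorem parabolic_mem' {F : Type*} [Field F] {n m : ℕ} {f : Fin n → Fin m} {A : GL (Fin n) F} :
    A ∈ parabolic f ↔ BlockTriangular (A : Matrix (Fin n) (Fin n) F) f := Iff.rfl

theorem levi_mem' {F : Type*} [Field F] {n m : ℕ} {f : Fin n → Fin m} {A : GL (Fin n) F} :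
    A ∈ levi f ↔ leviMem f (A : Matrix (Fin n) (Fin n) F) := Iff.rfl

/-- extraction of the `a`-th diagonal block, as a group homomorphism from the parabolic
subgroup to a general linear group, along an enumeration `e` of the `a`-th block. -/
def leviProj (f : Fin n → Fin m) (a : Fin m) (e : Fin k → Fin n)
    (he : Function.Injective e) (hmem : ∀ i, f (e i) = a)
    (hsurj : ∀ j, f j = a → ∃ i, e i = j) :
    (parabolic (F := F) f) →* GL (Fin k) F where
  toFun A :=
    { val := ((A : GL (Fin n) F) : Matrix (Fin n) (Fin n) F).submatrix e e
      inv := (((A : GL (Fin n) F)⁻¹ : GL (Fin n) F) : Matrix (Fin n) (Fin n) F).submatrix e e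
      val_inv := by
        rw [← submatrix_mul_block f a e he hmem hsurj (parabolic_mem'.mp A.2)
          (parabolic_mem'.mp ((parabolic f).inv_mem A.2))]
        rw [show ((A : GL (Fin n) F) : Matrix (Fin n) (Fin n) F) *
            (((A : GL (Fin n) F)⁻¹ : GL (Fin n) F) : Matrix (Fin n) (Fin n) F) = 1 by
          rw [← Units.val_mul, mul_inv_cancel, Units.val_one]]
        exact Matrix.submatrix_one e he
      inv_val := by
        rw [← submatrix_mul_block f a e he hmem hsurj
          (parabolic_mem'.mp ((parabolic f).inv_mem A.2)) (parabolic_mem'.mp A.2)]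
        rw [show (((A : GL (Fin n) F)⁻¹ : GL (Fin n) F) : Matrix (Fin n) (Fin n) F) *
            ((A : GL (Fin n) F) : Matrix (Fin n) (Fin n) F) = 1 by
          rw [← Units.val_mul, inv_mul_cancel, Units.val_one]]
        exact Matrix.submatrix_one e he }
  map_one' := by
    ext i j
    show ((1 : Matrix (Fin n) (Fin n) F).submatrix e e) i j = _
    rw [Matrix.submatrix_one e he]
    rfl
  map_mul' A B := by
    ext i j
    show ((((A * B : (parabolic f)) : GL (Fin n) F) : Matrix (Fin n) (Fin n) F).submatrix e e) i j
      = _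
    rw [show (((A * B : (parabolic f)) : GL (Fin n) F) : Matrix (Fin n) (Fin n) F)
        = ((A : GL (Fin n) F) : Matrix (Fin n) (Fin n) F) *
          ((B : GL (Fin n) F) : Matrix (Fin n) (Fin n) F) from rfl]
    rw [submatrix_mul_block f a e he hmem hsurj (parabolic_mem'.mp A.2) (parabolic_mem'.mp B.2)]
    rfl


open scoped TensorProduct

/-- exterior tensor product of representations: the product group `∀ a, G a` acts on
`⨂[ℂ] a, V a` factorwise. -/
def piTensorRep {ι : Type*} [Fintype ι] {G : ι → Type*} [∀ a, Group (G a)]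
    {V : ι → Type*} [∀ a, AddCommGroup (V a)] [∀ a, Module ℂ (V a)]
    (π : ∀ a, Representation ℂ (G a) (V a)) :
    Representation ℂ (∀ a, G a) (⨂[ℂ] a, V a) :=
  PiTensorProduct.mapMonoidHom.comp
    { toFun := fun g => fun a => π a (g a)
      map_one' := by funext a; simp
      map_mul' := fun g h => by funext a; simp }

variable {G : Type*} [Group G] {W : Type*} [AddCommGroup W] [Module ℂ W]

/-- the space of the induced representation (function model): functions `φ : G → W`
with `φ (p * g) = x p (φ g)`. -/
def IndCarrier (P : Subgroup G) (x : Representation ℂ P W) : Submodule ℂ (G → W) where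
  carrier := {φ | ∀ (p : P) (g : G), φ (↑p * g) = x p (φ g)}
  add_mem' := by
    intro φ ψ hφ hψ p g
    simp only [Pi.add_apply, hφ p g, hψ p g, map_add]
  zero_mem' := by
    intro p g
    simp
  smul_mem' := by
    intro c φ hφ p g
    simp only [Pi.smul_apply, hφ p g, _root_.map_smul]

/-- the induced representation `Ind_P^G x` in the function model, `(g • φ) y = φ (y * g)`. -/
def IndRep (P : Subgroup G) (x : Representation ℂ P W) :
    Representation ℂ G (IndCarrier P x) where
  toFun g :=
    { toFun := fun φ => ⟨fun y => (φ : G → W) (y * g), by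
        intro p y
        show (φ : G → W) (↑p * y * g) = _
        rw [mul_assoc]
        exact φ.2 p (y * g)⟩
      map_add' := fun φ ψ => by ext y; rfl
      map_smul' := fun c φ => by ext y; rfl }
  map_one' := by
    apply LinearMap.ext
    intro φ
    apply Subtype.ext
    funext y
    show (φ : G → W) (y * 1) = (φ : G → W) y
    rw [mul_one]
  map_mul' g h := by
    apply LinearMap.ext
    intro φ
    apply Subtype.ext
    funext y
    show (φ : G → W) (y * (g * h)) = (φ : G → W) (y * g * h)
    rw [mul_assoc]


theorem unip_conj {f : Fin n → Fin m} {l A : GL (Fin n) F}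
    (hl : l ∈ levi f) (hA : unipMem f (A : Matrix (Fin n) (Fin n) F)) :
    unipMem f ((l⁻¹ * A * l : GL (Fin n) F) : Matrix (Fin n) (Fin n) F) := by
  have hli : leviMem f ((l⁻¹ : GL (Fin n) F) : Matrix (Fin n) (Fin n) F) :=
    levi_mem'.mp ((levi f).inv_mem hl)
  have hlm : leviMem f ((l : GL (Fin n) F) : Matrix (Fin n) (Fin n) F) := levi_mem'.mp hl
  set li := ((l⁻¹ : GL (Fin n) F) : Matrix (Fin n) (Fin n) F) with hli_def
  set lm := ((l : GL (Fin n) F) : Matrix (Fin n) (Fin n) F) with hlm_def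
  set Am := ((A : GL (Fin n) F) : Matrix (Fin n) (Fin n) F) with hAm_def
  have hval : ((l⁻¹ * A * l : GL (Fin n) F) : Matrix (Fin n) (Fin n) F) = li * Am * lm := by
    rw [Units.val_mul, Units.val_mul]
  have hN : li * Am * lm = 1 + li * (Am - 1) * lm := by
    have h1 : li * lm = 1 := by
      rw [hli_def, hlm_def, ← Units.val_mul, inv_mul_cancel, Units.val_one]
    rw [Matrix.mul_sub, Matrix.mul_one, Matrix.sub_mul, h1]
    abel
  intro i j hij
  rw [hval, hN, Matrix.add_apply]
  have hzero : (li * (Am - 1) * lm) i j = 0 := by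
    rw [Matrix.mul_apply]
    apply Finset.sum_eq_zero
    intro t _
    by_cases ht : f t = f j
    · rw [Matrix.mul_apply]
      have : ∀ s ∈ Finset.univ, li i s * (Am - 1) s t = 0 := by
        intro s _
        by_cases hs : f i = f s
        · have hN0 : (Am - 1) s t = 0 := by
            have : ¬ f s < f t := by rw [← hs, ht]; exact hij
            rw [Matrix.sub_apply, hA s t this, sub_self]
          rw [hN0, mul_zero]
        · rw [hli i s (fun h => hs h), zero_mul]
      rw [Finset.sum_eq_zero this, zero_mul]
    · rw [hlm t j ht, mul_zero]
  rw [hzero, add_zero]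

variable {V : Type*} [AddCommGroup V] [Module ℂ V]

/-- the Jacquet restriction: the space of vectors invariant under the unipotent radical. -/
def jacquetModule (π : Representation ℂ (GL (Fin n) F) V) (f : Fin n → Fin m) :
    Submodule ℂ V where
  carrier := {v | ∀ A : GL (Fin n) F, unipMem f (A : Matrix (Fin n) (Fin n) F) → π A v = v}
  add_mem' := fun hv hw A hA => by rw [map_add, hv A hA, hw A hA]
  zero_mem' := fun A hA => by simp
  smul_mem' := fun c v hv A hA => by rw [_root_.map_smul, hv A hA]

theorem jacquet_stable (π : Representation ℂ (GL (Fin n) F) V) (f : Fin n → Fin m)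
    {l : GL (Fin n) F} (hl : l ∈ levi f) {v : V} (hv : v ∈ jacquetModule π f) :
    π l v ∈ jacquetModule π f := by
  intro A hA
  have key : A * l = l * (l⁻¹ * A * l) := by group
  have : π A (π l v) = π (A * l) v := by rw [_root_.map_mul]; rfl
  rw [this, key, _root_.map_mul]
  have : π (l⁻¹ * A * l) v = v := hv _ (unip_conj hl hA)
  show π l (π (l⁻¹ * A * l) v) = π l v
  rw [this]

/-- the Jacquet restriction of `π` as a representation of the Levi subgroup. -/
def jacquetRep (π : Representation ℂ (GL (Fin n) F) V) (f : Fin n → Fin m) :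
    Representation ℂ (levi (F := F) f) (jacquetModule π f) where
  toFun l := (π (l : GL (Fin n) F)).restrict (fun v hv => jacquet_stable π f l.2 hv)
  map_one' := by
    apply LinearMap.ext
    intro v
    apply Subtype.ext
    show π ((1 : levi (F := F) f) : GL (Fin n) F) (v : V) = (v : V)
    rw [Subgroup.coe_one, _root_.map_one]
    rfl
  map_mul' l l' := by
    apply LinearMap.ext
    intro v
    apply Subtype.ext
    show π (((l * l' : levi (F := F) f)) : GL (Fin n) F) (v : V) = _
    rw [Subgroup.coe_mul, _root_.map_mul]
    rfl



section ParabolicInduction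

variable {F : Type*} [Field F]

/-- the group homomorphism from a parabolic subgroup onto the product of the general linear
groups of its diagonal blocks. -/
def leviProjPi {N m : ℕ} (f : Fin N → Fin m) {k : Fin m → ℕ} (e : ∀ a, Fin (k a) → Fin N)
    (he : ∀ a, Function.Injective (e a)) (hmem : ∀ a i, f (e a i) = a)
    (hsurj : ∀ a j, f j = a → ∃ i, e a i = j) :
    (parabolic (F := F) f) →* (∀ a, GL (Fin (k a)) F) :=
  Pi.monoidHom (fun a => leviProj f a (e a) (he a) (hmem a) (hsurj a))

/-- parabolic induction: the representation of `GL_N(F)` induced from the inflation to the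
parabolic subgroup attached to `f` of the exterior tensor product of the `π a`. -/
def parabolicInd {N m : ℕ} (f : Fin N → Fin m) {k : Fin m → ℕ} (e : ∀ a, Fin (k a) → Fin N)
    (he : ∀ a, Function.Injective (e a)) (hmem : ∀ a i, f (e a i) = a)
    (hsurj : ∀ a j, f j = a → ∃ i, e a i = j)
    {V : Fin m → Type*} [∀ a, AddCommGroup (V a)] [∀ a, Module ℂ (V a)]
    (π : ∀ a, Representation ℂ (GL (Fin (k a)) F) (V a)) :
    Representation ℂ (GL (Fin N) F)
      (IndCarrier (parabolic f) ((piTensorRep π).comp (leviProjPi f e he hmem hsurj))) :=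
  IndRep (parabolic f) ((piTensorRep π).comp (leviProjPi f e he hmem hsurj))

end ParabolicInduction

/-- `A` is a monomial matrix (normalizes the diagonal torus) with underlying
permutation `σ`. -/
def IsMonomialWith {F : Type*} [Field F] {n : ℕ} (A : GL (Fin n) F)
    (σ : Equiv.Perm (Fin n)) : Prop :=
  ∀ i j, i ≠ σ j → (A : Matrix (Fin n) (Fin n) F) i j = 0

/-- the space of equivariant linear maps between two representations. -/
def equivariantMaps {G V W : Type*} [Group G] [AddCommGroup V] [Module ℂ V]
    [AddCommGroup W] [Module ℂ W]
    (π : Representation ℂ G V) (π' : Representation ℂ G W) : Submodule ℂ (V →ₗ[ℂ] W) where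
  carrier := {T | ∀ (g : G) (v : V), T (π g v) = π' g (T v)}
  add_mem' := by
    intro T S hT hS g v
    simp [hT g v, hS g v]
  zero_mem' := by intro g v; simp
  smul_mem' := by
    intro c T hT g v
    simp [hT g v]

/-- a representation is self-dual -/
def SelfDual {G V : Type*} [Group G] [AddCommGroup V] [Module ℂ V]
    (π : Representation ℂ G V) : Prop :=
  RepIso π π.dual

/-- `π` occurs as a subrepresentation of `ξ`. -/
def OccursIn {G V W : Type*} [Group G] [AddCommGroup V] [Module ℂ V]
    [AddCommGroup W] [Module ℂ W]
    (π : Representation ℂ G V) (ξ : Representation ℂ G W) : Prop :=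
  ∃ ι : V →ₗ[ℂ] W, Function.Injective ι ∧ ∀ (g : G) (v : V), ι (π g v) = ξ g (ι v)

/-- the canonical identification `GL_a(F) ≅ GL_b(F)` for `a = b`. -/
def castGL {F : Type*} [Field F] {a b : ℕ} (h : a = b) : GL (Fin a) F ≃* GL (Fin b) F :=
  Units.mapEquiv (Matrix.reindexAlgEquiv F F (finCongr h)).toRingEquiv.toMulEquiv

/-- `π` is a `ρ`-primary representation: it occurs in the `c`-fold parabolic
induction `ρ × ρ × ⋯ × ρ`. -/
def IsPrimary {F : Type*} [Field F] {r c : ℕ} {V W : Type*}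
    [AddCommGroup V] [Module ℂ V] [AddCommGroup W] [Module ℂ W]
    (ρ : Representation ℂ (GL (Fin r) F) V)
    (π : Representation ℂ (GL (Fin (r * c)) F) W) : Prop :=
  ∃ (f : Fin (r * c) → Fin c) (e : ∀ _ : Fin c, Fin r → Fin (r * c))
    (_ : Monotone f) (he : ∀ a, StrictMono (e a))
    (hmem : ∀ a i, f (e a i) = a) (hsurj : ∀ a j, f j = a → ∃ i, e a i = j),
    OccursIn π (parabolicInd f e (fun a => (he a).injective) hmem hsurj (fun _ => ρ))

open scoped TensorProduct

noncomputable section Development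

section RepBasics

variable {G : Type*} [Group G] {V : Type*} [AddCommGroup V] [Module ℂ V]
  {V' : Type*} [AddCommGroup V'] [Module ℂ V'] {V'' : Type*} [AddCommGroup V''] [Module ℂ V'']

theorem rep_mul_apply (π : Representation ℂ G V) (g h : G) (v : V) :
    π (g * h) v = π g (π h v) := by rw [map_mul]; rfl

theorem rep_one_apply (π : Representation ℂ G V) (v : V) : π 1 v = v := by rw [map_one]; rfl

theorem rep_inv_self_apply (π : Representation ℂ G V) (g : G) (v : V) : π g⁻¹ (π g v) = v := by
  rw [← rep_mul_apply, inv_mul_cancel, rep_one_apply]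

theorem rep_self_inv_apply (π : Representation ℂ G V) (g : G) (v : V) : π g (π g⁻¹ v) = v := by
  rw [← rep_mul_apply, mul_inv_cancel, rep_one_apply]

theorem rep_injective (π : Representation ℂ G V) (g : G) : Function.Injective (π g) :=
  Function.LeftInverse.injective (rep_inv_self_apply π g)

theorem dual_rep_apply (π : Representation ℂ G V) (g : G) (l : Module.Dual ℂ V) (v : V) :
    π.dual g l v = l (π g⁻¹ v) := rfl

theorem RepIso.symm {π : Representation ℂ G V} {π' : Representation ℂ G V'}
    (h : RepIso π π') : RepIso π' π := by
  obtain ⟨e, he⟩ := h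
  refine ⟨e.symm, fun g v => ?_⟩
  apply e.injective
  rw [he, e.apply_symm_apply, e.apply_symm_apply]

theorem RepIso.trans {π : Representation ℂ G V} {π' : Representation ℂ G V'}
    {π'' : Representation ℂ G V''} (h : RepIso π π') (h' : RepIso π' π'') : RepIso π π'' := by
  obtain ⟨e, he⟩ := h
  obtain ⟨e', he'⟩ := h'
  exact ⟨e.trans e', fun g v => by simp [he, he']⟩

theorem RepIso.dual {π : Representation ℂ G V} {π' : Representation ℂ G V'}
    (h : RepIso π π') : RepIso π.dual π'.dual := by
  obtain ⟨e, he⟩ := h.symm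
  refine ⟨e.dualMap, fun g l => ?_⟩
  ext v
  simp only [LinearEquiv.dualMap_apply, dual_rep_apply, he]

theorem RepIso.dual_dual [FiniteDimensional ℂ V] (π : Representation ℂ G V) :
    RepIso π π.dual.dual := by
  refine ⟨Module.evalEquiv ℂ V, fun g v => ?_⟩
  ext l
  change l (π g v) = l (π g⁻¹⁻¹ v)
  rw [inv_inv]

theorem IsIrred.comp {H : Type*} [Group H] {π : Representation ℂ G V} (h : IsIrred π)
    (φ : H →* G) (hφ : Function.Surjective φ) : IsIrred (π.comp φ) := by
  refine ⟨h.1, fun U hU => h.2 U fun g v hv => ?_⟩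
  obtain ⟨x, rfl⟩ := hφ g
  exact hU x v hv

theorem IsIrred.injective {π : Representation ℂ G V} (h : IsIrred π)
    {π' : Representation ℂ G V'} (T : V →ₗ[ℂ] V') (hT : ∀ g v, T (π g v) = π' g (T v))
    (hne : T ≠ 0) : Function.Injective T := by
  rw [← LinearMap.ker_eq_bot]
  refine (h.2 (LinearMap.ker T) fun g v hv => ?_).resolve_right fun hk => hne ?_
  · rw [LinearMap.mem_ker] at hv ⊢
    rw [hT, hv, map_zero]
  · exact LinearMap.ker_eq_top.mp hk

theorem IsIrred.surjective {π : Representation ℂ G V}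
    {π' : Representation ℂ G V'} (h : IsIrred π') (T : V →ₗ[ℂ] V')
    (hT : ∀ g v, T (π g v) = π' g (T v)) (hne : T ≠ 0) : Function.Surjective T := by
  rw [← LinearMap.range_eq_top]
  refine (h.2 (LinearMap.range T) fun g v hv => ?_).resolve_left fun hk => hne ?_
  · obtain ⟨u, rfl⟩ := hv
    exact ⟨π g u, hT g u⟩
  · exact LinearMap.range_eq_bot.mp hk

theorem IsIrred.repIso {π : Representation ℂ G V} {π' : Representation ℂ G V'}
    (h : IsIrred π) (h' : IsIrred π') (T : V →ₗ[ℂ] V')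
    (hT : ∀ g v, T (π g v) = π' g (T v)) (hne : T ≠ 0) : RepIso π π' :=
  ⟨LinearEquiv.ofBijective T ⟨h.injective T hT hne, h'.surjective T hT hne⟩, hT⟩

theorem IsIrred.nontrivial {π : Representation ℂ G V} (h : IsIrred π) : Nontrivial V := by
  obtain ⟨v, hv⟩ := h.1
  exact ⟨v, 0, hv⟩

theorem IsIrred.scalar [FiniteDimensional ℂ V] {π : Representation ℂ G V} (h : IsIrred π)
    (T : V →ₗ[ℂ] V) (hT : ∀ g v, T (π g v) = π g (T v)) : ∃ z : ℂ, ∀ v, T v = z • v := by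
  have := h.nontrivial
  obtain ⟨z, hz⟩ := Module.End.exists_eigenvalue (K := ℂ) T
  obtain ⟨v, hv⟩ := hz.exists_hasEigenvector
  refine ⟨z, fun u => ?_⟩
  by_contra hu
  have hne : T - z • LinearMap.id ≠ 0 := by
    intro h0
    have := LinearMap.congr_fun h0 u
    simp only [LinearMap.sub_apply, LinearMap.smul_apply, LinearMap.id_apply,
      LinearMap.zero_apply, sub_eq_zero] at this
    exact hu this
  have hinj := h.injective (π' := π) (T - z • LinearMap.id) (fun g v => by simp [hT]) hne
  apply hv.2
  apply hinj
  simp [hv.apply_eq_smul]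

/-- A nonzero invariant pairing between irreducible representations identifies each with the
dual of the other. -/
theorem IsIrred.repIso_dual [FiniteDimensional ℂ V] [FiniteDimensional ℂ V']
    {π : Representation ℂ G V} {π' : Representation ℂ G V'} (h : IsIrred π) (h' : IsIrred π')
    (B : V →ₗ[ℂ] V' →ₗ[ℂ] ℂ) (hB : ∀ g v v', B (π g v) (π' g v') = B v v') (hne : B ≠ 0) :
    RepIso π.dual π' := by
  have hB' : ∀ g v v', B (π g v) v' = B v (π' g⁻¹ v') := fun g v v' => by
    rw [← hB g v, rep_self_inv_apply]
  have h1 : Function.Injective B := h.injective (π' := π'.dual) B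
    (fun g v => LinearMap.ext fun v' => hB' g v v') hne
  have h2 : Function.Injective B.flip := h'.injective (π' := π.dual) B.flip
    (fun g v => LinearMap.ext fun v' => by
      simp only [LinearMap.flip_apply, dual_rep_apply]
      rw [← hB g (π g⁻¹ v'), rep_self_inv_apply])
    (fun h0 => hne (LinearMap.ext₂ fun v v' => LinearMap.congr_fun₂ h0 v' v))
  have d1 := LinearMap.finrank_le_finrank_of_injective h1
  have d2 := LinearMap.finrank_le_finrank_of_injective h2
  have e1 : Module.finrank ℂ (V' →ₗ[ℂ] ℂ) = Module.finrank ℂ V' := Subspace.dual_finrank_eq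
  have e2 : Module.finrank ℂ (V →ₗ[ℂ] ℂ) = Module.finrank ℂ V := Subspace.dual_finrank_eq
  have hbij : Function.Bijective B.flip :=
    ⟨h2, (LinearMap.injective_iff_surjective_of_finrank_eq_finrank (by omega)).mp h2⟩
  refine RepIso.symm ⟨LinearEquiv.ofBijective B.flip hbij, fun g v => LinearMap.ext fun v' => ?_⟩
  simp only [LinearEquiv.ofBijective_apply, LinearMap.flip_apply, dual_rep_apply]
  rw [← hB g (π g⁻¹ v'), rep_self_inv_apply]

/-- Averaging a rank one operator over an irreducible representation. -/
theorem IsIrred.sum_coef_smul [Fintype G] [FiniteDimensional ℂ V] {π : Representation ℂ G V}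
    (h : IsIrred π) (l : Module.Dual ℂ V) (v w : V) :
    ∑ g, l (π g⁻¹ v) • π g w
      = ((Fintype.card G : ℂ) / (Module.finrank ℂ V : ℂ) * l w) • v := by
  have := h.nontrivial
  set T : V →ₗ[ℂ] V := ∑ g, π g ∘ₗ (l.smulRight w) ∘ₗ π g⁻¹ with hT
  have hTa : ∀ v, T v = ∑ g, l (π g⁻¹ v) • π g w := fun v => by
    simp [hT, LinearMap.sum_apply]
  have hTe : ∀ x v, T (π x v) = π x (T v) := by
    intro x v
    rw [hTa, hTa, map_sum, ← Equiv.sum_comp (Equiv.mulLeft x)]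
    refine Finset.sum_congr rfl fun g _ => ?_
    rw [Equiv.coe_mulLeft, ← rep_mul_apply, _root_.mul_inv_rev, inv_mul_cancel_right, rep_mul_apply,
      map_smul]
  obtain ⟨z, hz⟩ := h.scalar T hTe
  have htr : LinearMap.trace ℂ V T = (Fintype.card G : ℂ) * l w := by
    rw [hT, map_sum]
    have : ∀ g, LinearMap.trace ℂ V (π g ∘ₗ (l.smulRight w) ∘ₗ π g⁻¹) = l w := by
      intro g
      rw [LinearMap.trace_comp_comm', LinearMap.comp_assoc]
      rw [show π g⁻¹ ∘ₗ π g = LinearMap.id from LinearMap.ext (rep_inv_self_apply π g)]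
      rw [LinearMap.comp_id, LinearMap.trace_smulRight]
    simp [this]
  have htr2 : LinearMap.trace ℂ V T = z * (Module.finrank ℂ V : ℂ) := by
    rw [show T = z • LinearMap.id from LinearMap.ext hz, map_smul, LinearMap.trace_id, smul_eq_mul]
  have hd : (Module.finrank ℂ V : ℂ) ≠ 0 := by
    exact_mod_cast (Module.finrank_pos (R := ℂ) (M := V)).ne'
  rw [← hTa, hz, div_mul_eq_mul_div, ← htr, htr2, mul_div_assoc, div_self hd, mul_one]

/-- A rank one operator is a combination of the operators of an irreducible representation. -/
theorem IsIrred.smulRight_eq_sum [Fintype G] [FiniteDimensional ℂ V] {π : Representation ℂ G V}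
    (h : IsIrred π) (l : Module.Dual ℂ V) (v : V) :
    ∃ z : G → ℂ, l.smulRight v = ∑ g, z g • π g := by
  have := h.nontrivial
  have hd : (Module.finrank ℂ V : ℂ) ≠ 0 := by
    exact_mod_cast (Module.finrank_pos (R := ℂ) (M := V)).ne'
  have hc : (Fintype.card G : ℂ) ≠ 0 := by exact_mod_cast Fintype.card_ne_zero
  refine ⟨fun g => (Module.finrank ℂ V : ℂ) / (Fintype.card G : ℂ) * l (π g⁻¹ v),
    LinearMap.ext fun w => ?_⟩
  have := h.sum_coef_smul l v w
  simp only [LinearMap.smulRight_apply, LinearMap.sum_apply, LinearMap.smul_apply, mul_smul,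
    ← Finset.smul_sum, this]
  rw [← mul_smul, ← mul_smul]
  congr 1
  field_simp

/-- An irreducible representation is self-dual as soon as a combination of its matrix
coefficients, nonzero at the identity, is also a combination of coefficients of `g ↦ π g⁻¹`. -/
theorem IsIrred.selfDual_of_coef [Fintype G] [FiniteDimensional ℂ V] {π : Representation ℂ G V}
    (h : IsIrred π) {ι κ : Type*} [Fintype ι] [Fintype κ] (φ : G → ℂ)
    (l : ι → Module.Dual ℂ V) (v : ι → V) (l' : κ → Module.Dual ℂ V) (v' : κ → V)
    (h1 : ∀ g, φ g = ∑ i, l i (π g (v i))) (h2 : ∀ g, φ g = ∑ j, l' j (π g⁻¹ (v' j)))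
    (hφ : φ 1 ≠ 0) : RepIso π π.dual := by
  have := h.nontrivial
  have hd : (Module.finrank ℂ V : ℂ) ≠ 0 := by
    exact_mod_cast (Module.finrank_pos (R := ℂ) (M := V)).ne'
  have hc : (Fintype.card G : ℂ) ≠ 0 := by exact_mod_cast Fintype.card_ne_zero
  have hS : ∑ g, φ g • π g ≠ 0 := by
    have e : ∑ g, φ g • π g
        = ((Fintype.card G : ℂ) / (Module.finrank ℂ V : ℂ)) • ∑ j, (l' j).smulRight (v' j) := by
      ext w
      simp only [LinearMap.sum_apply, LinearMap.smul_apply, h2, Finset.sum_smul,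
        LinearMap.smulRight_apply]
      rw [Finset.sum_comm, Finset.smul_sum]
      refine Finset.sum_congr rfl fun j _ => ?_
      rw [h.sum_coef_smul, mul_smul]
    rw [e]
    intro h0
    have := congrArg (LinearMap.trace ℂ V) h0
    rw [map_smul, map_sum, map_zero] at this
    simp only [LinearMap.trace_smulRight] at this
    have h3 := h2 1
    simp only [inv_one, rep_one_apply] at h3
    rw [← h3, smul_eq_mul] at this
    exact mul_ne_zero (div_ne_zero hc hd) hφ this
  have : ∃ (l₁ l₂ : Module.Dual ℂ V) (v₁ v₂ : V), ∑ g, l₁ (π g v₁) * l₂ (π g v₂) ≠ 0 := by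
    by_contra! hcon
    apply hS
    ext w
    rw [LinearMap.zero_apply]
    refine (Module.forall_dual_apply_eq_zero_iff ℂ _).mp fun m => ?_
    simp only [LinearMap.sum_apply, LinearMap.smul_apply, map_sum, map_smul, smul_eq_mul, h1,
      Finset.sum_mul]
    rw [Finset.sum_comm]
    exact Finset.sum_eq_zero fun i _ => hcon _ _ _ _
  obtain ⟨l₁, l₂, v₁, v₂, hne⟩ := this
  refine (h.repIso_dual h (∑ g, ((l₁ ∘ₗ π g).smulRight (l₂ ∘ₗ π g))) (fun x v w => ?_)
    (fun h0 => ?_)).symm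
  · simp only [LinearMap.sum_apply, LinearMap.smulRight_apply, LinearMap.smul_apply,
      LinearMap.comp_apply, smul_eq_mul]
    rw [← Equiv.sum_comp (Equiv.mulRight x)
      (fun g => l₁ (π g v) * l₂ (π g w))]
    simp
  · apply hne
    have := LinearMap.congr_fun₂ h0 v₁ v₂
    simpa [LinearMap.sum_apply] using this

/-- Two irreducible representations of the same group with non-orthogonal coefficients are
dual to each other. -/
theorem IsIrred.repIso_dual_of_sum_ne_zero [Fintype G] [FiniteDimensional ℂ V]
    [FiniteDimensional ℂ V'] {π : Representation ℂ G V} {π' : Representation ℂ G V'}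
    (h : IsIrred π) (h' : IsIrred π') (l₁ : Module.Dual ℂ V) (l₂ : Module.Dual ℂ V')
    (v₁ : V) (v₂ : V') (hne : ∑ g, l₁ (π g v₁) * l₂ (π' g v₂) ≠ 0) : RepIso π.dual π' := by
  refine h.repIso_dual h' (∑ g, ((l₁ ∘ₗ π g).smulRight (l₂ ∘ₗ π' g))) (fun x v w => ?_)
    (fun h0 => ?_)
  · simp only [LinearMap.sum_apply, LinearMap.smulRight_apply, LinearMap.smul_apply,
      LinearMap.comp_apply, smul_eq_mul]
    rw [← Equiv.sum_comp (Equiv.mulRight x)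
      (fun g => l₁ (π g v) * l₂ (π' g w))]
    simp
  · apply hne
    have := LinearMap.congr_fun₂ h0 v₁ v₂
    simpa [LinearMap.sum_apply] using this

/-- Two irreducible representations with coefficients not orthogonal in the twisted sense are
isomorphic. -/
theorem IsIrred.repIso_of_sum_ne_zero [Fintype G] {π : Representation ℂ G V}
    {π' : Representation ℂ G V'}
    (h : IsIrred π) (h' : IsIrred π') (l₁ : Module.Dual ℂ V) (l₂ : Module.Dual ℂ V')
    (v₁ : V) (v₂ : V') (hne : ∑ g, l₁ (π g v₁) * l₂ (π' g⁻¹ v₂) ≠ 0) : RepIso π π' := by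
  set T : V →ₗ[ℂ] V' := ∑ g, (l₁ ∘ₗ π g).smulRight (π' g⁻¹ v₂) with hT
  have hTa : ∀ v, T v = ∑ g, l₁ (π g v) • π' g⁻¹ v₂ := fun v => by
    simp [hT, LinearMap.sum_apply]
  refine h.repIso h' T (fun x v => ?_) (fun h0 => hne ?_)
  · rw [hTa, hTa, map_sum, ← Equiv.sum_comp (Equiv.mulRight x⁻¹)]
    refine Finset.sum_congr rfl fun g _ => ?_
    rw [Equiv.coe_mulRight, ← rep_mul_apply, inv_mul_cancel_right, _root_.mul_inv_rev, inv_inv,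
      rep_mul_apply, map_smul]
  · have := congrArg l₂ (LinearMap.congr_fun h0 v₁)
    rw [hTa, map_sum] at this
    simpa using this

/-- An operator on a finite-dimensional space is a combination of rank one operators. -/
theorem end_eq_sum_smulRight [FiniteDimensional ℂ V] (E : V →ₗ[ℂ] V) :
    E = ∑ i, ((Module.finBasis ℂ V).coord i).smulRight (E (Module.finBasis ℂ V i)) := by
  refine (Module.finBasis ℂ V).ext fun j => ?_
  rw [LinearMap.sum_apply, Finset.sum_eq_single j]
  · simp
  · intro i _ hij
    simp [hij.symm]
  · simp

theorem end_eq_sum_sum [FiniteDimensional ℂ V] (E : V →ₗ[ℂ] V) :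
    E = ∑ i, ∑ j, (Module.finBasis ℂ V).coord j (E (Module.finBasis ℂ V i)) •
      ((Module.finBasis ℂ V).coord i).smulRight (Module.finBasis ℂ V j) := by
  conv_lhs => rw [end_eq_sum_smulRight E]
  refine Finset.sum_congr rfl fun i _ => LinearMap.ext fun v => ?_
  simp only [LinearMap.smulRight_apply, LinearMap.sum_apply, LinearMap.smul_apply]
  conv_lhs => rw [← (Module.finBasis ℂ V).sum_repr (E (Module.finBasis ℂ V i))]
  rw [Finset.smul_sum]
  exact Finset.sum_congr rfl fun j _ => smul_comm _ _ _

theorem sum_comm_pairs {ι κ Z : Type*} [Fintype ι] [Fintype κ] [AddCommMonoid Z]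
    (φ : κ → κ → ι → ι → Z) :
    ∑ x, ∑ y, ∑ z, ∑ w, φ x y z w = ∑ z, ∑ w, ∑ x, ∑ y, φ x y z w := by
  have := Finset.sum_comm (s := (Finset.univ : Finset (κ × κ))) (t := (Finset.univ : Finset (ι × ι)))
    (f := fun p q => φ p.1 p.2 q.1 q.2)
  simpa only [Fintype.sum_prod_type] using this

/-- If all products of coefficients of two families of operators sum to zero, so do all products
of their images under linear maps into an algebra. -/
theorem sum_mul_eq_zero_of_coef [FiniteDimensional ℂ V] [FiniteDimensional ℂ V']
    {ι : Type*} [Fintype ι] {E : ι → V →ₗ[ℂ] V} {E' : ι → V' →ₗ[ℂ] V'}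
    (h : ∀ (l : Module.Dual ℂ V) (l' : Module.Dual ℂ V') (v : V) (v' : V'),
      ∑ i, l (E i v) * l' (E' i v') = 0)
    {X Y Z : Type*} [AddCommGroup X] [Module ℂ X] [AddCommGroup Y] [Module ℂ Y]
    [AddCommGroup Z] [Module ℂ Z] (B : X →ₗ[ℂ] Y →ₗ[ℂ] Z)
    (S : (V →ₗ[ℂ] V) →ₗ[ℂ] X) (S' : (V' →ₗ[ℂ] V') →ₗ[ℂ] Y) :
    ∑ i, B (S (E i)) (S' (E' i)) = 0 := by
  have key : ∀ i, B (S (E i)) (S' (E' i)) = ∑ a, ∑ b, ∑ a', ∑ b',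
      ((Module.finBasis ℂ V).coord b (E i (Module.finBasis ℂ V a)) *
        (Module.finBasis ℂ V').coord b' (E' i (Module.finBasis ℂ V' a'))) •
      B (S (((Module.finBasis ℂ V).coord a).smulRight (Module.finBasis ℂ V b)))
        (S' (((Module.finBasis ℂ V').coord a').smulRight (Module.finBasis ℂ V' b'))) := by
    intro i
    conv_lhs => rw [end_eq_sum_sum (E i), end_eq_sum_sum (E' i)]
    simp only [map_sum S, map_sum S', map_sum B, LinearMap.sum_apply, map_smul,
      LinearMap.smul_apply, map_sum, Finset.smul_sum, mul_smul]
    rw [sum_comm_pairs]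
    refine Finset.sum_congr rfl fun _ _ => Finset.sum_congr rfl fun _ _ =>
      Finset.sum_congr rfl fun _ _ => Finset.sum_congr rfl fun _ _ => smul_comm _ _ _
  simp only [key]
  rw [Finset.sum_comm]
  refine Finset.sum_eq_zero fun a _ => ?_
  rw [Finset.sum_comm]
  refine Finset.sum_eq_zero fun b _ => ?_
  rw [Finset.sum_comm]
  refine Finset.sum_eq_zero fun a' _ => ?_
  rw [Finset.sum_comm]
  refine Finset.sum_eq_zero fun b' _ => ?_
  rw [← Finset.sum_smul, h, zero_smul]

/-- A nonzero equivariant map has an equivariant generalized inverse. -/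
theorem exists_equivariant_pseudoinverse [Fintype G] (x : Representation ℂ G V)
    (y : Representation ℂ G V') (δ : V →ₗ[ℂ] V') (hδ : ∀ g v, δ (x g v) = y g (δ v)) :
    ∃ ε : V' →ₗ[ℂ] V, (∀ g v, ε (y g v) = x g (ε v)) ∧ ∀ v, δ (ε (δ v)) = δ v := by
  have hc : (Fintype.card G : ℂ) ≠ 0 := by exact_mod_cast Fintype.card_ne_zero
  obtain ⟨s, hs⟩ := δ.rangeRestrict.exists_rightInverse_of_surjective δ.range_rangeRestrict
  obtain ⟨s', hs'⟩ := s.exists_extend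
  have h1 : ∀ v, δ (s' (δ v)) = δ v := by
    intro v
    have e1 : s' (δ v) = s (δ.rangeRestrict v) := by
      rw [← hs']; rfl
    rw [e1]
    exact congrArg Subtype.val (LinearMap.congr_fun hs (δ.rangeRestrict v))
  set ε : V' →ₗ[ℂ] V := (Fintype.card G : ℂ)⁻¹ • ∑ g, x g ∘ₗ s' ∘ₗ y g⁻¹ with hε
  have hεa : ∀ v, ε v = (Fintype.card G : ℂ)⁻¹ • ∑ g, x g (s' (y g⁻¹ v)) := fun v => by
    simp [hε, LinearMap.sum_apply]
  refine ⟨ε, fun g v => ?_, fun v => ?_⟩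
  · rw [hεa, hεa, map_smul, map_sum, ← Equiv.sum_comp (Equiv.mulLeft g)]
    congr 1
    refine Finset.sum_congr rfl fun k _ => ?_
    rw [Equiv.coe_mulLeft, ← rep_mul_apply y, _root_.mul_inv_rev, inv_mul_cancel_right, rep_mul_apply]
  · rw [hεa, map_smul, map_sum]
    have : ∀ g, δ (x g (s' (y g⁻¹ (δ v)))) = δ v := by
      intro g
      rw [← hδ, hδ, h1, hδ, rep_self_inv_apply]
    simp [this, ← Nat.cast_smul_eq_nsmul ℂ, smul_smul, hc]

/-- Complete reducibility: a finite-dimensional representation all of whose equivariant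
endomorphisms are scalar is irreducible. -/
theorem isIrred_of_scalar [Fintype G] (π : Representation ℂ G V) (hne : ∃ v : V, v ≠ 0)
    (h : ∀ T : V →ₗ[ℂ] V, (∀ g v, T (π g v) = π g (T v)) → ∃ z : ℂ, ∀ v, T v = z • v) :
    IsIrred π := by
  refine ⟨hne, fun U hU => ?_⟩
  let u : Representation ℂ G U :=
    { toFun := fun g => (π g).restrict (hU g)
      map_one' := by ext v; simp
      map_mul' := fun a b => by ext v; simp }
  obtain ⟨ε, hε, hε2⟩ := exists_equivariant_pseudoinverse u π U.subtype (fun _ _ => rfl)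
  obtain ⟨z, hz⟩ := h (U.subtype ∘ₗ ε) (fun g v => by
    rw [LinearMap.comp_apply, hε]; rfl)
  have h3 : ∀ v ∈ U, z • v = v := fun v hv => by
    rw [← hz]; exact hε2 ⟨v, hv⟩
  rw [or_iff_not_imp_left]
  intro hb
  obtain ⟨v, hv, hv0⟩ := Submodule.exists_mem_ne_zero_of_ne_bot hb
  have hz1 : z = 1 := by
    have := h3 v hv
    by_contra hz1
    apply hv0
    have h4 : (z - 1) • v = 0 := by rw [sub_smul, this, one_smul, sub_self]
    exact (smul_eq_zero.mp h4).resolve_left (sub_ne_zero.mpr hz1)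
  rw [eq_top_iff]
  intro w _
  have := hz w
  rw [hz1, one_smul] at this
  rw [← this]
  exact (ε w).2

end RepBasics

section ConjGL

variable {F : Type*} [Field F]

/-- Conjugation by mutually inverse rectangular matrices. -/
def conjGL {a b : ℕ} (θ : Matrix (Fin a) (Fin b) F) (θ' : Matrix (Fin b) (Fin a) F)
    (h1 : θ * θ' = 1) (h2 : θ' * θ = 1) : GL (Fin a) F →* GL (Fin b) F where
  toFun h := ⟨θ' * h.val * θ, θ' * (h⁻¹).val * θ, by
      calc θ' * h.val * θ * (θ' * (h⁻¹).val * θ)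
          = θ' * (h.val * (θ * θ') * (h⁻¹).val) * θ := by simp only [Matrix.mul_assoc]
        _ = 1 := by rw [h1, Matrix.mul_one, Units.mul_inv, Matrix.mul_one, h2], by
      calc θ' * (h⁻¹).val * θ * (θ' * h.val * θ)
          = θ' * ((h⁻¹).val * (θ * θ') * h.val) * θ := by simp only [Matrix.mul_assoc]
        _ = 1 := by rw [h1, Matrix.mul_one, Units.inv_mul, Matrix.mul_one, h2]⟩
  map_one' := by
    apply Units.ext
    simp [h2]
  map_mul' g h := by
    apply Units.ext
    show θ' * (g.val * h.val) * θ = θ' * g.val * θ * (θ' * h.val * θ)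
    calc θ' * (g.val * h.val) * θ = θ' * (g.val * 1 * h.val) * θ := by rw [Matrix.mul_one]
      _ = _ := by rw [← h1]; simp only [Matrix.mul_assoc]

theorem conjGL_val {a b : ℕ} (θ : Matrix (Fin a) (Fin b) F) (θ' : Matrix (Fin b) (Fin a) F)
    (h1 : θ * θ' = 1) (h2 : θ' * θ = 1) (h : GL (Fin a) F) :
    (conjGL θ θ' h1 h2 h).val = θ' * h.val * θ := rfl

theorem conjGL_surjective {a b : ℕ} (θ : Matrix (Fin a) (Fin b) F) (θ' : Matrix (Fin b) (Fin a) F)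
    (h1 : θ * θ' = 1) (h2 : θ' * θ = 1) : Function.Surjective (conjGL θ θ' h1 h2) := by
  intro g
  refine ⟨conjGL θ' θ h2 h1 g, Units.ext ?_⟩
  rw [conjGL_val, conjGL_val]
  calc θ' * (θ * g.val * θ') * θ = (θ' * θ) * g.val * (θ' * θ) := by
        simp only [Matrix.mul_assoc]
    _ = g.val := by rw [h2, Matrix.one_mul, Matrix.mul_one]

theorem castGL_rfl {a : ℕ} (h : a = a) (g : GL (Fin a) F) : castGL h g = g := by
  apply Units.ext
  ext i j
  rfl

/-- An isomorphism up to conjugation by rectangular matrices is an isomorphism. -/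
theorem repIso_castGL {a b : ℕ} {V V' : Type*} [AddCommGroup V] [Module ℂ V]
    [AddCommGroup V'] [Module ℂ V'] {ρ : Representation ℂ (GL (Fin a) F) V}
    {ρ' : Representation ℂ (GL (Fin b) F) V'}
    (θ : Matrix (Fin a) (Fin b) F) (θ' : Matrix (Fin b) (Fin a) F)
    (h1 : θ * θ' = 1) (h2 : θ' * θ = 1) (h : RepIso ρ (ρ'.comp (conjGL θ θ' h1 h2))) :
    ∃ hab : a = b, RepIso ρ (ρ'.comp (castGL hab).toMonoidHom) := by
  have hab : a = b := by
    simpa using Matrix.square_of_invertible θ θ' h1 h2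
  subst hab
  refine ⟨rfl, h.trans ?_⟩
  let u : GL (Fin a) F := ⟨θ, θ', h1, h2⟩
  have hu : ∀ g, conjGL θ θ' h1 h2 g = u⁻¹ * g * u := fun g => Units.ext rfl
  have hs : Function.Surjective (ρ' u) := fun v => ⟨ρ' u⁻¹ v, rep_self_inv_apply ρ' u v⟩
  refine ⟨LinearEquiv.ofBijective (ρ' u) ⟨rep_injective ρ' u, hs⟩, fun g v => ?_⟩
  change ρ' u (ρ' (conjGL θ θ' h1 h2 g) v) = ρ' (castGL rfl g) (ρ' u v)
  rw [hu, castGL_rfl, ← rep_mul_apply, ← rep_mul_apply]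
  congr 2
  group

end ConjGL

section TensorSlots

variable {ι : Type*} [Fintype ι] [DecidableEq ι]
  {V : ι → Type*} [∀ a, AddCommGroup (V a)] [∀ a, Module ℂ (V a)]
  {W : ι → Type*} [∀ a, AddCommGroup (W a)] [∀ a, Module ℂ (W a)]
  {G : ι → Type*} [∀ a, Group (G a)]

omit [DecidableEq ι] in
theorem piTensorRep_tprod (π : ∀ a, Representation ℂ (G a) (V a)) (g : ∀ a, G a) (v : ∀ a, V a) :
    piTensorRep π g (PiTensorProduct.tprod ℂ v) = PiTensorProduct.tprod ℂ fun a => π a (g a) (v a) :=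
  PiTensorProduct.map_tprod _ _

omit [DecidableEq ι] in
theorem piTensorRep_eq_map (π : ∀ a, Representation ℂ (G a) (V a)) (g : ∀ a, G a) :
    piTensorRep π g = PiTensorProduct.map fun a => π a (g a) := rfl

/-- An operator acting on a single tensor factor. -/
def tensorSlot (b : ι) : (V b →ₗ[ℂ] V b) →ₗ[ℂ] ((⨂[ℂ] a, V a) →ₗ[ℂ] (⨂[ℂ] a, V a)) :=
  (PiTensorProduct.mapMultilinear ℂ V V).toLinearMap (fun _ => LinearMap.id) b

theorem piTensorRep_mulSingle (π : ∀ a, Representation ℂ (G a) (V a)) (b : ι) (h : G b) :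
    piTensorRep π (Pi.mulSingle b h) = tensorSlot b (π b h) := by
  rw [piTensorRep_eq_map]
  change PiTensorProduct.map _ = PiTensorProduct.map _
  congr 1
  funext a
  by_cases hab : a = b
  · subst hab
    simp
  · rw [Pi.mulSingle_eq_of_ne hab, Function.update_of_ne hab, map_one]
    rfl

/-- The tensor product of linear forms. -/
def tensorForm (l : ∀ a, Module.Dual ℂ (V a)) : (⨂[ℂ] a, V a) →ₗ[ℂ] ℂ :=
  PiTensorProduct.lift ((MultilinearMap.mkPiAlgebra ℂ ι ℂ).compLinearMap l)

omit [DecidableEq ι] in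
theorem tensorForm_tprod (l : ∀ a, Module.Dual ℂ (V a)) (v : ∀ a, V a) :
    tensorForm l (PiTensorProduct.tprod ℂ v) = ∏ a, l a (v a) := by
  simp [tensorForm]

omit [DecidableEq ι] in
theorem map_smulRight_apply (l : ∀ a, Module.Dual ℂ (V a)) (v : ∀ a, V a) (x : ⨂[ℂ] a, V a) :
    PiTensorProduct.map (fun a => (l a).smulRight (v a)) x
      = tensorForm l x • PiTensorProduct.tprod ℂ v := by
  have : PiTensorProduct.map (fun a => (l a).smulRight (v a))
      = (tensorForm l).smulRight (PiTensorProduct.tprod ℂ v) := by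
    ext u
    simp only [LinearMap.compMultilinearMap_apply, PiTensorProduct.map_tprod,
      LinearMap.smulRight_apply, tensorForm_tprod, MultilinearMap.map_smul_univ]
  rw [this]
  rfl

omit [DecidableEq ι] in
theorem tprod_ne_zero {v : ∀ a, V a} (hv : ∀ a, v a ≠ 0) : PiTensorProduct.tprod ℂ v ≠ 0 := by
  choose l hl using fun a => Module.Projective.exists_dual_ne_zero ℂ (hv a)
  intro h
  have h1 := tensorForm_tprod l v
  rw [h, map_zero] at h1
  exact Finset.prod_ne_zero_iff.mpr (fun a _ => hl a) h1.symm

omit [DecidableEq ι] in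
theorem piTensorRep_scalar [∀ a, Fintype (G a)] [∀ a, FiniteDimensional ℂ (V a)]
    {π : ∀ a, Representation ℂ (G a) (V a)} (hπ : ∀ a, IsIrred (π a))
    (T : (⨂[ℂ] a, V a) →ₗ[ℂ] (⨂[ℂ] a, V a))
    (hT : ∀ g v, T (piTensorRep π g v) = piTensorRep π g (T v)) :
    ∃ z : ℂ, ∀ v, T v = z • v := by
  classical
  choose u hu using fun a => (hπ a).1
  choose l hl using fun a => Module.Projective.exists_dual_ne_zero ℂ (hu a)
  have hlu : tensorForm l (PiTensorProduct.tprod ℂ u) ≠ 0 := by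
    rw [tensorForm_tprod]
    exact Finset.prod_ne_zero_iff.mpr fun a _ => hl a
  refine ⟨(tensorForm l (PiTensorProduct.tprod ℂ u))⁻¹ *
    tensorForm l (T (PiTensorProduct.tprod ℂ u)), fun v => ?_⟩
  suffices h : T = ((tensorForm l (PiTensorProduct.tprod ℂ u))⁻¹ *
      tensorForm l (T (PiTensorProduct.tprod ℂ u))) • LinearMap.id from LinearMap.congr_fun h v
  ext v
  simp only [LinearMap.compMultilinearMap_apply, LinearMap.smul_apply, LinearMap.id_apply]
  choose z hz using fun a => (hπ a).smulRight_eq_sum (l a) (v a)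
  have hE : PiTensorProduct.map (fun a => (l a).smulRight (v a))
      = ∑ g : ∀ a, G a, (∏ a, z a (g a)) • piTensorRep π g := by
    change PiTensorProduct.mapMultilinear ℂ V V (fun a => (l a).smulRight (v a)) = _
    simp only [hz]
    rw [MultilinearMap.map_sum]
    refine Finset.sum_congr rfl fun g _ => ?_
    rw [MultilinearMap.map_smul_univ]
    rfl
  have hc : T (PiTensorProduct.map (fun a => (l a).smulRight (v a)) (PiTensorProduct.tprod ℂ u))
      = PiTensorProduct.map (fun a => (l a).smulRight (v a)) (T (PiTensorProduct.tprod ℂ u)) := by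
    rw [hE]
    simp only [LinearMap.sum_apply, LinearMap.smul_apply, map_sum, map_smul, hT]
  rw [map_smulRight_apply, map_smulRight_apply, map_smul] at hc
  rw [mul_smul, ← hc, smul_smul, inv_mul_cancel₀ hlu, one_smul]

omit [DecidableEq ι] in
theorem exists_map_piTensorRep_ne_zero [∀ a, Fintype (G a)]
    {π : ∀ a, Representation ℂ (G a) (V a)} (hπ : ∀ a, IsIrred (π a))
    (δ : ∀ a, V a →ₗ[ℂ] W a) (hδ : ∀ a, δ a ≠ 0) (v : ⨂[ℂ] a, V a) (hv : v ≠ 0) :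
    ∃ h : ∀ a, G a, PiTensorProduct.map δ (piTensorRep π h v) ≠ 0 := by
  classical
  have hz : ∀ a, ∃ z : G a → (W a →ₗ[ℂ] V a),
      ∑ h, z h ∘ₗ δ a ∘ₗ π a h = LinearMap.id := by
    intro a
    let Θ : V a →ₗ[ℂ] (G a → W a) := LinearMap.pi fun h => δ a ∘ₗ π a h
    have hΘ : LinearMap.ker Θ = ⊥ := by
      refine ((hπ a).2 (LinearMap.ker Θ) fun g v hv => ?_).resolve_right fun htop => hδ a ?_
      · rw [LinearMap.mem_ker] at hv ⊢
        funext h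
        have := congrFun hv (h * g)
        simpa [Θ] using this
      · ext v
        have : v ∈ LinearMap.ker Θ := by rw [htop]; trivial
        have := congrFun (LinearMap.mem_ker.mp this) 1
        simpa [Θ] using this
    obtain ⟨L, hL⟩ := Θ.exists_leftInverse_of_injective hΘ
    refine ⟨fun h => L ∘ₗ LinearMap.single ℂ (fun _ => W a) h, LinearMap.ext fun v => ?_⟩
    have h1 : Θ v = ∑ h, Pi.single h (δ a (π a h v)) := by
      rw [Finset.univ_sum_single]
      rfl
    have h2 := LinearMap.congr_fun hL v
    rw [LinearMap.comp_apply, h1, map_sum] at h2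
    simpa [LinearMap.sum_apply] using h2
  choose z hz using hz
  by_contra! hcon
  apply hv
  have h1 : PiTensorProduct.mapMultilinear ℂ V V
      (fun a => ∑ h, z a h ∘ₗ δ a ∘ₗ π a h) v = v := by
    simp only [hz]
    exact LinearMap.congr_fun (PiTensorProduct.map_id (R := ℂ)) v
  rw [MultilinearMap.map_sum, LinearMap.sum_apply] at h1
  rw [← h1]
  refine Finset.sum_eq_zero fun h _ => ?_
  have h2 : PiTensorProduct.mapMultilinear ℂ V V (fun a => z a (h a) ∘ₗ δ a ∘ₗ π a (h a))
      = PiTensorProduct.map (fun a => z a (h a)) ∘ₗ PiTensorProduct.map δ ∘ₗ piTensorRep π h := by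
    rw [piTensorRep_eq_map, ← PiTensorProduct.map_comp, ← PiTensorProduct.map_comp]
    rfl
  rw [h2, LinearMap.comp_apply, LinearMap.comp_apply, hcon, map_zero]

omit [DecidableEq ι] in
theorem exists_comp_piTensorRep_map_ne_zero [∀ a, Fintype (G a)]
    {π : ∀ a, Representation ℂ (G a) (V a)} (hπ : ∀ a, IsIrred (π a))
    (δ : ∀ a, W a →ₗ[ℂ] V a) (hδ : ∀ a, δ a ≠ 0) {Z : Type*} [AddCommGroup Z] [Module ℂ Z]
    (Φ : (⨂[ℂ] a, V a) →ₗ[ℂ] Z) (hΦ : Φ ≠ 0) :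
    ∃ h : ∀ a, G a, Φ ∘ₗ piTensorRep π h ∘ₗ PiTensorProduct.map δ ≠ 0 := by
  classical
  have hz : ∀ a, ∃ z : G a → (V a →ₗ[ℂ] W a),
      ∑ h, π a h ∘ₗ δ a ∘ₗ z h = LinearMap.id := by
    intro a
    let Θ : (G a → W a) →ₗ[ℂ] V a := ∑ h, π a h ∘ₗ δ a ∘ₗ LinearMap.proj h
    have hΘa : ∀ x, Θ x = ∑ h, π a h (δ a (x h)) := fun x => by
      simp [Θ, LinearMap.sum_apply]
    have hΘ : LinearMap.range Θ = ⊤ := by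
      refine ((hπ a).2 (LinearMap.range Θ) fun g v hv => ?_).resolve_left fun hbot => hδ a ?_
      · obtain ⟨x, rfl⟩ := hv
        refine ⟨fun h => x (g⁻¹ * h), ?_⟩
        rw [hΘa, hΘa, map_sum, ← Equiv.sum_comp (Equiv.mulLeft g)]
        simp
      · ext v
        have : Θ (Pi.single 1 v) ∈ LinearMap.range Θ := ⟨_, rfl⟩
        rw [hbot, Submodule.mem_bot, hΘa, Finset.sum_eq_single 1] at this
        · simpa using this
        · intro h _ hh
          simp [hh]
        · simp
    obtain ⟨L, hL⟩ := Θ.exists_rightInverse_of_surjective hΘ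
    refine ⟨fun h => LinearMap.proj h ∘ₗ L, LinearMap.ext fun v => ?_⟩
    have h2 := LinearMap.congr_fun hL v
    rw [LinearMap.comp_apply, hΘa] at h2
    simpa [LinearMap.sum_apply] using h2
  choose z hz using hz
  by_contra! hcon
  apply hΦ
  have h1 : PiTensorProduct.mapMultilinear ℂ V V
      (fun a => ∑ h, π a h ∘ₗ δ a ∘ₗ z a h) = LinearMap.id := by
    simp only [hz]
    exact PiTensorProduct.map_id (R := ℂ)
  rw [MultilinearMap.map_sum] at h1
  ext1
  ext v
  have h3 := congrArg Φ (LinearMap.congr_fun h1 (PiTensorProduct.tprod ℂ v))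
  simp only [LinearMap.compMultilinearMap_apply, LinearMap.zero_apply]
  rw [LinearMap.id_apply] at h3
  rw [← h3, LinearMap.sum_apply, map_sum]
  refine Finset.sum_eq_zero fun h _ => ?_
  have h2 : PiTensorProduct.mapMultilinear ℂ V V (fun a => π a (h a) ∘ₗ δ a ∘ₗ z a (h a))
      = piTensorRep π h ∘ₗ PiTensorProduct.map δ ∘ₗ PiTensorProduct.map (fun a => z a (h a)) := by
    rw [piTensorRep_eq_map, ← PiTensorProduct.map_comp, ← PiTensorProduct.map_comp]
    rfl
  rw [h2]
  exact LinearMap.congr_fun (hcon h)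
    (PiTensorProduct.map (fun a => z a (h a)) (PiTensorProduct.tprod ℂ v))

end TensorSlots

section Cusp

variable {F : Type*} [Field F] {r : ℕ}

/-- Every subspace of `F^r` is carried to a standard coordinate subspace by some matrix. -/
theorem exists_GL_standard_subspace (K : Submodule F (Fin r → F)) :
    ∃ (d : ℕ) (g : GL (Fin r) F), ∀ x, x ∈ K ↔ ∀ i : Fin r, d ≤ i → (g.val *ᵥ x) i = 0 := by
  obtain ⟨C, hC⟩ := K.exists_isCompl
  have hsum : Module.finrank F K + Module.finrank F C = r := by
    rw [Submodule.finrank_add_eq_of_isCompl hC]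
    simp
  let b : Module.Basis (Fin r) F (Fin r → F) :=
    ((((Module.finBasis F K).prod (Module.finBasis F C)).map
      (K.prodEquivOfIsCompl C hC)).reindex finSumFinEquiv).reindex (finCongr hsum)
  let φ := b.equivFun
  let g : GL (Fin r) F := ⟨LinearMap.toMatrix' φ.toLinearMap, LinearMap.toMatrix' φ.symm.toLinearMap,
    by rw [← LinearMap.toMatrix'_comp]; simp, by rw [← LinearMap.toMatrix'_comp]; simp⟩
  have hg : ∀ x, g.val *ᵥ x = φ x := fun x => by
    change LinearMap.toMatrix' φ.toLinearMap *ᵥ x = φ x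
    rw [LinearMap.toMatrix'_mulVec]
    rfl
  refine ⟨Module.finrank F K, g, fun x => ?_⟩
  rw [hg]
  obtain ⟨⟨k, c⟩, rfl⟩ := (K.prodEquivOfIsCompl C hC).surjective x
  have h1 : ∀ j, φ (K.prodEquivOfIsCompl C hC (k, c)) (finCongr hsum (Fin.natAdd _ j))
      = (Module.finBasis F C).repr c j := by
    intro j
    simp [φ, b]
  have h2 : K.prodEquivOfIsCompl C hC (k, c) ∈ K ↔ c = 0 := by
    rw [Submodule.coe_prodEquivOfIsCompl']
    constructor
    · intro h
      have h3 : (c : Fin r → F) ∈ K := by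
        have := K.sub_mem h k.2
        simpa using this
      have h4 := (Submodule.disjoint_def.mp hC.disjoint) _ h3 c.2
      exact Subtype.ext h4
    · rintro rfl
      simp
  rw [h2]
  constructor
  · rintro rfl i hi
    have : i = finCongr hsum (Fin.natAdd (Module.finrank F K)
        ⟨i - Module.finrank F K, by omega⟩) := by
      apply Fin.ext; simp; omega
    rw [this, h1]
    simp
  · intro h
    apply (Module.finBasis F C).repr.injective
    ext j
    rw [← h1, h _ (by simp)]
    simp

theorem IsCuspidal.vec_eq_zero {V : Type*} [AddCommGroup V] [Module ℂ V]
    {ρ : Representation ℂ (GL (Fin r) F) V} (hρ : IsCuspidal ρ) (K : Submodule F (Fin r → F))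
    (hK : K ≠ ⊥) (hK' : K ≠ ⊤) (v : V)
    (hv : ∀ (u : GL (Fin r) F) (n : Matrix (Fin r) (Fin r) F), u.val = 1 + n →
      (∀ x ∈ K, n *ᵥ x = 0) → (∀ x, n *ᵥ x ∈ K) → ρ u v = v) : v = 0 := by
  obtain ⟨d, g, hg⟩ := exists_GL_standard_subspace K
  have hinv : ∀ y, g.val *ᵥ ((g⁻¹).val *ᵥ y) = y := fun y => by
    rw [mulVec_mulVec, Units.mul_inv, one_mulVec]
  have hd0 : 0 < d := by
    by_contra h0
    apply hK
    rw [eq_bot_iff]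
    intro x hx
    have h1 : g.val *ᵥ x = 0 := by
      funext i
      exact (hg x).mp hx i (by omega)
    have h2 : (g⁻¹).val *ᵥ (g.val *ᵥ x) = x := by
      rw [mulVec_mulVec, Units.inv_mul, one_mulVec]
    rw [h1, mulVec_zero] at h2
    exact h2.symm
  have hdr : d < r := by
    by_contra h0
    apply hK'
    rw [eq_top_iff]
    intro x _
    rw [hg]
    intro i hi
    omega
  apply rep_injective ρ g
  rw [map_zero]
  refine hρ 2 (fun i => if (i : ℕ) < d then 0 else 1) le_rfl ?_ ?_ _ fun A hA => ?_
  · intro i j hij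
    have : (i : ℕ) ≤ j := hij
    dsimp only
    split_ifs <;> omega
  · intro c
    fin_cases c
    · exact ⟨⟨0, by omega⟩, by simp [hd0]⟩
    · exact ⟨⟨d, hdr⟩, by simp⟩
  · have hA1 : ∀ i j : Fin r, ¬ ((i : ℕ) < d ∧ d ≤ (j : ℕ)) → (A.val - 1) i j = 0 := by
      intro i j hij
      rw [Matrix.sub_apply, hA i j, sub_self]
      intro h
      by_cases h1 : (i : ℕ) < d <;> by_cases h2 : (j : ℕ) < d
      · simp [h1, h2] at h
      · omega
      · simp [h1, h2] at h
      · simp [h1, h2] at h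
    have key := hv (g⁻¹ * A * g) ((g⁻¹).val * (A.val - 1) * g.val) ?_ ?_ ?_
    · rw [rep_mul_apply, rep_mul_apply] at key
      conv_rhs => rw [← key]
      rw [rep_self_inv_apply]
    · rw [Units.val_mul, Units.val_mul, Matrix.mul_sub, Matrix.sub_mul, Matrix.mul_one,
        Units.inv_mul, add_sub_cancel]
    · intro x hx
      rw [Matrix.mul_assoc, ← mulVec_mulVec, ← mulVec_mulVec]
      have : (A.val - 1) *ᵥ (g.val *ᵥ x) = 0 := by
        funext i
        change ∑ j, (A.val - 1) i j * (g.val *ᵥ x) j = 0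
        refine Finset.sum_eq_zero fun j _ => ?_
        by_cases hj : d ≤ (j : ℕ)
        · rw [(hg x).mp hx j hj, mul_zero]
        · rw [hA1 i j (by omega), zero_mul]
      rw [this, mulVec_zero]
    · intro x
      rw [hg]
      intro i hi
      rw [Matrix.mul_assoc, ← mulVec_mulVec, hinv, ← mulVec_mulVec]
      change ∑ j, (A.val - 1) i j * (g.val *ᵥ x) j = 0
      refine Finset.sum_eq_zero fun j _ => ?_
      rw [hA1 i j (by omega), zero_mul]

theorem IsCuspidal.eq_zero_of_unip [Finite F] {V : Type*} [AddCommGroup V] [Module ℂ V]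
    {ρ : Representation ℂ (GL (Fin r) F) V} (hρ : IsCuspidal ρ) (K : Submodule F (Fin r → F))
    (hK : K ≠ ⊥) (hK' : K ≠ ⊤) {Z : Type*} [AddCommGroup Z] [Module ℂ Z]
    (L : (V →ₗ[ℂ] V) →ₗ[ℂ] Z) (ξ : Z)
    (hξ : ∀ (u : GL (Fin r) F) (n : Matrix (Fin r) (Fin r) F), u.val = 1 + n →
      (∀ x ∈ K, n *ᵥ x = 0) → (∀ x, n *ᵥ x ∈ K) → L (ρ u) = ξ) : ξ = 0 := by
  let U : Subgroup (GL (Fin r) F) :=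
    { carrier := {u | (∀ x ∈ K, (u.val - 1) *ᵥ x = 0) ∧ ∀ x, (u.val - 1) *ᵥ x ∈ K}
      one_mem' := by simp
      mul_mem' := by
        rintro a b ⟨ha, ha'⟩ ⟨hb, hb'⟩
        have e : (a * b).val - 1 = (a.val - 1) * (b.val - 1) + (a.val - 1) + (b.val - 1) := by
          rw [Units.val_mul]; noncomm_ring
        refine ⟨fun x hx => ?_, fun x => ?_⟩
        · rw [e, add_mulVec, add_mulVec, ← mulVec_mulVec, ha x hx, hb x hx]
          simp
        · rw [e, add_mulVec, add_mulVec, ← mulVec_mulVec]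
          exact K.add_mem (K.add_mem (ha' _) (ha' _)) (hb' _)
      inv_mem' := by
        rintro a ⟨ha, ha'⟩
        have e : (a⁻¹).val - 1 = - ((a⁻¹).val * (a.val - 1)) := by
          rw [Matrix.mul_sub, Units.inv_mul]; simp
        have e' : (a⁻¹).val - 1 = - ((a.val - 1) * (a⁻¹).val) := by
          rw [Matrix.sub_mul, Units.mul_inv]; simp
        refine ⟨fun x hx => ?_, fun x => ?_⟩
        · rw [e, neg_mulVec, ← mulVec_mulVec, ha x hx, mulVec_zero, neg_zero]
        · rw [e', neg_mulVec, ← mulVec_mulVec]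
          exact K.neg_mem (ha' _) }
  have hUmem : ∀ u : GL (Fin r) F, u ∈ U ↔
      (∀ x ∈ K, (u.val - 1) *ᵥ x = 0) ∧ ∀ x, (u.val - 1) *ᵥ x ∈ K := fun u => Iff.rfl
  have : Finite (GL (Fin r) F) := inferInstance
  have : Fintype U := Fintype.ofFinite U
  have hsum : ∑ u : U, ρ u = 0 := by
    ext v
    rw [LinearMap.zero_apply]
    refine hρ.vec_eq_zero K hK hK' _ fun u n hu h1 h2 => ?_
    have huU : u ∈ U := by
      rw [hUmem, hu, add_sub_cancel_left]
      exact ⟨h1, h2⟩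
    rw [LinearMap.sum_apply, map_sum, ← Equiv.sum_comp (Equiv.mulLeft (⟨u, huU⟩ : U))
      (fun x : U => ρ x v)]
    refine Finset.sum_congr rfl fun x _ => ?_
    rw [Equiv.coe_mulLeft, Subgroup.coe_mul, rep_mul_apply]
  have h1 := congrArg L hsum
  rw [map_sum, map_zero, Finset.sum_congr rfl (fun (u : U) _ =>
    hξ u (u.1.val - 1) (by abel) u.2.1 u.2.2), Finset.sum_const, ← Nat.cast_smul_eq_nsmul ℂ] at h1
  refine (smul_eq_zero.mp h1).resolve_left ?_
  rw [Finset.card_univ]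
  exact_mod_cast Fintype.card_ne_zero

end Cusp

section Involution

/-- A common eigenvector of a subgroup pairs nontrivially with a form having the same
eigenvalues. -/
theorem exists_eigenform {G V : Type*} [Group G] [Finite G] [AddCommGroup V] [Module ℂ V]
    (ρ : Representation ℂ G V) (S : Subgroup G) (χ : G → ℂ) (v : V) (hv : v ≠ 0)
    (hχ : ∀ s ∈ S, ρ s v = χ s • v) :
    ∃ l : Module.Dual ℂ V, l v ≠ 0 ∧ ∀ s ∈ S, ∀ w, l (ρ s w) = χ s * l w := by
  obtain ⟨l₀, hl₀⟩ := Module.Projective.exists_dual_ne_zero ℂ hv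
  have : Fintype S := Fintype.ofFinite S
  have hne : ∀ s ∈ S, χ s ≠ 0 := by
    intro s hs h0
    have := hχ s hs
    rw [h0, zero_smul] at this
    exact hv (rep_injective ρ s (this.trans (map_zero _).symm))
  have hmul : ∀ s ∈ S, ∀ s' ∈ S, χ (s * s') = χ s * χ s' := by
    intro s hs s' hs'
    have h1 := hχ _ (S.mul_mem hs hs')
    rw [rep_mul_apply, hχ s' hs', map_smul, hχ s hs, smul_smul] at h1
    rw [mul_comm]
    exact (smul_left_injective ℂ hv h1).symm
  refine ⟨∑ s : S, (χ s)⁻¹ • (l₀ ∘ₗ ρ s), ?_, fun s hs w => ?_⟩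
  · have : ∀ s : S, ((χ s)⁻¹ • (l₀ ∘ₗ ρ s)) v = l₀ v := by
      intro s
      rw [LinearMap.smul_apply, LinearMap.comp_apply, hχ s s.2, map_smul, smul_smul,
        inv_mul_cancel₀ (hne s s.2), one_smul]
    rw [LinearMap.sum_apply]
    simp [this, hl₀]
  · rw [LinearMap.sum_apply, LinearMap.sum_apply, Finset.mul_sum,
      ← Equiv.sum_comp (Equiv.mulRight (⟨s, hs⟩ : S)⁻¹)]
    refine Finset.sum_congr rfl fun x _ => ?_
    have h1 := hmul x x.2 s⁻¹ (S.inv_mem hs)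
    have h2 := hmul s hs s⁻¹ (S.inv_mem hs)
    have h3 := hmul 1 S.one_mem 1 S.one_mem
    rw [mul_inv_cancel] at h2
    have h4 : χ 1 = 1 := by
      rw [one_mul] at h3
      exact (mul_eq_left₀ (hne 1 S.one_mem)).mp h3.symm
    simp only [Equiv.coe_mulRight, Subgroup.coe_mul, InvMemClass.coe_inv, LinearMap.smul_apply,
      LinearMap.comp_apply, smul_eq_mul]
    rw [← rep_mul_apply, inv_mul_cancel_right, h1, _root_.mul_inv_rev, ← mul_assoc]
    congr 2
    rw [inv_eq_of_mul_eq_one_left (h2.symm.trans h4)]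

variable {F : Type*} [Field F] {r : ℕ}

/-- For `θ`, `B` involutions with `θ + B` and `θ - B` both singular, there is a proper nonzero
subspace `K` such that every unipotent element attached to `K` is a product of unipotent
elements commuting with `θ` and with `B`. -/
theorem exists_subspace_of_involutions (h2 : (2 : F) ≠ 0) (θ B : Matrix (Fin r) (Fin r) F)
    (hθ : θ * θ = 1) (hB : B * B = 1) (h1 : (θ + B).det = 0) (h1' : (θ - B).det = 0) :
    ∃ K : Submodule F (Fin r → F), K ≠ ⊥ ∧ K ≠ ⊤ ∧
      ∀ y : Matrix (Fin r) (Fin r) F, (∀ x ∈ K, y *ᵥ x = 0) → (∀ x, y *ᵥ x ∈ K) →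
        ∃ y₁ y₂ : Matrix (Fin r) (Fin r) F, y = y₁ + y₂ ∧ y₁ * y₂ = 0 ∧ y₁ * y₁ = 0 ∧
          y₂ * y₂ = 0 ∧ y₁ * θ = θ * y₁ ∧ y₂ * B = B * y₂ := by
  obtain ⟨m, hm⟩ := Filter.eventually_atTop.mp
    (LinearMap.eventually_isCompl_ker_pow_range_pow (Matrix.mulVecLin (1 + θ * B)))
  set C := 1 + θ * B with hC
  set M := m + 1
  have hpow : ∀ x, (Matrix.mulVecLin C ^ M) x = (C ^ M) *ᵥ x := by
    intro x
    rw [← Matrix.toLin'_apply', ← Matrix.toLin'_pow, Matrix.toLin'_apply]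
  have hcompl := hm M (by omega)
  set K := LinearMap.ker (Matrix.mulVecLin C ^ M) with hK
  have hKmem : ∀ x, x ∈ K ↔ (C ^ M) *ᵥ x = 0 := fun x => by
    rw [hK, LinearMap.mem_ker, hpow]
  have hC' : Commute (B * θ) C := by
    change B * θ * C = C * (B * θ)
    rw [hC]
    have e1 : B * θ * (θ * B) = 1 := by
      rw [show B * θ * (θ * B) = B * (θ * θ) * B by noncomm_ring, hθ, mul_one, hB]
    have e2 : θ * B * (B * θ) = 1 := by
      rw [show θ * B * (B * θ) = θ * (B * B) * θ by noncomm_ring, hB, mul_one, hθ]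
    rw [mul_add, add_mul, e1, e2, mul_one, one_mul]
  have hsC : SemiconjBy θ (B * θ * C) C := by
    change θ * (B * θ * C) = C * θ
    rw [hC]
    have : θ * (B * θ * (1 + θ * B)) = θ * B * θ + θ * B * (θ * θ) * B := by noncomm_ring
    rw [this, hθ, mul_one, mul_assoc θ B B, hB]
    noncomm_ring
  have hsB : SemiconjBy B (B * θ * C) C := by
    change B * (B * θ * C) = C * B
    rw [hC]
    have : B * (B * θ * (1 + θ * B)) = (B * B) * θ + (B * B) * (θ * θ) * B := by noncomm_ring
    rw [this, hθ, hB]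
    have : (1 + θ * B) * B = B + θ * (B * B) := by noncomm_ring
    rw [this, hB]
    noncomm_ring
  have hstab : ∀ X : Matrix (Fin r) (Fin r) F, SemiconjBy X (B * θ * C) C →
      ∀ x ∈ K, X *ᵥ x ∈ K := by
    intro X hX x hx
    rw [hKmem] at hx ⊢
    have := (hX.pow_right M).eq
    rw [mulVec_mulVec, ← this, hC'.mul_pow, ← mul_assoc, ← mulVec_mulVec, hx, mulVec_zero]
  refine ⟨K, ?_, ?_, ?_⟩
  · have hdet : C.det = 0 := by
      have : C = θ * (θ + B) := by rw [mul_add, hθ]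
      rw [this, det_mul, h1, mul_zero]
    obtain ⟨x, hx0, hx⟩ := Matrix.exists_mulVec_eq_zero_iff.mpr hdet
    intro hbot
    apply hx0
    have : x ∈ K := by
      rw [hKmem, pow_succ, ← mulVec_mulVec, hx, mulVec_zero]
    rw [hbot] at this
    exact this
  · have hdet : (1 - θ * B).det = 0 := by
      have : 1 - θ * B = θ * (θ - B) := by rw [mul_sub, hθ]
      rw [this, det_mul, h1', mul_zero]
    obtain ⟨x, hx0, hx⟩ := Matrix.exists_mulVec_eq_zero_iff.mpr hdet
    rw [sub_mulVec, one_mulVec, sub_eq_zero] at hx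
    have hCx : C *ᵥ x = (2 : F) • x := by
      rw [hC, add_mulVec, one_mulVec, ← hx, two_smul]
    have hCp : ∀ p : ℕ, (C ^ p) *ᵥ x = (2 : F) ^ p • x := by
      intro p
      induction p with
      | zero => simp
      | succ p ih => rw [pow_succ, ← mulVec_mulVec, hCx, mulVec_smul, ih, smul_smul, pow_succ,
          mul_comm]
    intro htop
    have : x ∈ K := by rw [htop]; trivial
    rw [hKmem, hCp] at this
    exact hx0 ((smul_eq_zero.mp this).resolve_left (pow_ne_zero _ h2))
  · let U : Submodule F (Matrix (Fin r) (Fin r) F) :=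
      { carrier := {y | (∀ x ∈ K, y *ᵥ x = 0) ∧ ∀ x, y *ᵥ x ∈ K}
        zero_mem' := by simp
        add_mem' := by
          rintro a b ⟨ha, ha'⟩ ⟨hb, hb'⟩
          refine ⟨fun x hx => ?_, fun x => ?_⟩
          · rw [add_mulVec, ha x hx, hb x hx, add_zero]
          · rw [add_mulVec]
            exact K.add_mem (ha' x) (hb' x)
        smul_mem' := by
          rintro c a ⟨ha, ha'⟩
          refine ⟨fun x hx => ?_, fun x => ?_⟩
          · rw [smul_mulVec, ha x hx, smul_zero]
          · rw [smul_mulVec]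
            exact K.smul_mem c (ha' x) }
    have hUconj : ∀ X : Matrix (Fin r) (Fin r) F, (∀ x ∈ K, X *ᵥ x ∈ K) → ∀ y ∈ U,
        X * y * X ∈ U := by
      rintro X hX y ⟨hy, hy'⟩
      refine ⟨fun x hx => ?_, fun x => ?_⟩
      · rw [← mulVec_mulVec, ← mulVec_mulVec, hy _ (hX x hx), mulVec_zero]
      · rw [← mulVec_mulVec, ← mulVec_mulVec]
        exact hX _ (hy' _)
    have hUmul : ∀ a ∈ U, ∀ b ∈ U, a * b = 0 := by
      rintro a ⟨ha, -⟩ b ⟨-, hb⟩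
      apply Matrix.ext_of_mulVec_single
      intro j
      rw [← mulVec_mulVec, ha _ (hb _), zero_mulVec]
    let Ψ : U →ₗ[F] U :=
      { toFun := fun z => ⟨θ * z * θ - B * z * B,
          U.sub_mem (hUconj θ (hstab θ hsC) z z.2) (hUconj B (hstab B hsB) z z.2)⟩
        map_add' := fun a b => Subtype.ext (by
          simp only [Submodule.coe_add]; noncomm_ring)
        map_smul' := fun c a => Subtype.ext (by
          simp [smul_sub]) }
    have hinj : Function.Injective Ψ := by
      rw [← LinearMap.ker_eq_bot, eq_bot_iff]
      intro z hz
      have hz1 : θ * z.1 * θ = B * z.1 * B :=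
        sub_eq_zero.mp (congrArg Subtype.val (LinearMap.mem_ker.mp hz))
      have hz2 : z.1 * (θ * B) = θ * B * z.1 := by
        calc z.1 * (θ * B) = (θ * θ) * z.1 * (θ * B) := by rw [hθ, one_mul]
          _ = θ * (θ * z.1 * θ) * B := by noncomm_ring
          _ = θ * B * z.1 * (B * B) := by rw [hz1]; noncomm_ring
          _ = _ := by rw [hB, mul_one]
      have hz3 : Commute z.1 C := by
        change z.1 * C = C * z.1
        rw [hC, mul_add, add_mul, hz2, mul_one, one_mul]
      have hz4 := (hz3.pow_right M).eq
      rw [Submodule.mem_bot]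
      apply Subtype.ext
      apply Matrix.ext_of_mulVec_single
      intro j
      have : Pi.single j 1 ∈ K ⊔ LinearMap.range (Matrix.mulVecLin C ^ M) := by
        rw [hcompl.sup_eq_top]; trivial
      obtain ⟨a, ha, b, ⟨c, rfl⟩, hab⟩ := Submodule.mem_sup.mp this
      rw [← hab, mulVec_add, z.2.1 a ha, zero_add, hpow, mulVec_mulVec, hz4, ← mulVec_mulVec,
        (hKmem _).mp (z.2.2 c)]
      simp
    have hsurj := LinearMap.injective_iff_surjective.mp hinj
    intro y hy hy'
    obtain ⟨z, hz⟩ := hsurj ⟨y, hy, hy'⟩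
    have hz1 : θ * z.1 * θ - B * z.1 * B = y := congrArg Subtype.val hz
    have hu1 : z.1 + θ * z.1 * θ ∈ U := U.add_mem z.2 (hUconj θ (hstab θ hsC) z z.2)
    have hu2 : -(z.1 + B * z.1 * B) ∈ U := U.neg_mem (U.add_mem z.2 (hUconj B (hstab B hsB) z z.2))
    refine ⟨z.1 + θ * z.1 * θ, -(z.1 + B * z.1 * B), ?_, hUmul _ hu1 _ hu2, hUmul _ hu1 _ hu1,
      hUmul _ hu2 _ hu2, ?_, ?_⟩
    · rw [← hz1]; abel
    · calc (z.1 + θ * z.1 * θ) * θ = z.1 * θ + θ * z.1 * (θ * θ) := by noncomm_ring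
        _ = (θ * θ) * z.1 * θ + θ * z.1 := by rw [hθ]; noncomm_ring
        _ = _ := by noncomm_ring
    · calc -(z.1 + B * z.1 * B) * B = -(z.1 * B + B * z.1 * (B * B)) := by noncomm_ring
        _ = -((B * B) * z.1 * B + B * z.1) := by rw [hB]; noncomm_ring
        _ = _ := by noncomm_ring

end Involution

section Involution

variable {F : Type*} [Field F] {r : ℕ}

/-- A cuspidal irreducible representation with a nonzero vector invariant under the centralizer
of an involution is self-dual. -/
theorem IsCuspidal.selfDual_of_involution [Finite F] (h2 : (2 : F) ≠ 0)
    {V : Type*} [AddCommGroup V] [Module ℂ V] [FiniteDimensional ℂ V]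
    {ρ : Representation ℂ (GL (Fin r) F) V} (hρ : IsCuspidal ρ) (hi : IsIrred ρ)
    (θ : Matrix (Fin r) (Fin r) F) (hθ : θ * θ = 1) (v₀ : V) (hv₀ : v₀ ≠ 0)
    (hinv : ∀ h : GL (Fin r) F, h.val * θ = θ * h.val → ρ h v₀ = v₀) : RepIso ρ ρ.dual := by
  have : Finite (GL (Fin r) F) := inferInstance
  have : Fintype (GL (Fin r) F) := Fintype.ofFinite _
  let S : Subgroup (GL (Fin r) F) :=
    { carrier := {g | g.val * θ = θ * g.val ∨ g.val * θ = -(θ * g.val)}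
      one_mem' := by simp
      mul_mem' := by
        rintro a b (ha | ha) (hb | hb)
        · left; rw [Units.val_mul, mul_assoc, hb, ← mul_assoc, ha, mul_assoc]
        · right; rw [Units.val_mul, mul_assoc, hb, mul_neg, ← mul_assoc, ha, mul_assoc]
        · right; rw [Units.val_mul, mul_assoc, hb, ← mul_assoc, ha, neg_mul, mul_assoc]
        · left; rw [Units.val_mul, mul_assoc, hb, mul_neg, ← mul_assoc, ha, neg_mul, neg_neg,
            mul_assoc]
      inv_mem' := by
        rintro a (ha | ha)
        · left
          calc (a⁻¹).val * θ = (a⁻¹).val * (θ * a.val) * (a⁻¹).val := by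
                rw [mul_assoc, mul_assoc θ, Units.mul_inv, mul_one]
            _ = θ * (a⁻¹).val := by rw [← ha, ← mul_assoc, Units.inv_mul, one_mul]
        · right
          calc (a⁻¹).val * θ = (a⁻¹).val * (θ * a.val) * (a⁻¹).val := by
                rw [mul_assoc, mul_assoc θ, Units.mul_inv, mul_one]
            _ = (a⁻¹).val * (-(a.val * θ)) * (a⁻¹).val := by rw [ha, neg_neg]
            _ = -((a⁻¹).val * a.val * θ * (a⁻¹).val) := by noncomm_ring
            _ = -(θ * (a⁻¹).val) := by rw [Units.inv_mul, one_mul] }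
  have hCmul : ∀ a b : GL (Fin r) F, a.val * θ = -(θ * a.val) → b.val * θ = -(θ * b.val) →
      (a * b).val * θ = θ * (a * b).val := by
    intro a b ha hb
    rw [Units.val_mul, mul_assoc, hb, mul_neg, ← mul_assoc, ha, neg_mul, neg_neg, mul_assoc]
  have hAinv : ∀ a : GL (Fin r) F, a.val * θ = -(θ * a.val) →
      (a⁻¹).val * θ = -(θ * (a⁻¹).val) := by
    intro a ha
    calc (a⁻¹).val * θ = (a⁻¹).val * (θ * a.val) * (a⁻¹).val := by
          rw [mul_assoc, mul_assoc θ, Units.mul_inv, mul_one]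
      _ = (a⁻¹).val * (-(a.val * θ)) * (a⁻¹).val := by rw [ha, neg_neg]
      _ = -((a⁻¹).val * a.val * θ * (a⁻¹).val) := by noncomm_ring
      _ = -(θ * (a⁻¹).val) := by rw [Units.inv_mul, one_mul]
  obtain ⟨v, hv, ε, hvC, hvA⟩ : ∃ v : V, v ≠ 0 ∧ ∃ ε : ℂ,
      (∀ h : GL (Fin r) F, h.val * θ = θ * h.val → ρ h v = v) ∧
      (∀ h : GL (Fin r) F, h.val * θ = -(θ * h.val) → ρ h v = ε • v) := by
    by_cases hA : ∃ y₀ : GL (Fin r) F, y₀.val * θ = -(θ * y₀.val)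
    · obtain ⟨y₀, hy₀⟩ := hA
      by_cases h0 : v₀ + ρ y₀ v₀ = 0
      · refine ⟨v₀, hv₀, -1, hinv, fun h hh => ?_⟩
        have e : h = y₀ * (y₀⁻¹ * h) := by group
        rw [e, rep_mul_apply, hinv (y₀⁻¹ * h) (hCmul _ _ (hAinv _ hy₀) hh), neg_one_smul]
        exact eq_neg_of_add_eq_zero_right h0
      · refine ⟨_, h0, 1, fun h hh => ?_, fun h hh => ?_⟩
        · have e : h * y₀ = y₀ * (y₀⁻¹ * (h * y₀)) := by group
          rw [map_add, hinv h hh, ← rep_mul_apply, e, rep_mul_apply,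
            hinv (y₀⁻¹ * (h * y₀)) (hCmul _ _ (hAinv _ hy₀) ?_)]
          rw [Units.val_mul, mul_assoc, hy₀, mul_neg, ← mul_assoc, hh, mul_assoc]
        · have e : h = y₀ * (y₀⁻¹ * h) := by group
          rw [map_add, ← rep_mul_apply, hinv (h * y₀) (hCmul _ _ hh hy₀), one_smul, e,
            rep_mul_apply, hinv (y₀⁻¹ * h) (hCmul _ _ (hAinv _ hy₀) hh), add_comm]
    · exact ⟨v₀, hv₀, 1, hinv, fun h hh => absurd ⟨h, hh⟩ hA⟩
  classical
  obtain ⟨l, hlv, hl⟩ := exists_eigenform ρ S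
    (fun g => if g.val * θ = θ * g.val then 1 else ε) v hv (by
      intro s hs
      split_ifs with h
      · rw [one_smul, hvC s h]
      · exact hvA s (hs.resolve_left h))
  have hlC : ∀ h : GL (Fin r) F, h.val * θ = θ * h.val → ∀ w, l (ρ h w) = l w := by
    intro h hh w
    rw [hl h (Or.inl hh), if_pos hh, one_mul]
  have hlA : ∀ h : GL (Fin r) F, h.val * θ = -(θ * h.val) → ∀ w, l (ρ h w) = ε * l w := by
    intro h hh w
    have h1 := hl h (Or.inr hh)
    have h3 : (if h.val * θ = θ * h.val then (1 : ℂ) else ε) = ε := by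
      split_ifs with hc
      · have h4 := hvA h hh
        rw [hvC h hc] at h4
        have h5 : (1 : ℂ) • v = ε • v := by rw [one_smul]; exact h4
        exact smul_left_injective ℂ hv h5
      · rfl
    rw [h1, h3]
  -- the two points are related by an invertible `θ + s B`
  have hreg : ∀ (g k : GL (Fin r) F) (B : Matrix (Fin r) (Fin r) F), B * g.val = g.val * θ →
      B * B = 1 → (k.val = θ + B ∨ k.val = θ - B) → l (ρ g v) = l (ρ g⁻¹ v) := by
    intro g k B hB hBB hk
    have hgB : (g⁻¹).val * B = θ * (g⁻¹).val := by
      calc (g⁻¹).val * B = (g⁻¹).val * (B * g.val) * (g⁻¹).val := by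
            rw [mul_assoc, mul_assoc B, Units.mul_inv, mul_one]
        _ = _ := by rw [hB, ← mul_assoc, Units.inv_mul, one_mul]
    have e1 : g = k⁻¹ * (k * g) := by group
    have e2 : g⁻¹ = (g⁻¹ * k) * k⁻¹ := by group
    rcases hk with hk | hk
    · have k1 : k.val * θ = B * k.val := by rw [hk, add_mul, mul_add, hθ, hBB, add_comm]
      have k2 : k.val * B = θ * k.val := by rw [hk, add_mul, mul_add, hθ, hBB, add_comm]
      have c1 : (k * g).val * θ = θ * (k * g).val := by
        rw [Units.val_mul, mul_assoc, ← hB, ← mul_assoc, k2, mul_assoc]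
      have c2 : (g⁻¹ * k).val * θ = θ * (g⁻¹ * k).val := by
        rw [Units.val_mul, mul_assoc, k1, ← mul_assoc, hgB, mul_assoc]
      rw [e2, rep_mul_apply, hlC _ c2]
      conv_lhs => rw [e1, rep_mul_apply, hvC _ c1]
    · have k1 : k.val * θ = -(B * k.val) := by rw [hk, sub_mul, mul_sub, hθ, hBB, neg_sub]
      have k2 : k.val * B = -(θ * k.val) := by rw [hk, sub_mul, mul_sub, hθ, hBB, neg_sub]
      have c1 : (k * g).val * θ = -(θ * (k * g).val) := by
        rw [Units.val_mul, mul_assoc, ← hB, ← mul_assoc, k2, neg_mul, mul_assoc]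
      have c2 : (g⁻¹ * k).val * θ = -(θ * (g⁻¹ * k).val) := by
        rw [Units.val_mul, mul_assoc, k1, mul_neg, ← mul_assoc, hgB, mul_assoc]
      rw [e2, rep_mul_apply, hlA _ c2]
      conv_lhs => rw [e1, rep_mul_apply, hvA _ c1, map_smul, map_smul, smul_eq_mul]
  have hsing : ∀ (g : GL (Fin r) F) (B : Matrix (Fin r) (Fin r) F), B * g.val = g.val * θ →
      B * B = 1 → (θ + B).det = 0 → (θ - B).det = 0 → l (ρ g v) = 0 := by
    intro g B hB hBB hd hd'
    obtain ⟨K, hK, hK', hy⟩ := exists_subspace_of_involutions h2 θ B hθ hBB hd hd'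
    refine hρ.eq_zero_of_unip K hK hK'
      (l ∘ₗ LinearMap.applyₗ (ρ g v))
      (l (ρ g v)) fun u n hu hn hn' => ?_
    obtain ⟨y₁, y₂, rfl, h12, h11, h22, hy₁, hy₂⟩ := hy n hn hn'
    let u₁ : GL (Fin r) F := ⟨1 + y₁, 1 - y₁, by
      rw [mul_sub, mul_one, add_mul, one_mul, h11]; noncomm_ring, by rw [mul_add, mul_one, sub_mul, one_mul, h11]; noncomm_ring⟩
    let u₂ : GL (Fin r) F := ⟨1 + y₂, 1 - y₂, by
      rw [mul_sub, mul_one, add_mul, one_mul, h22]; noncomm_ring, by rw [mul_add, mul_one, sub_mul, one_mul, h22]; noncomm_ring⟩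
    have hu' : u = u₁ * u₂ := by
      apply Units.ext
      rw [hu, Units.val_mul]
      change _ = (1 + y₁) * (1 + y₂)
      rw [mul_add, mul_one, add_mul, one_mul, h12]
      abel
    have hgB : (g⁻¹).val * B = θ * (g⁻¹).val := by
      calc (g⁻¹).val * B = (g⁻¹).val * (B * g.val) * (g⁻¹).val := by
            rw [mul_assoc, mul_assoc B, Units.mul_inv, mul_one]
        _ = _ := by rw [hB, ← mul_assoc, Units.inv_mul, one_mul]
    change l (ρ u (ρ g v)) = l (ρ g v)
    rw [hu', rep_mul_apply, hlC u₁, ← rep_mul_apply,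
      show u₂ * g = g * (g⁻¹ * u₂ * g) by group, rep_mul_apply, hvC]
    · change (g⁻¹).val * (1 + y₂) * g.val * θ = θ * ((g⁻¹).val * (1 + y₂) * g.val)
      rw [mul_assoc, ← hB, ← mul_assoc, ← mul_assoc, ← mul_assoc, ← hgB, mul_assoc _ (1 + y₂) B,
        mul_assoc _ B (1 + y₂)]
      congr 2
      rw [add_mul, mul_add, hy₂, mul_one, one_mul]
    · change (1 + y₁) * θ = θ * (1 + y₁)
      rw [add_mul, mul_add, hy₁, mul_one, one_mul]
  refine hi.selfDual_of_coef (ι := Unit) (κ := Unit) (fun g => l (ρ g v)) (fun _ => l)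
    (fun _ => v) (fun _ => l) (fun _ => v) (fun g => by simp) (fun g => ?_) ?_
  · rw [Fintype.sum_unique]
    set B := g.val * θ * (g⁻¹).val with hBdef
    have hB : B * g.val = g.val * θ := by rw [hBdef, mul_assoc, Units.inv_mul, mul_one]
    have hBB : B * B = 1 := by
      calc B * B = B * g.val * θ * (g⁻¹).val := by rw [hBdef]; noncomm_ring
        _ = g.val * (θ * θ) * (g⁻¹).val := by rw [hB]; noncomm_ring
        _ = 1 := by rw [hθ, mul_one, Units.mul_inv]
    by_cases hd : (θ + B).det = 0
    · by_cases hd' : (θ - B).det = 0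
      · rw [hsing g B hB hBB hd hd']
        set B' := (g⁻¹).val * θ * g.val with hB'def
        have hB' : B' * (g⁻¹).val = (g⁻¹).val * θ := by rw [hB'def, mul_assoc, Units.mul_inv, mul_one]
        have hBB' : B' * B' = 1 := by
          calc B' * B' = B' * (g⁻¹).val * θ * g.val := by rw [hB'def]; noncomm_ring
            _ = (g⁻¹).val * (θ * θ) * g.val := by rw [hB']; noncomm_ring
            _ = 1 := by rw [hθ, mul_one, Units.inv_mul]
        have hθ' : θ = (g⁻¹).val * B * g.val := by
          rw [mul_assoc, hB, ← mul_assoc, Units.inv_mul, one_mul]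
        refine (hsing g⁻¹ B' hB' hBB' ?_ ?_).symm
        · have : θ + B' = (g⁻¹).val * (θ + B) * g.val := by
            rw [hB'def, mul_add, add_mul, ← hθ', add_comm]
          rw [this, det_mul, det_mul, hd, mul_zero, zero_mul]
        · have : θ - B' = (g⁻¹).val * (-(θ - B)) * g.val := by
            rw [hB'def, neg_sub, mul_sub, sub_mul, ← hθ']
          rw [this, det_mul, det_mul, det_neg, hd', mul_zero, mul_zero, zero_mul]
      · exact hreg g (GeneralLinearGroup.mkOfDetNeZero _ hd') B hB hBB (Or.inr rfl)
    · exact hreg g (GeneralLinearGroup.mkOfDetNeZero _ hd) B hB hBB (Or.inl rfl)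
  · rw [rep_one_apply]
    exact hlv

end Involution

section BlocksSection

/-- A division of `Fin N` into consecutive blocks of sizes `k b`, with enumerations. -/
structure Blocks (N : ℕ) {B : Type*} [LinearOrder B] (k : B → ℕ) where
  /-- the block of an index -/
  blk : Fin N → B
  /-- the enumeration of a block -/
  enum : ∀ b, Fin (k b) → Fin N
  mono : Monotone blk
  inj : ∀ b, Function.Injective (enum b)
  blk_enum : ∀ b i, blk (enum b i) = b
  surj : ∀ b j, blk j = b → ∃ i, enum b i = j

namespace Blocks

variable {N : ℕ} {B : Type*} [LinearOrder B] {k : B → ℕ} (D : Blocks N k)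
  (F : Type*) [Field F]

/-- the inclusion matrix of a block -/
def incl (b : B) : Matrix (Fin N) (Fin (k b)) F :=
  of fun x i => if x = D.enum b i then 1 else 0

variable {F}

theorem incl_apply (b : B) (x : Fin N) (i : Fin (k b)) :
    D.incl F b x i = if x = D.enum b i then 1 else 0 := rfl

theorem mul_incl_apply {ι : Type*} (b : B) (M : Matrix ι (Fin N) F) (x : ι) (i : Fin (k b)) :
    (M * D.incl F b) x i = M x (D.enum b i) := by
  simp [Matrix.mul_apply, incl_apply]

theorem inclT_mul_apply {ι : Type*} (b : B) (M : Matrix (Fin N) ι F) (x : ι) (i : Fin (k b)) :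
    ((D.incl F b)ᵀ * M) i x = M (D.enum b i) x := by
  simp [Matrix.mul_apply, incl_apply]

theorem inclT_mul_incl_self (b : B) : (D.incl F b)ᵀ * D.incl F b = 1 := by
  ext i j
  rw [inclT_mul_apply, incl_apply, Matrix.one_apply]
  simp only [(D.inj b).eq_iff]

theorem inclT_mul_incl_of_ne {b b' : B} (h : b ≠ b') :
    (D.incl F b)ᵀ * D.incl F b' = 0 := by
  ext i j
  rw [inclT_mul_apply, incl_apply, if_neg]
  · rfl
  · intro e
    apply h
    rw [← D.blk_enum b i, e, D.blk_enum]

theorem incl_mul_apply_of_ne {ι : Type*} {b : B} (M : Matrix (Fin (k b)) ι F) {x : Fin N}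
    (y : ι) (h : D.blk x ≠ b) : (D.incl F b * M) x y = 0 := by
  rw [Matrix.mul_apply]
  refine Finset.sum_eq_zero fun i _ => ?_
  rw [incl_apply, if_neg, zero_mul]
  rintro rfl
  exact h (D.blk_enum b i)

theorem mul_inclT_apply_of_ne {ι : Type*} {b : B} (M : Matrix ι (Fin (k b)) F) (x : ι)
    {y : Fin N} (h : D.blk y ≠ b) : (M * (D.incl F b)ᵀ) x y = 0 := by
  rw [Matrix.mul_apply]
  refine Finset.sum_eq_zero fun i _ => ?_
  rw [transpose_apply, incl_apply, if_neg, mul_zero]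
  rintro rfl
  exact h (D.blk_enum b i)

theorem sum_incl_mul_inclT [Fintype B] : ∑ b, D.incl F b * (D.incl F b)ᵀ = 1 := by
  ext x y
  rw [Matrix.sum_apply, Finset.sum_eq_single (D.blk x)]
  · obtain ⟨i, hi⟩ := D.surj _ x rfl
    rw [Matrix.mul_apply, Finset.sum_eq_single i]
    · rw [incl_apply, if_pos hi.symm, transpose_apply, incl_apply, one_mul, hi, Matrix.one_apply]
      simp only [eq_comm]
    · intro j _ hj
      rw [incl_apply, if_neg, zero_mul]
      exact fun h => hj (D.inj _ (h.symm.trans hi.symm))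
    · simp
  · intro b _ hb
    exact D.incl_mul_apply_of_ne _ _ (Ne.symm hb)
  · simp

/-- `M` is block upper triangular with diagonal blocks `y b`. -/
def Lev (M : Matrix (Fin N) (Fin N) F) (y : ∀ b, Matrix (Fin (k b)) (Fin (k b)) F) : Prop :=
  BlockTriangular M D.blk ∧ ∀ b, (D.incl F b)ᵀ * M * D.incl F b = y b

theorem inclT_mul_mul_incl_apply {b b' : B} (M : Matrix (Fin N) (Fin N) F) (i : Fin (k b))
    (j : Fin (k b')) :
    ((D.incl F b)ᵀ * M * D.incl F b') i j = M (D.enum b i) (D.enum b' j) := by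
  rw [mul_incl_apply, inclT_mul_apply]

theorem inclT_mul_mul_incl_eq_zero {M : Matrix (Fin N) (Fin N) F} (h : BlockTriangular M D.blk)
    {b b' : B} (hb : b' < b) : (D.incl F b)ᵀ * M * D.incl F b' = 0 := by
  ext i j
  rw [inclT_mul_mul_incl_apply, h (by rwa [D.blk_enum, D.blk_enum]), Matrix.zero_apply]

variable {D}

theorem Lev.congr {M : Matrix (Fin N) (Fin N) F} {y y' : ∀ b, Matrix (Fin (k b)) (Fin (k b)) F}
    (h : D.Lev M y) (e : y = y') : D.Lev M y' := e ▸ h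

theorem Lev.unique {M : Matrix (Fin N) (Fin N) F} {y y' : ∀ b, Matrix (Fin (k b)) (Fin (k b)) F}
    (h : D.Lev M y) (h' : D.Lev M y') : y = y' := funext fun b => (h.2 b).symm.trans (h'.2 b)

theorem lev_zero : D.Lev (0 : Matrix (Fin N) (Fin N) F) 0 :=
  ⟨fun _ _ _ => rfl, fun b => by rw [Matrix.mul_zero, Matrix.zero_mul]; rfl⟩

theorem lev_one : D.Lev (1 : Matrix (Fin N) (Fin N) F) 1 :=
  ⟨blockTriangular_one, fun b => by rw [Matrix.mul_one, inclT_mul_incl_self]; rfl⟩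

theorem Lev.add {M M' : Matrix (Fin N) (Fin N) F} {y y' : ∀ b, Matrix (Fin (k b)) (Fin (k b)) F}
    (h : D.Lev M y) (h' : D.Lev M' y') : D.Lev (M + M') (y + y') :=
  ⟨h.1.add h'.1, fun b => by rw [Matrix.mul_add, Matrix.add_mul, h.2, h'.2]; rfl⟩

theorem Lev.mul [Fintype B] {M M' : Matrix (Fin N) (Fin N) F}
    {y y' : ∀ b, Matrix (Fin (k b)) (Fin (k b)) F}
    (h : D.Lev M y) (h' : D.Lev M' y') : D.Lev (M * M') (y * y') := by
  refine ⟨h.1.mul h'.1, fun b => ?_⟩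
  have e : (D.incl F b)ᵀ * (M * M') * D.incl F b =
      ∑ a, ((D.incl F b)ᵀ * M * D.incl F a) * ((D.incl F a)ᵀ * M' * D.incl F b) := by
    calc (D.incl F b)ᵀ * (M * M') * D.incl F b
        = (D.incl F b)ᵀ * M * (∑ a, D.incl F a * (D.incl F a)ᵀ) * (M' * D.incl F b) := by
          rw [sum_incl_mul_inclT, Matrix.mul_one]
          simp only [Matrix.mul_assoc]
      _ = _ := by
          rw [Matrix.mul_sum, Matrix.sum_mul]
          simp only [Matrix.mul_assoc]
  rw [e, Finset.sum_eq_single b, h.2, h'.2]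
  · rfl
  · intro a _ hab
    rcases lt_or_gt_of_ne hab with hh | hh
    · rw [D.inclT_mul_mul_incl_eq_zero h.1 hh, Matrix.zero_mul]
    · rw [D.inclT_mul_mul_incl_eq_zero h'.1 hh, Matrix.mul_zero]
  · simp

theorem lev_single (b : B) (y : Matrix (Fin (k b)) (Fin (k b)) F) :
    D.Lev (D.incl F b * y * (D.incl F b)ᵀ) (Pi.single b y) := by
  refine ⟨fun i j hij => ?_, fun b' => ?_⟩
  · by_cases h : D.blk j = b
    · rw [Matrix.mul_assoc]
      exact D.incl_mul_apply_of_ne _ _ (by rintro rfl; exact hij.ne h)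
    · exact D.mul_inclT_apply_of_ne _ _ h
  · by_cases h : b' = b
    · subst h
      rw [Pi.single_eq_same, ← Matrix.mul_assoc, ← Matrix.mul_assoc, inclT_mul_incl_self,
        Matrix.one_mul, Matrix.mul_assoc, inclT_mul_incl_self, Matrix.mul_one]
    · rw [Pi.single_eq_of_ne h, ← Matrix.mul_assoc, ← Matrix.mul_assoc,
        D.inclT_mul_incl_of_ne h, Matrix.zero_mul, Matrix.zero_mul, Matrix.zero_mul]

theorem lev_offdiag {b c : B} (h : b < c) (y : Matrix (Fin (k b)) (Fin (k c)) F) :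
    D.Lev (D.incl F b * y * (D.incl F c)ᵀ) 0 := by
  refine ⟨fun i j hij => ?_, fun b' => ?_⟩
  · by_cases hj : D.blk j = c
    · rw [Matrix.mul_assoc]
      refine D.incl_mul_apply_of_ne _ _ ?_
      rintro rfl
      exact lt_asymm h (hj ▸ hij)
    · exact D.mul_inclT_apply_of_ne _ _ hj
  · by_cases h' : b' = b
    · subst h'
      rw [Matrix.mul_assoc, Matrix.mul_assoc _ _ (D.incl F b'), D.inclT_mul_incl_of_ne h.ne',
        Matrix.mul_zero, Matrix.mul_zero]
      rfl
    · rw [← Matrix.mul_assoc, ← Matrix.mul_assoc,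
        D.inclT_mul_incl_of_ne h', Matrix.zero_mul, Matrix.zero_mul, Matrix.zero_mul]
      rfl

theorem exists_lev (A : GL (Fin N) F) (hA : BlockTriangular A.val D.blk) [Fintype B] :
    ∃ m : ∀ b, GL (Fin (k b)) F, D.Lev A.val (fun b => (m b).val) ∧
      D.Lev (A⁻¹).val (fun b => ((m b)⁻¹).val) := by
  have hA' : BlockTriangular (A⁻¹).val D.blk := by
    have : Invertible A.val := A.invertible
    rw [Matrix.coe_units_inv]
    exact blockTriangular_inv_of_blockTriangular hA
  have h1 : D.Lev A.val (fun b => (D.incl F b)ᵀ * A.val * D.incl F b) := ⟨hA, fun b => rfl⟩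
  have h2 : D.Lev (A⁻¹).val (fun b => (D.incl F b)ᵀ * (A⁻¹).val * D.incl F b) := ⟨hA', fun b => rfl⟩
  have h3 := h1.mul h2
  have h4 := h2.mul h1
  rw [Units.mul_inv] at h3
  rw [Units.inv_mul] at h4
  exact ⟨fun b => ⟨_, _, congrFun (h3.unique lev_one) b, congrFun (h4.unique lev_one) b⟩, h1, h2⟩

variable (D)

/-- block diagonal matrices -/
def diag [Fintype B] : (∀ b, GL (Fin (k b)) F) →* GL (Fin N) F :=
  MonoidHom.toHomUnits
    { toFun := fun m => ∑ b, D.incl F b * (m b).val * (D.incl F b)ᵀ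
      map_one' := by
        simp only [Pi.one_apply, Units.val_one, Matrix.mul_one]
        exact D.sum_incl_mul_inclT
      map_mul' := fun m m' => by
        rw [Matrix.sum_mul]
        refine Finset.sum_congr rfl fun b _ => ?_
        rw [Matrix.mul_sum, Finset.sum_eq_single b]
        · calc D.incl F b * ((m * m') b).val * (D.incl F b)ᵀ
              = D.incl F b * (m b).val * (1 : Matrix (Fin (k b)) (Fin (k b)) F) * (m' b).val *
                (D.incl F b)ᵀ := by
                rw [Matrix.mul_one, Pi.mul_apply, Units.val_mul]
                simp only [Matrix.mul_assoc]
            _ = _ := by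
                rw [← D.inclT_mul_incl_self b]
                simp only [Matrix.mul_assoc]
        · intro c _ hc
          calc _ = D.incl F b * (m b).val * ((D.incl F b)ᵀ * D.incl F c) * (m' c).val *
                  (D.incl F c)ᵀ := by simp only [Matrix.mul_assoc]
            _ = 0 := by
                rw [D.inclT_mul_incl_of_ne hc.symm, Matrix.mul_zero, Matrix.zero_mul,
                  Matrix.zero_mul]
        · simp }

theorem diag_val [Fintype B] (m : ∀ b, GL (Fin (k b)) F) :
    (D.diag m).val = ∑ b, D.incl F b * (m b).val * (D.incl F b)ᵀ := rfl

theorem diag_lev [Fintype B] (m : ∀ b, GL (Fin (k b)) F) :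
    D.Lev (D.diag m).val (fun b => (m b).val) := by
  classical
  rw [diag_val]
  have key : ∀ s : Finset B, D.Lev (∑ b ∈ s, D.incl F b * (m b).val * (D.incl F b)ᵀ)
      (∑ b ∈ s, Pi.single b (m b).val) := by
    intro s
    induction s using Finset.induction_on with
    | empty => exact lev_zero
    | insert b s hb ih => rw [Finset.sum_insert hb, Finset.sum_insert hb]; exact (lev_single _ _).add ih
  exact (key Finset.univ).congr (Finset.univ_sum_single _)

theorem lev_isUnit_det [Fintype B] {A : Matrix (Fin N) (Fin N) F} {m : ∀ b, GL (Fin (k b)) F}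
    (h : D.Lev A (fun b => (m b).val)) : A.det ≠ 0 := by
  classical
  rw [h.1.det]
  refine Finset.prod_ne_zero_iff.2 fun b _ => ?_
  let ε : Fin (k b) ≃ {x // D.blk x = b} := Equiv.ofBijective (fun i => ⟨D.enum b i, D.blk_enum b i⟩)
    ⟨fun i j hij => D.inj b (congrArg Subtype.val hij), fun x => by
      obtain ⟨i, hi⟩ := D.surj b x.1 x.2
      exact ⟨i, Subtype.ext hi⟩⟩
  have e : (A.toSquareBlock D.blk b).submatrix ε ε = (m b).val := by
    have hb := h.2 b
    dsimp only at hb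
    rw [← hb]
    ext i j
    rw [inclT_mul_mul_incl_apply]
    rfl
  rw [← Matrix.det_submatrix_equiv_self ε, e]
  exact ((Matrix.isUnit_iff_isUnit_det _).1 (m b).isUnit).ne_zero

theorem lev_units [Fintype B] {A : Matrix (Fin N) (Fin N) F} {m : ∀ b, GL (Fin (k b)) F}
    (h : D.Lev A (fun b => (m b).val)) : ∃ A' : GL (Fin N) F, A'.val = A :=
  ⟨GeneralLinearGroup.mkOfDetNeZero A (D.lev_isUnit_det h), rfl⟩

theorem lev_mulSingle (b : B) {u : GL (Fin (k b)) F} {M : Matrix (Fin N) (Fin N) F}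
    (h : D.Lev M (1 + Pi.single b (u.val - 1))) :
    D.Lev M (fun b' => ((Pi.mulSingle b u : ∀ b, GL (Fin (k b)) F) b').val) := by
  refine h.congr (funext fun b' => ?_)
  by_cases hb : b' = b
  · subst hb
    simp
  · simp [Pi.single_eq_of_ne hb, Pi.mulSingle_eq_of_ne hb]

end Blocks

/-- permutation matrices, sending the basis vector `x` to `w x` -/
def permGL (F : Type*) [Field F] (N : ℕ) : Equiv.Perm (Fin N) →* GL (Fin N) F :=
  MonoidHom.toHomUnits
    { toFun := fun w => of fun x y => if x = w y then 1 else 0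
      map_one' := by
        ext x y
        simp [Matrix.one_apply]
        rfl
      map_mul' := fun w w' => by
        ext x y
        simp [Matrix.mul_apply]
        rfl }

section Perm

variable {F : Type*} [Field F] {N : ℕ}

theorem permGL_apply (w : Equiv.Perm (Fin N)) (x y : Fin N) :
    (permGL F N w).val x y = if x = w y then 1 else 0 := rfl

theorem permGL_inv_val (w : Equiv.Perm (Fin N)) :
    ((permGL F N w)⁻¹).val = (permGL F N w⁻¹).val := by rw [map_inv]

theorem mul_permGL_apply {ι : Type*} (w : Equiv.Perm (Fin N)) (M : Matrix ι (Fin N) F) (x : ι)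
    (y : Fin N) : (M * (permGL F N w).val) x y = M x (w y) := by
  simp [Matrix.mul_apply, permGL_apply]

theorem permGL_mul_apply {ι : Type*} (w : Equiv.Perm (Fin N)) (M : Matrix (Fin N) ι F)
    (x : Fin N) (y : ι) : ((permGL F N w).val * M) x y = M (w⁻¹ x) y := by
  rw [Matrix.mul_apply, Finset.sum_eq_single (w⁻¹ x)]
  · simp [permGL_apply]
  · intro z _ hz
    rw [permGL_apply, if_neg, zero_mul]
    rintro rfl
    simp at hz
  · simp

/-- Bruhat decomposition. -/
theorem bruhat (g : GL (Fin N) F) : ∃ (w : Equiv.Perm (Fin N)) (b₁ b₂ : GL (Fin N) F),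
    BlockTriangular b₁.val id ∧ BlockTriangular b₂.val id ∧ g = b₁ * permGL F N w * b₂ := by
  classical
  have hinj : ∀ v, (g⁻¹).val *ᵥ v = 0 → v = 0 := by
    intro v hv
    have : g.val *ᵥ ((g⁻¹).val *ᵥ v) = v := by
      rw [Matrix.mulVec_mulVec, Units.mul_inv, Matrix.one_mulVec]
    rw [← this, hv, Matrix.mulVec_zero]
  have hex : ∀ i : Fin N, ∃ c : ℕ, ∃ v : Fin N → F, v i ≠ 0 ∧ (∀ x, i < x → v x = 0) ∧
      ∀ y : Fin N, c ≤ y.val → ((g⁻¹).val *ᵥ v) y = 0 := fun i =>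
    ⟨N, Pi.single i 1, by simp, fun x hx => Pi.single_eq_of_ne hx.ne' _,
      fun y hy => absurd y.2 (not_lt.2 hy)⟩
  have hτ : ∀ i : Fin N, ∃ (c : Fin N) (v : Fin N → F), v i ≠ 0 ∧ (∀ x, i < x → v x = 0) ∧
      (∀ y, c < y → ((g⁻¹).val *ᵥ v) y = 0) ∧ ((g⁻¹).val *ᵥ v) c ≠ 0 ∧
      ∀ v' : Fin N → F, v' i ≠ 0 → (∀ x, i < x → v' x = 0) →
        (∀ y, c ≤ y → ((g⁻¹).val *ᵥ v') y = 0) → False := by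
    intro i
    obtain ⟨v, hv, hv', hv''⟩ := Nat.find_spec (hex i)
    set c := Nat.find (hex i) with hc
    have hc0 : c ≠ 0 := by
      intro h0
      apply hv
      rw [hinj v (funext fun y => hv'' y (by omega))]
      rfl
    have hcN : c - 1 < N := by
      by_contra hcon
      refine Nat.find_min (hex i) (m := c - 1) (by omega) ⟨v, hv, hv', fun y hy => ?_⟩
      have := y.2
      omega
    have hmin : ∀ v' : Fin N → F, v' i ≠ 0 → (∀ x, i < x → v' x = 0) →
        (∀ y, (⟨c - 1, hcN⟩ : Fin N) ≤ y → ((g⁻¹).val *ᵥ v') y = 0) → False := by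
      intro v' h1 h2 h3
      exact Nat.find_min (hex i) (m := c - 1) (by omega) ⟨v', h1, h2, fun y hy => h3 y hy⟩
    refine ⟨⟨c - 1, hcN⟩, v, hv, hv', fun y hy => hv'' y ?_, fun h => ?_, hmin⟩
    · have : c - 1 < y.val := hy
      omega
    · refine hmin v hv hv' fun y hy => ?_
      rcases hy.eq_or_lt with rfl | hlt
      · exact h
      · refine hv'' y ?_
        have : c - 1 < y.val := hlt
        omega
  choose τ v h1 h2 h3 h4 h5 using hτ
  have key : ∀ i j, i < j → τ i ≠ τ j := by
    intro i j hij e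
    refine h5 j (v j - (((g⁻¹).val *ᵥ v j) (τ j) / ((g⁻¹).val *ᵥ v i) (τ j)) • v i) ?_ ?_ ?_
    · rw [Pi.sub_apply, Pi.smul_apply, h2 i j hij, smul_zero, sub_zero]
      exact h1 j
    · intro x hx
      rw [Pi.sub_apply, Pi.smul_apply, h2 i x (hij.trans hx), h2 j x hx, smul_zero, sub_zero]
    · intro y hy
      rw [Matrix.mulVec_sub, Matrix.mulVec_smul, Pi.sub_apply, Pi.smul_apply, smul_eq_mul]
      rcases hy.eq_or_lt with rfl | hlt
      · rw [div_mul_cancel₀ _ (by rw [← e]; exact h4 i), sub_self]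
      · rw [h3 j y hlt, h3 i y (by rw [e]; exact hlt), mul_zero, sub_zero]
  have hτi : Function.Injective τ := by
    intro i j e
    by_contra hne
    rcases lt_or_gt_of_ne hne with h | h
    · exact key i j h e
    · exact key j i h e.symm
  let w : Equiv.Perm (Fin N) := Equiv.ofBijective τ (Finite.injective_iff_bijective.1 hτi)
  let b : Matrix (Fin N) (Fin N) F := of fun x i => v i x
  have hb : BlockTriangular b id := fun x y hxy => h2 y x hxy
  have hbd : b.det ≠ 0 := by
    rw [Matrix.det_of_isUpperTriangular hb]
    exact Finset.prod_ne_zero_iff.2 fun i _ => h1 i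
  let b₁ : GL (Fin N) F := GeneralLinearGroup.mkOfDetNeZero b hbd
  let b₂ : GL (Fin N) F := g⁻¹ * b₁ * (permGL F N w)⁻¹
  have hb₂ : BlockTriangular b₂.val id := by
    intro x y hxy
    change ((g⁻¹).val * b₁.val * ((permGL F N w)⁻¹).val) x y = 0
    rw [permGL_inv_val, mul_permGL_apply]
    have : w (w⁻¹ y) = y := by simp
    exact h3 (w⁻¹ y) x (by change w (w⁻¹ y) < x; rw [this]; exact hxy)
  refine ⟨w⁻¹, b₁, b₂⁻¹, hb, ?_, ?_⟩
  · have : Invertible b₂.val := b₂.invertible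
    rw [Matrix.coe_units_inv]
    exact blockTriangular_inv_of_blockTriangular hb₂
  · rw [map_inv]
    change g = b₁ * (permGL F N w)⁻¹ * (g⁻¹ * b₁ * (permGL F N w)⁻¹)⁻¹
    group

theorem blockTriangular_of_id {B : Type*} [LinearOrder B] {β : Fin N → B} (hβ : Monotone β)
    {M : Matrix (Fin N) (Fin N) F} (h : BlockTriangular M id) : BlockTriangular M β :=
  fun _ _ hij => h (hβ.reflect_lt hij)

/-- A permutation mapping blocks into blocks has an inverse doing the same. -/
theorem perm_preserves_inv {α B : Type*} [Finite α] {β : α → B} {w : Equiv.Perm α}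
    (h : ∀ x y, β x = β y → β (w x) = β (w y)) : ∀ x y, β x = β y → β (w⁻¹ x) = β (w⁻¹ y) := by
  have hp : ∀ (n : ℕ) x y, β x = β y → β ((w ^ n) x) = β ((w ^ n) y) := by
    intro n
    induction n with
    | zero => exact fun x y hxy => hxy
    | succ n ih =>
      intro x y hxy
      rw [pow_succ']
      exact h _ _ (ih x y hxy)
  have : Finite (Equiv.Perm α) := inferInstance
  have e : w⁻¹ = w ^ (Nat.card (Equiv.Perm α) - 1) := by
    rw [inv_eq_iff_mul_eq_one, ← pow_succ', Nat.sub_add_cancel Nat.card_pos, pow_card_eq_one']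
  rw [e]
  exact hp _

end Perm

end BlocksSection

section Preserve

namespace Blocks

variable {F : Type*} [Field F] {N : ℕ} {B : Type*} [LinearOrder B] {k : B → ℕ}
  {D : Blocks N k}

theorem lev_zero_of_strict {M : Matrix (Fin N) (Fin N) F}
    (h : ∀ x y, ¬ D.blk x < D.blk y → M x y = 0) : D.Lev M 0 := by
  refine ⟨fun x y hxy => h x y (lt_asymm hxy), fun b => ?_⟩
  ext i j
  rw [D.inclT_mul_mul_incl_apply, h _ _ (by rw [D.blk_enum, D.blk_enum]; exact lt_irrefl _)]
  rfl

theorem permGL_inv_mul_mul_apply (w : Equiv.Perm (Fin N)) (M : Matrix (Fin N) (Fin N) F)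
    (x y : Fin N) : (((permGL F N w)⁻¹).val * M * (permGL F N w).val) x y = M (w x) (w y) := by
  rw [mul_permGL_apply, permGL_inv_val, permGL_mul_apply, inv_inv]

theorem lev_zero_conj_perm (w : Equiv.Perm (Fin N)) (b : B)
    (y : Matrix (Fin (k b)) (Fin (k b)) F)
    (hy : ∀ i j, ¬ D.blk (w⁻¹ (D.enum b i)) < D.blk (w⁻¹ (D.enum b j)) → y i j = 0) :
    D.Lev (((permGL F N w)⁻¹).val * (D.incl F b * y * (D.incl F b)ᵀ) * (permGL F N w).val) 0 := by
  refine lev_zero_of_strict fun x z hxz => ?_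
  rw [permGL_inv_mul_mul_apply]
  by_cases hx : D.blk (w x) = b
  · by_cases hz : D.blk (w z) = b
    · obtain ⟨i, hi⟩ := D.surj _ _ hx
      obtain ⟨j, hj⟩ := D.surj _ _ hz
      have hs := (lev_single (D := D) b y).2 b
      rw [Pi.single_eq_same] at hs
      rw [← hi, ← hj, ← D.inclT_mul_mul_incl_apply (D.incl F b * y * (D.incl F b)ᵀ), hs]
      refine hy i j ?_
      rw [hi, hj]
      simpa using hxz
    · exact D.mul_inclT_apply_of_ne _ _ hz
  · rw [Matrix.mul_assoc]
    exact D.incl_mul_apply_of_ne _ _ hx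

section Slots

variable [Finite F] {V : B → Type*} [∀ b, AddCommGroup (V b)] [∀ b, Module ℂ (V b)]
  {ρ : ∀ b, Representation ℂ (GL (Fin (k b)) F) (V b)}
  {Z : Type*} [AddCommGroup Z] [Module ℂ Z]
  {R : (∀ b, GL (Fin (k b)) F) →* Module.End ℂ Z}
  {S : ∀ b, Module.End ℂ (V b) →ₗ[ℂ] Module.End ℂ Z}

theorem const_of_invariant (hρ : ∀ b, IsCuspidal (ρ b))
    (hS : ∀ b h, R (Pi.mulSingle b h) = S b (ρ b h)) (γ : Fin N → B) {v : Z} (hv : v ≠ 0)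
    (hinv : ∀ b (y : Matrix (Fin (k b)) (Fin (k b)) F),
      (∀ i j, ¬ γ (D.enum b i) < γ (D.enum b j) → y i j = 0) →
      ∀ u : GL (Fin (k b)) F, u.val = 1 + y → R (Pi.mulSingle b u) v = v) :
    ∀ x y, D.blk x = D.blk y → γ x = γ y := by
  have key : ∀ x y, D.blk x = D.blk y → ¬ γ x < γ y := by
    intro x y hxy hlt
    obtain ⟨b, hb⟩ : ∃ b, D.blk x = b := ⟨_, rfl⟩
    obtain ⟨i₀, rfl⟩ := D.surj b x hb
    obtain ⟨j₀, rfl⟩ := D.surj b y (hxy ▸ hb)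
    let K : Submodule F (Fin (k b) → F) :=
      { carrier := {z | ∀ i, γ (D.enum b j₀) ≤ γ (D.enum b i) → z i = 0}
        zero_mem' := fun _ _ => rfl
        add_mem' := fun {z z'} hz hz' i hi => by rw [Pi.add_apply, hz i hi, hz' i hi, add_zero]
        smul_mem' := fun c z hz i hi => by rw [Pi.smul_apply, hz i hi, smul_zero] }
    refine hv ((hρ b).eq_zero_of_unip K ?_ ?_ ((LinearMap.applyₗ v) ∘ₗ S b) v
      fun u n hu hn hn' => ?_)
    · rw [Submodule.ne_bot_iff]
      refine ⟨Pi.single i₀ 1, fun i hi => Pi.single_eq_of_ne ?_ _, ?_⟩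
      · rintro rfl
        exact absurd hlt (not_lt.2 hi)
      · rw [Ne, Pi.single_eq_zero_iff]
        exact one_ne_zero
    · intro hK
      have h1 : (Pi.single j₀ 1 : Fin (k b) → F) ∈ K := hK ▸ Submodule.mem_top
      have h2 := h1 j₀ le_rfl
      rw [Pi.single_eq_same] at h2
      exact one_ne_zero h2
    · change S b (ρ b u) v = v
      rw [← hS]
      refine hinv b n (fun i j hij => ?_) u hu
      have e : n i j = (n *ᵥ Pi.single j 1) i := by simp
      rcases lt_or_ge (γ (D.enum b j)) (γ (D.enum b j₀)) with hj | hj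
      · have hz : n *ᵥ Pi.single j 1 = 0 := hn _ fun i' hi' => by
          apply Pi.single_eq_of_ne
          rintro rfl
          exact absurd hj (not_lt.2 hi')
        rw [e, hz]
        rfl
      · rw [e]
        exact hn' _ i (hj.trans (not_lt.1 hij))
  exact fun x y hxy => le_antisymm (not_lt.1 (key y x hxy.symm)) (not_lt.1 (key x y hxy))

variable [Fintype B]

theorem preserves_of_equivariant (hρ : ∀ b, IsCuspidal (ρ b))
    (hS : ∀ b h, R (Pi.mulSingle b h) = S b (ρ b h)) (φ : GL (Fin N) F → Z)
    (h1 : ∀ (A g : GL (Fin N) F) m, D.Lev A.val (fun b => (m b).val) → φ (A * g) = R m (φ g))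
    (h2 : ∀ g u : GL (Fin N) F, D.Lev u.val 1 → φ (g * u) = φ g)
    (w : Equiv.Perm (Fin N)) (hw : φ (permGL F N w) ≠ 0) :
    ∀ x y, D.blk x = D.blk y → D.blk (w x) = D.blk (w y) := by
  have h := const_of_invariant (D := D) hρ hS (fun x => D.blk (w⁻¹ x)) hw fun b y hy u hu => ?_
  · simpa using perm_preserves_inv h
  · have hA : D.Lev (1 + D.incl F b * y * (D.incl F b)ᵀ) (fun b' =>
        ((Pi.mulSingle b u : ∀ b, GL (Fin (k b)) F) b').val) := by
      refine D.lev_mulSingle b ((lev_one.add (lev_single b y)).congr ?_)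
      rw [hu, add_sub_cancel_left]
    obtain ⟨A, hAv⟩ := D.lev_units hA
    rw [← hAv] at hA
    rw [← h1 A _ _ hA, show A * permGL F N w = permGL F N w *
      ((permGL F N w)⁻¹ * A * permGL F N w) by group]
    refine h2 _ _ ?_
    rw [Units.val_mul, Units.val_mul, hAv, Matrix.mul_add, Matrix.add_mul, Matrix.mul_one,
      Units.inv_mul]
    exact (lev_one.add (lev_zero_conj_perm w b y hy)).congr (add_zero _)

theorem preserves_of_invariant (hρ : ∀ b, IsCuspidal (ρ b))
    (hS : ∀ b h, R (Pi.mulSingle b h) = S b (ρ b h)) (w : Equiv.Perm (Fin N))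
    (X q : GL (Fin N) F) (hX : X = permGL F N w * q) (hq : BlockTriangular q.val D.blk)
    (hXX : X * X = 1) {v : Z} (hv : v ≠ 0)
    (hinv : ∀ (A : GL (Fin N) F) m, D.Lev A.val (fun b => (m b).val) → A * X = X * A →
      R m v = v) :
    ∀ x y, D.blk x = D.blk y → D.blk (w x) = D.blk (w y) := by
  have h := const_of_invariant (D := D) hρ hS (fun x => D.blk (w⁻¹ x)) hv fun b y hy u hu => ?_
  · simpa using perm_preserves_inv h
  · obtain ⟨mq, hq1, hq2⟩ := exists_lev q hq
    set n := D.incl F b * y * (D.incl F b)ᵀ with hn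
    have hX1 : X⁻¹ = X := inv_eq_of_mul_eq_one_left hXX
    have hXXv : X.val * X.val = 1 := by rw [← Units.val_mul, hXX, Units.val_one]
    have hn' : D.Lev (X.val * n * X.val) 0 := by
      have e : X.val * n * X.val = (q⁻¹).val * (((permGL F N w)⁻¹).val * n *
          (permGL F N w).val) * q.val := by
        have e1 : X.val * n * X.val = (X⁻¹).val * n * X.val := by rw [hX1]
        rw [e1, hX, _root_.mul_inv_rev, Units.val_mul, Units.val_mul]
        simp only [Matrix.mul_assoc]
      rw [e]
      refine ((hq2.mul (lev_zero_conj_perm w b y hy)).mul hq1).congr ?_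
      rw [mul_zero, zero_mul]
    have hA : D.Lev (1 + n + X.val * n * X.val) (fun b' =>
        ((Pi.mulSingle b u : ∀ b, GL (Fin (k b)) F) b').val) := by
      refine D.lev_mulSingle b (((lev_one.add (lev_single b y)).add hn').congr ?_)
      rw [hu, add_sub_cancel_left, add_zero]
    obtain ⟨A, hAv⟩ := D.lev_units hA
    rw [← hAv] at hA
    refine hinv A _ hA (Units.ext ?_)
    rw [Units.val_mul, Units.val_mul, hAv]
    have e2 : X.val * (X.val * n * X.val) = n * X.val := by
      rw [Matrix.mul_assoc X.val n, ← Matrix.mul_assoc X.val, hXXv, Matrix.one_mul]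
    have e3 : X.val * n * X.val * X.val = X.val * n := by
      rw [Matrix.mul_assoc, hXXv, Matrix.mul_one]
    rw [Matrix.mul_add, Matrix.mul_add, Matrix.add_mul, Matrix.add_mul, e2, e3, Matrix.one_mul,
      Matrix.mul_one]
    abel

end Slots

section Lift

variable [Fintype B] (w : Equiv.Perm (Fin N)) (b c : B)

/-- the permutation matrix restricted to a pair of blocks -/
theorem perm_mul_incl (hw : ∀ x, D.blk (w x) = b ↔ D.blk x = c) :
    (permGL F N w).val * D.incl F c =
      D.incl F b * ((D.incl F b)ᵀ * (permGL F N w).val * D.incl F c) := by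
  have h0 : ∀ a, a ≠ b → (D.incl F a)ᵀ * (permGL F N w).val * D.incl F c = 0 := by
    intro a ha
    ext i j
    rw [D.inclT_mul_mul_incl_apply, permGL_apply, if_neg]
    · rfl
    · intro h
      apply ha
      rw [← D.blk_enum a i, h]
      exact (hw _).2 (D.blk_enum c j)
  calc (permGL F N w).val * D.incl F c
      = (∑ a, D.incl F a * (D.incl F a)ᵀ) * ((permGL F N w).val * D.incl F c) := by
        rw [D.sum_incl_mul_inclT, Matrix.one_mul]
    _ = _ := by
        rw [Matrix.sum_mul, Finset.sum_eq_single b]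
        · simp only [Matrix.mul_assoc]
        · intro a _ ha
          rw [Matrix.mul_assoc, ← Matrix.mul_assoc (D.incl F a)ᵀ, h0 a ha, Matrix.mul_zero]
        · simp

theorem permGL_transpose : (permGL F N w).valᵀ = ((permGL F N w)⁻¹).val := by
  rw [permGL_inv_val]
  ext x y
  rw [transpose_apply, permGL_apply, permGL_apply]
  simp only [Equiv.Perm.eq_inv_iff_eq, eq_comm]

variable {w b c}

/-- A permutation matrix carrying the block `c` onto the block `b` induces a permutation matrix
between the blocks. -/
theorem exists_perm_lift (hw : ∀ x, D.blk (w x) = b ↔ D.blk x = c) :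
    ∃ (P : Matrix (Fin (k b)) (Fin (k c)) F) (P' : Matrix (Fin (k c)) (Fin (k b)) F),
      P * P' = 1 ∧ P' * P = 1 ∧ ((permGL F N w)⁻¹).val * D.incl F b = D.incl F c * P' ∧
      (D.incl F b)ᵀ * (permGL F N w).val = P * (D.incl F c)ᵀ := by
  set P := (D.incl F b)ᵀ * (permGL F N w).val * D.incl F c with hP
  have hP1 : (permGL F N w).val * D.incl F c = D.incl F b * P := perm_mul_incl w b c hw
  have hw' : ∀ x, D.blk (w⁻¹ x) = c ↔ D.blk x = b := fun x => by
    rw [← hw (w⁻¹ x), show w (w⁻¹ x) = x by simp]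
  set P' := (D.incl F c)ᵀ * ((permGL F N w)⁻¹).val * D.incl F b with hP'
  have hP2 : ((permGL F N w)⁻¹).val * D.incl F b = D.incl F c * P' := by
    have := perm_mul_incl (F := F) (D := D) w⁻¹ c b hw'
    rwa [← permGL_inv_val] at this
  have hPT : Pᵀ = P' := by
    rw [hP, hP', Matrix.transpose_mul, Matrix.transpose_mul, Matrix.transpose_transpose,
      permGL_transpose, Matrix.mul_assoc]
  have hP3 : (D.incl F b)ᵀ * (permGL F N w).val = P * (D.incl F c)ᵀ := by
    have := congrArg Matrix.transpose hP2
    rw [Matrix.transpose_mul, Matrix.transpose_mul, ← permGL_transpose, Matrix.transpose_transpose,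
      ← hPT, Matrix.transpose_transpose] at this
    exact this
  have hPP' : P * P' = 1 := by
    rw [hP, Matrix.mul_assoc, ← hP2, Matrix.mul_assoc, ← Matrix.mul_assoc (permGL F N w).val,
      Units.mul_inv, Matrix.one_mul, D.inclT_mul_incl_self]
  have hP'P : P' * P = 1 := by
    rw [hP', Matrix.mul_assoc, ← hP1, Matrix.mul_assoc, ← Matrix.mul_assoc ((permGL F N w)⁻¹).val,
      Units.inv_mul, Matrix.one_mul, D.inclT_mul_incl_self]
  exact ⟨P, P', hPP', hP'P, hP2, hP3⟩

/-- If `X = w q` is an involution and `w` maps the block `c` onto the block `b`, conjugation by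
`X` carries the block `b` of the Levi to the block `c`. -/
theorem exists_lift (hw : ∀ x, D.blk (w x) = b ↔ D.blk x = c) (X q : GL (Fin N) F)
    (hX : X = permGL F N w * q) (hq : BlockTriangular q.val D.blk) (hXX : X * X = 1) :
    ∃ (θ : Matrix (Fin (k b)) (Fin (k c)) F) (θ' : Matrix (Fin (k c)) (Fin (k b)) F),
      θ * θ' = 1 ∧ θ' * θ = 1 ∧
      (∀ y : Matrix (Fin (k b)) (Fin (k b)) F,
        D.Lev (X.val * (D.incl F b * y * (D.incl F b)ᵀ) * X.val) (Pi.single c (θ' * y * θ))) ∧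
      θ = (D.incl F b)ᵀ * X.val * D.incl F c ∧ θ' = (D.incl F c)ᵀ * X.val * D.incl F b := by
  obtain ⟨mq, hq1, hq2⟩ := exists_lev q hq
  obtain ⟨P, P', hPP', hP'P, hP2, hP3⟩ := exists_perm_lift (F := F) hw
  have hX1 : X⁻¹ = X := inv_eq_of_mul_eq_one_left hXX
  refine ⟨P * (mq c).val, ((mq c)⁻¹).val * P', ?_, ?_, ?_, ?_, ?_⟩
  · rw [Matrix.mul_assoc, ← Matrix.mul_assoc (mq c).val, Units.mul_inv, Matrix.one_mul, hPP']
  · rw [Matrix.mul_assoc, ← Matrix.mul_assoc P', hP'P, Matrix.one_mul, Units.inv_mul]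
  · intro y
    have e : X.val * (D.incl F b * y * (D.incl F b)ᵀ) * X.val =
        (q⁻¹).val * (D.incl F c * (P' * y * P) * (D.incl F c)ᵀ) * q.val := by
      have e1 : X.val * (D.incl F b * y * (D.incl F b)ᵀ) * X.val =
        (X⁻¹).val * (D.incl F b * y * (D.incl F b)ᵀ) * X.val := by rw [hX1]
      rw [e1, hX, _root_.mul_inv_rev, Units.val_mul, Units.val_mul]
      calc _ = (q⁻¹).val * ((((permGL F N w)⁻¹).val * D.incl F b) * y * ((D.incl F b)ᵀ *
                (permGL F N w).val)) * q.val := by simp only [Matrix.mul_assoc]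
        _ = _ := by
          rw [hP2, hP3]
          simp only [Matrix.mul_assoc]
    rw [e]
    refine ((hq2.mul (lev_single c (P' * y * P))).mul hq1).congr (funext fun a => ?_)
    rw [Pi.mul_apply, Pi.mul_apply]
    by_cases ha : a = c
    · subst ha
      rw [Pi.single_eq_same, Pi.single_eq_same]
      simp only [Matrix.mul_assoc]
    · rw [Pi.single_eq_of_ne ha, Pi.single_eq_of_ne ha, mul_zero, zero_mul]
  · have h1 := hq1.2 c
    dsimp only at h1
    rw [← h1, hX, Units.val_mul]
    calc P * ((D.incl F c)ᵀ * q.val * D.incl F c)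
        = (P * (D.incl F c)ᵀ) * q.val * D.incl F c := by simp only [Matrix.mul_assoc]
      _ = _ := by rw [← hP3]; simp only [Matrix.mul_assoc]
  · have h1 := hq2.2 c
    dsimp only at h1
    rw [← h1]
    have e1 : X.val = (q⁻¹).val * ((permGL F N w)⁻¹).val := by
      rw [← Units.val_mul, ← _root_.mul_inv_rev, ← hX, hX1]
    rw [e1]
    calc (D.incl F c)ᵀ * (q⁻¹).val * D.incl F c * P'
        = (D.incl F c)ᵀ * (q⁻¹).val * (D.incl F c * P') := by simp only [Matrix.mul_assoc]
      _ = _ := by rw [← hP2]; simp only [Matrix.mul_assoc]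

variable {V : B → Type*} [∀ b, AddCommGroup (V b)] [∀ b, Module ℂ (V b)]
  [∀ b, FiniteDimensional ℂ (V b)] [Finite F]
  {ρ : ∀ b, Representation ℂ (GL (Fin (k b)) F) (V b)}
  {Z : Type*} [AddCommGroup Z] [Module ℂ Z]
  {R : (∀ b, GL (Fin (k b)) F) →* Module.End ℂ Z}
  {S : ∀ b, Module.End ℂ (V b) →ₗ[ℂ] Module.End ℂ Z}

/-- An averaging argument: a vector fixed by a diagonally embedded general linear group
yields a duality between two slots. -/
theorem repIso_dual_of_slots {G : Type*} [Group G] [Finite G] {V₁ V₂ : Type*} [AddCommGroup V₁]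
    [Module ℂ V₁] [FiniteDimensional ℂ V₁] [AddCommGroup V₂] [Module ℂ V₂]
    [FiniteDimensional ℂ V₂] {ρ₁ : Representation ℂ G V₁} {ρ₂ : Representation ℂ G V₂}
    (h₁ : IsIrred ρ₁) (h₂ : IsIrred ρ₂) (S₁ : Module.End ℂ V₁ →ₗ[ℂ] Module.End ℂ Z)
    (S₂ : Module.End ℂ V₂ →ₗ[ℂ] Module.End ℂ Z) {v : Z} (hv : v ≠ 0)
    (h : ∀ g, S₁ (ρ₁ g) (S₂ (ρ₂ g) v) = v) : RepIso ρ₁.dual ρ₂ := by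
  have : Fintype G := Fintype.ofFinite G
  by_contra hcon
  have h0 := sum_mul_eq_zero_of_coef (E := fun g => ρ₁ g) (E' := fun g => ρ₂ g)
    (fun l l' v v' => by
      by_contra hne
      exact hcon (h₁.repIso_dual_of_sum_ne_zero h₂ l l' v v' hne))
    (LinearMap.mul ℂ (Module.End ℂ Z)) S₁ S₂
  have h1 := congrArg (fun T : Module.End ℂ Z => T v) h0
  simp only [LinearMap.sum_apply, LinearMap.mul_apply', Module.End.mul_apply, h,
    LinearMap.zero_apply, Finset.sum_const, Finset.card_univ] at h1
  rw [← Nat.cast_smul_eq_nsmul ℂ, smul_eq_zero] at h1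
  exact h1.elim (fun h2 => Fintype.card_ne_zero (Nat.cast_eq_zero.1 h2)) hv

theorem repIso_dual_of_invariant (hi : IsIrred (ρ b)) (hi' : IsIrred (ρ c))
    (hS : ∀ b h, R (Pi.mulSingle b h) = S b (ρ b h)) (hbc : b ≠ c)
    (hw : ∀ x, D.blk (w x) = b ↔ D.blk x = c) (X q : GL (Fin N) F)
    (hX : X = permGL F N w * q) (hq : BlockTriangular q.val D.blk) (hXX : X * X = 1)
    {v : Z} (hv : v ≠ 0)
    (hinv : ∀ (A : GL (Fin N) F) m, D.Lev A.val (fun b => (m b).val) → A * X = X * A →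
      R m v = v) :
    ∃ h : k b = k c, RepIso (ρ b).dual ((ρ c).comp (castGL h).toMonoidHom) := by
  obtain ⟨θ, θ', h1, h2, hθ, -, -⟩ := exists_lift (F := F) hw X q hX hq hXX
  refine repIso_castGL θ θ' h1 h2 (repIso_dual_of_slots (Z := Z) hi
    (hi'.comp _ (conjGL_surjective θ θ' h1 h2)) (S b) (S c) hv fun g => ?_)
  change S b (ρ b g) (S c (ρ c (conjGL θ θ' h1 h2 g)) v) = v
  rw [← hS, ← hS, ← Module.End.mul_apply, ← map_mul]
  have hXXv : X.val * X.val = 1 := by rw [← Units.val_mul, hXX, Units.val_one]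
  set n := D.incl F b * (g.val - 1) * (D.incl F b)ᵀ with hn
  have hA : D.Lev (1 + n + X.val * n * X.val) (fun a =>
      ((Pi.mulSingle b g * Pi.mulSingle c (conjGL θ θ' h1 h2 g) :
        ∀ b, GL (Fin (k b)) F) a).val) := by
    refine ((lev_one.add (lev_single b _)).add (hθ _)).congr (funext fun a => ?_)
    rw [Pi.add_apply, Pi.add_apply, Pi.mul_apply]
    by_cases hab : a = b
    · subst hab
      simp [hbc]
    · by_cases hac : a = c
      · subst hac
        rw [Pi.single_eq_of_ne hab, Pi.mulSingle_eq_of_ne hab, one_mul, Pi.single_eq_same,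
          Pi.mulSingle_eq_same, conjGL_val, Matrix.mul_sub, Matrix.sub_mul, Matrix.mul_one, h2]
        simp
      · simp [hab, hac]
  obtain ⟨A, hAv⟩ := D.lev_units hA
  rw [← hAv] at hA
  refine hinv A _ hA (Units.ext ?_)
  rw [Units.val_mul, Units.val_mul, hAv]
  have e2 : X.val * (X.val * n * X.val) = n * X.val := by
    rw [Matrix.mul_assoc X.val n, ← Matrix.mul_assoc X.val, hXXv, Matrix.one_mul]
  have e3 : X.val * n * X.val * X.val = X.val * n := by
    rw [Matrix.mul_assoc, hXXv, Matrix.mul_one]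
  rw [Matrix.mul_add, Matrix.mul_add, Matrix.add_mul, Matrix.add_mul, e2, e3, Matrix.one_mul,
    Matrix.mul_one]
  abel

theorem selfDual_of_invariant (h2 : (2 : F) ≠ 0) (hi : IsIrred (ρ b)) (hc : IsCuspidal (ρ b))
    (hS : ∀ b h, R (Pi.mulSingle b h) = S b (ρ b h))
    (hw : ∀ x, D.blk (w x) = b ↔ D.blk x = b) (X q : GL (Fin N) F)
    (hX : X = permGL F N w * q) (hq : BlockTriangular q.val D.blk) (hXX : X * X = 1)
    {v : Z} (hv : v ≠ 0)
    (hinv : ∀ (A : GL (Fin N) F) m, D.Lev A.val (fun b => (m b).val) → A * X = X * A →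
      R m v = v) :
    RepIso (ρ b) (ρ b).dual := by
  obtain ⟨θ, θ', h11, h12, hθ, e1, e2⟩ := exists_lift (F := F) hw X q hX hq hXX
  obtain rfl : θ = θ' := e1.trans e2.symm
  let C : Subgroup (GL (Fin (k b)) F) :=
    { carrier := {h | h.val * θ = θ * h.val}
      one_mem' := by simp
      mul_mem' := fun {x y} hx hy => by
        change _ = _ at hx hy
        change _ = _
        rw [Units.val_mul, mul_assoc, hy, ← mul_assoc, hx, mul_assoc]
      inv_mem' := fun {x} hx => by
        change _ = _ at hx
        change _ = _
        calc (x⁻¹).val * θ = (x⁻¹).val * (θ * x.val) * (x⁻¹).val := by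
              rw [mul_assoc, mul_assoc θ, Units.mul_inv, mul_one]
          _ = _ := by rw [← hx, ← mul_assoc, Units.inv_mul, one_mul] }
  have hfix : ∀ g ∈ C, S b (ρ b g) v = v := by
    intro g hg
    change g.val * θ = θ * g.val at hg
    have hXXv : X.val * X.val = 1 := by rw [← Units.val_mul, hXX, Units.val_one]
    rw [← hS]
    set n := D.incl F b * ((2 : F)⁻¹ • (g.val - 1)) * (D.incl F b)ᵀ with hn
    have hA : D.Lev (1 + n + X.val * n * X.val) (fun a =>
        ((Pi.mulSingle b g : ∀ b, GL (Fin (k b)) F) a).val) := by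
      refine D.lev_mulSingle b (((lev_one.add (lev_single b _)).add (hθ _)).congr ?_)
      rw [add_assoc, ← Pi.single_add]
      congr 2
      rw [Matrix.mul_smul, Matrix.smul_mul, ← smul_add, Matrix.mul_sub, Matrix.sub_mul,
        Matrix.mul_one, h11, ← hg, Matrix.mul_assoc, h11, Matrix.mul_one, ← two_smul F,
        smul_smul, inv_mul_cancel₀ h2, one_smul]
    obtain ⟨A, hAv⟩ := D.lev_units hA
    rw [← hAv] at hA
    refine hinv A _ hA (Units.ext ?_)
    rw [Units.val_mul, Units.val_mul, hAv]
    have e2 : X.val * (X.val * n * X.val) = n * X.val := by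
      rw [Matrix.mul_assoc X.val n, ← Matrix.mul_assoc X.val, hXXv, Matrix.one_mul]
    have e3 : X.val * n * X.val * X.val = X.val * n := by
      rw [Matrix.mul_assoc, hXXv, Matrix.mul_one]
    rw [Matrix.mul_add, Matrix.mul_add, Matrix.add_mul, Matrix.add_mul, e2, e3, Matrix.one_mul,
      Matrix.mul_one]
    abel
  have : Finite (GL (Fin (k b)) F) := inferInstance
  have : Fintype C := Fintype.ofFinite _
  obtain ⟨z, hz⟩ : ∃ z, (∑ g : C, ρ b g) z ≠ 0 := by
    by_contra hcon
    push Not at hcon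
    have h0 : ∑ g : C, ρ b g = 0 := LinearMap.ext hcon
    have h1 := congrArg (fun T => S b T v) h0
    simp only [map_sum, LinearMap.sum_apply, map_zero, LinearMap.zero_apply] at h1
    rw [Finset.sum_congr rfl fun g _ => hfix g.1 g.2, Finset.sum_const, Finset.card_univ,
      ← Nat.cast_smul_eq_nsmul ℂ, smul_eq_zero] at h1
    exact h1.elim (fun h2 => Fintype.card_ne_zero (Nat.cast_eq_zero.1 h2)) hv
  refine hc.selfDual_of_involution h2 hi θ h11 _ hz fun h hh => ?_
  rw [LinearMap.sum_apply, map_sum]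
  simp only [← rep_mul_apply]
  exact Fintype.sum_equiv (Equiv.mulLeft (⟨h, hh⟩ : C)) _ _ fun g => rfl

end Lift

end Blocks

end Preserve

section BraidTower

variable {A : Type*} [Ring A] [Algebra ℂ A]

/-- the tower of spaces `M₀ = ℂ`, `M_{k+1} = M_k + M_k T_k M_k` generated by a sequence `T` -/
def tower (T : ℕ → A) : ℕ → Submodule ℂ A
  | 0 => 1
  | k + 1 => tower T k + tower T k * Submodule.span ℂ {T k} * tower T k

theorem tower_le_succ (T : ℕ → A) (k : ℕ) : tower T k ≤ tower T (k + 1) :=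
  le_sup_left

theorem one_le_tower (T : ℕ → A) (k : ℕ) : 1 ≤ tower T k := by
  induction k with
  | zero => exact le_rfl
  | succ k ih => exact ih.trans (tower_le_succ T k)

theorem tower_mono (T : ℕ → A) : Monotone (tower T) :=
  monotone_nat_of_le_succ (tower_le_succ T)

theorem span_le_tower_succ (T : ℕ → A) (k : ℕ) :
    Submodule.span ℂ {T k} ≤ tower T (k + 1) := by
  refine le_trans ?_ (le_sup_right : tower T k * Submodule.span ℂ {T k} * tower T k ≤ _)
  calc Submodule.span ℂ {T k} = 1 * Submodule.span ℂ {T k} * 1 := by simp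
    _ ≤ _ := mul_le_mul' (mul_le_mul' (one_le_tower T k) le_rfl) (one_le_tower T k)

/-- an element commuting with the earlier generators commutes with the tower -/
theorem commute_tower (T : ℕ → A) (y : A) :
    ∀ k, (∀ i, i < k → T i * y = y * T i) → ∀ x ∈ tower T k, x * y = y * x := by
  intro k
  induction k with
  | zero =>
    intro _ x hx
    obtain ⟨z, rfl⟩ := Submodule.mem_one.1 hx
    exact Algebra.commutes z y
  | succ k ih =>
    intro h x hx
    have ih' := ih fun i hi => h i (hi.trans (Nat.lt_succ_self k))
    obtain ⟨u, hu, v, hv, rfl⟩ := Submodule.mem_sup.1 hx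
    rw [add_mul, mul_add, ih' u hu]
    congr 1
    refine Submodule.mul_induction_on hv (fun a ha b hb => ?_) fun a b ha hb => ?_
    · refine Submodule.mul_induction_on ha (fun a ha t ht => ?_) fun a a' ha ha' => ?_
      · obtain ⟨z, rfl⟩ := Submodule.mem_span_singleton.1 ht
        rw [mul_assoc, ih' b hb, ← mul_assoc, mul_assoc a, smul_mul_assoc,
          h k (Nat.lt_succ_self k), ← mul_smul_comm, ← mul_assoc, ih' a ha]
        simp only [mul_assoc]
      · rw [add_mul, add_mul, mul_add, ha, ha']
    · rw [add_mul, mul_add, ha, hb]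

theorem tower_mul_tower {T : ℕ → A} (hcomm : ∀ i j, i + 2 ≤ j → T i * T j = T j * T i)
    (hbraid : ∀ i, T i * T (i + 1) * T i = T (i + 1) * T i * T (i + 1))
    (hquad : ∀ i, ∃ α β : ℂ, T i * T i = α • 1 + β • T i) (k : ℕ) :
    tower T k * tower T k ≤ tower T k := by
  have htt : ∀ k, Submodule.span ℂ {T k} * Submodule.span ℂ {T k}
      ≤ 1 + Submodule.span ℂ {T k} := by
    intro k
    obtain ⟨α, β, h⟩ := hquad k
    rw [Submodule.span_mul_span, Set.singleton_mul_singleton, Submodule.span_singleton_le_iff_mem,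
      h]
    exact Submodule.add_mem_sup (Submodule.smul_mem _ _ (Submodule.one_le.1 le_rfl))
      (Submodule.smul_mem _ _ (Submodule.mem_span_singleton_self _))
  induction k with
  | zero => simp [tower]
  | succ k ih =>
    have h1 := one_le_tower T k
    have hM : tower T k ≤ tower T (k + 1) := tower_le_succ T k
    have hMtM : tower T k * Submodule.span ℂ {T k} * tower T k ≤ tower T (k + 1) := le_sup_right
    have key : Submodule.span ℂ {T k} * tower T k * Submodule.span ℂ {T k}
        ≤ tower T (k + 1) := by
      cases k with
      | zero =>
        rw [tower, mul_one]
        exact (htt 0).trans (sup_le (one_le_tower T 1) (span_le_tower_succ T 0))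
      | succ j =>
        have hc : Submodule.span ℂ {T (j + 1)} * tower T j
            = tower T j * Submodule.span ℂ {T (j + 1)} := by
          have h := commute_tower T (T (j + 1)) j fun i hi => hcomm i (j + 1) (by omega)
          apply le_antisymm
          · refine Submodule.mul_le.2 fun t ht x hx => ?_
            obtain ⟨z, rfl⟩ := Submodule.mem_span_singleton.1 ht
            rw [smul_mul_assoc, ← h x hx, ← mul_smul_comm]
            exact Submodule.mul_mem_mul hx ht
          · refine Submodule.mul_le.2 fun x hx t ht => ?_
            obtain ⟨z, rfl⟩ := Submodule.mem_span_singleton.1 ht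
            rw [mul_smul_comm, h x hx, ← smul_mul_assoc]
            exact Submodule.mul_mem_mul ht hx
        have hb : Submodule.span ℂ {T (j + 1)} * Submodule.span ℂ {T j}
            * Submodule.span ℂ {T (j + 1)}
            = Submodule.span ℂ {T j} * Submodule.span ℂ {T (j + 1)} * Submodule.span ℂ {T j} := by
          simp only [Submodule.span_mul_span, Set.singleton_mul_singleton, hbraid]
        set t := Submodule.span ℂ {T (j + 1)} with ht
        set s := Submodule.span ℂ {T j} with hs
        set M := tower T j with hMj
        have hM' : tower T (j + 1) = M + M * s * M := rfl
        have hMle : M ≤ tower T (j + 1) := tower_le_succ T j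
        have hMs : M * s ≤ tower T (j + 1) := by
          calc M * s = M * s * 1 := by rw [mul_one]
            _ ≤ M * s * M := mul_le_mul' le_rfl (one_le_tower T j)
            _ ≤ _ := le_sup_right
        have hsM : s * M ≤ tower T (j + 1) := by
          calc s * M = 1 * s * M := by rw [one_mul]
            _ ≤ M * s * M := mul_le_mul' (mul_le_mul' (one_le_tower T j) le_rfl) le_rfl
            _ ≤ _ := le_sup_right
        rw [hM', mul_add, add_mul]
        refine sup_le ?_ ?_
        · calc t * M * t = M * (t * t) := by rw [hc, mul_assoc]
            _ ≤ M * (1 + t) := mul_le_mul' le_rfl (htt (j + 1))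
            _ = M + M * t * 1 := by rw [mul_add, mul_one, mul_one]
            _ ≤ _ := sup_le (hMle.trans hM)
              ((mul_le_mul' (mul_le_mul' hMle le_rfl) h1).trans hMtM)
        · calc t * (M * s * M) * t = (t * M) * s * (M * t) := by simp only [mul_assoc]
            _ = M * (t * s * t) * M := by rw [← hc, hc]; simp only [mul_assoc]; rw [hc]
            _ = (M * s) * t * (s * M) := by rw [hb]; simp only [mul_assoc]
            _ ≤ _ := (mul_le_mul' (mul_le_mul' hMs le_rfl) hsM).trans hMtM
    have hL : tower T k * tower T (k + 1) ≤ tower T (k + 1) := by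
      rw [tower, mul_add]
      refine sup_le (ih.trans hM) ?_
      rw [← mul_assoc, ← mul_assoc]
      exact (mul_le_mul' (mul_le_mul' ih le_rfl) le_rfl).trans hMtM
    have hR : tower T (k + 1) * tower T k ≤ tower T (k + 1) := by
      rw [tower, add_mul]
      refine sup_le (ih.trans hM) ?_
      rw [mul_assoc]
      exact (mul_le_mul' le_rfl ih).trans hMtM
    conv_lhs => rw [tower]
    rw [add_mul]
    refine sup_le ((mul_le_mul' le_rfl le_rfl).trans hL) ?_
    rw [mul_add]
    refine sup_le ((mul_le_mul' hMtM le_rfl).trans hR) ?_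
    calc tower T k * Submodule.span ℂ {T k} * tower T k
          * (tower T k * Submodule.span ℂ {T k} * tower T k)
        = tower T k * (Submodule.span ℂ {T k} * (tower T k * tower T k)
          * Submodule.span ℂ {T k}) * tower T k := by simp only [mul_assoc]
      _ ≤ tower T k * (Submodule.span ℂ {T k} * tower T k * Submodule.span ℂ {T k})
          * tower T k :=
        mul_le_mul' (mul_le_mul' le_rfl (mul_le_mul' (mul_le_mul' le_rfl ih) le_rfl)) le_rfl
      _ ≤ tower T k * tower T (k + 1) * tower T k :=
        mul_le_mul' (mul_le_mul' le_rfl key) le_rfl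
      _ ≤ tower T (k + 1) := (mul_le_mul' hL le_rfl).trans hR

open MulOpposite

/-- A trace takes the same value on both components of the elements of the algebra generated by
the pairs `(T i, op (T i))`, when `T` satisfies the relations of a Hecke algebra of type `A`. -/
theorem trace_eq_of_mem_tower {T : ℕ → A}
    (hcomm : ∀ i j, i + 2 ≤ j → T i * T j = T j * T i)
    (hbraid : ∀ i, T i * T (i + 1) * T i = T (i + 1) * T i * T (i + 1))
    (hquad : ∀ i, ∃ α β : ℂ, T i * T i = α • 1 + β • T i) (k : ℕ) :
    ∀ τ : A →ₗ[ℂ] ℂ,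
      (∀ h ∈ tower (fun i => ((T i, op (T i)) : A × Aᵐᵒᵖ)) (k - 1),
        ∀ x ∈ tower (fun i => ((T i, op (T i)) : A × Aᵐᵒᵖ)) k,
        τ (x.1 * h.1) = τ (h.1 * x.1) ∧ τ (unop x.2 * unop h.2) = τ (unop h.2 * unop x.2)) →
      ∀ x ∈ tower (fun i => ((T i, op (T i)) : A × Aᵐᵒᵖ)) k, τ x.1 = τ (unop x.2) := by
  set T' : ℕ → A × Aᵐᵒᵖ := fun i => (T i, op (T i)) with hT'
  have hcomm' : ∀ i j, i + 2 ≤ j → T' i * T' j = T' j * T' i := fun i j h =>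
    Prod.ext (hcomm i j h) (unop_injective (hcomm i j h).symm)
  have hbraid' : ∀ i, T' i * T' (i + 1) * T' i = T' (i + 1) * T' i * T' (i + 1) := fun i =>
    Prod.ext (hbraid i) (unop_injective (by simpa [hT', mul_assoc] using hbraid i))
  have hquad' : ∀ i, ∃ α β : ℂ, T' i * T' i = α • 1 + β • T' i := fun i => by
    obtain ⟨α, β, h⟩ := hquad i
    exact ⟨α, β, Prod.ext h (unop_injective h)⟩
  have hmul := tower_mul_tower hcomm' hbraid' hquad'
  induction k with
  | zero =>
    intro τ _ x hx
    obtain ⟨z, rfl⟩ := Submodule.mem_one.1 hx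
    rfl
  | succ k ih =>
    intro τ hτ x hx
    rw [Nat.add_sub_cancel] at hτ
    have hk : tower T' (k - 1) ≤ tower T' k := tower_mono T' (Nat.sub_le k 1)
    have hTk : T' k ∈ tower T' (k + 1) :=
      span_le_tower_succ T' k (Submodule.mem_span_singleton_self _)
    have hmul' : ∀ {x y}, x ∈ tower T' (k + 1) → y ∈ tower T' (k + 1) →
        x * y ∈ tower T' (k + 1) := fun hx hy => hmul (k + 1) (Submodule.mul_mem_mul hx hy)
    have hle := tower_le_succ T' k
    have hcT : ∀ h ∈ tower T' (k - 1), h * T' k = T' k * h := by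
      cases k with
      | zero =>
        intro h hh
        obtain ⟨z, rfl⟩ := Submodule.mem_one.1 hh
        exact Algebra.commutes z _
      | succ j => exact commute_tower T' _ j fun i hi => hcomm' i (j + 1) (by omega)
    have ihT : ∀ y ∈ tower T' k, τ (y.1 * T k) = τ (unop y.2 * T k) := by
      refine ih (τ ∘ₗ LinearMap.mulRight ℂ (T k)) fun h hh x hx => ?_
      have e := hcT h hh
      have e1 : h.1 * T k = T k * h.1 := congrArg Prod.fst e
      have e2 : T k * unop h.2 = unop h.2 * T k := congrArg unop (congrArg Prod.snd e)
      constructor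
      · change τ (x.1 * h.1 * T k) = τ (h.1 * x.1 * T k)
        have := (hτ h (hk hh) (x * T' k) (hmul' (hle hx) hTk)).1
        change τ (x.1 * T k * h.1) = τ (h.1 * (x.1 * T k)) at this
        rw [mul_assoc, e1, ← mul_assoc, this, mul_assoc]
      · change τ (unop x.2 * unop h.2 * T k) = τ (unop h.2 * unop x.2 * T k)
        have := (hτ h (hk hh) (T' k * x) (hmul' hTk (hle hx))).2
        change τ (unop x.2 * T k * unop h.2) = τ (unop h.2 * (unop x.2 * T k)) at this
        rw [mul_assoc, ← e2, ← mul_assoc, this, mul_assoc]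
    obtain ⟨u, hu, v, hv, rfl⟩ := Submodule.mem_sup.1 hx
    have hu' : τ u.1 = τ (unop u.2) :=
      ih τ (fun h hh x hx => hτ h (hk hh) x (hle hx)) u hu
    rw [Prod.fst_add, Prod.snd_add, unop_add, _root_.map_add, _root_.map_add, hu']
    congr 1
    refine Submodule.mul_induction_on hv (fun a ha b hb => ?_) fun a b ha hb => ?_
    · refine Submodule.mul_induction_on ha (fun a ha t ht => ?_) fun a a' ha ha' => ?_
      · obtain ⟨z, rfl⟩ := Submodule.mem_span_singleton.1 ht
        have h1 := (hτ b hb (a * T' k) (hmul' (hle ha) hTk)).1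
        have h3 := ihT (b * a) (hmul k (Submodule.mul_mem_mul hb ha))
        change τ (a.1 * T k * b.1) = τ (b.1 * (a.1 * T k)) at h1
        change τ (b.1 * a.1 * T k) = τ (unop a.2 * unop b.2 * T k) at h3
        have h5 := (hτ a ha (T' k * b) (hmul' hTk (hle hb))).2
        change τ (unop b.2 * T k * unop a.2) = τ (unop a.2 * (unop b.2 * T k)) at h5
        change τ (a.1 * (z • T k) * b.1) = τ (unop b.2 * (z • T k * unop a.2))
        rw [mul_smul_comm, smul_mul_assoc, smul_mul_assoc, mul_smul_comm, _root_.map_smul,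
          _root_.map_smul, h1, ← mul_assoc, h3, ← mul_assoc (unop b.2), h5, mul_assoc]
      · rw [add_mul, Prod.fst_add, Prod.snd_add, unop_add, _root_.map_add, _root_.map_add, ha, ha']
    · rw [Prod.fst_add, Prod.snd_add, unop_add, _root_.map_add, _root_.map_add, ha, hb]

end BraidTower

section Hecke

variable {G : Type*} [Group G] {Q : Subgroup G} [Fintype Q] {S : Type*} [Group S]
  {X W : Type*} [AddCommGroup X] [Module ℂ X] [AddCommGroup W] [Module ℂ W]
  (x : Representation ℂ Q X) (π : Representation ℂ G W)

/-- averaging a linear map over a subgroup -/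
def avg : (X →ₗ[ℂ] W) →ₗ[ℂ] equivariantMaps x (π.comp Q.subtype) :=
  LinearMap.codRestrict _
    ((Fintype.card Q : ℂ)⁻¹ • ∑ q : Q, Representation.linHom x (π.comp Q.subtype) q)
    (fun θ g v => by
      rw [LinearMap.smul_apply, LinearMap.sum_apply, LinearMap.smul_apply, LinearMap.sum_apply,
        LinearMap.smul_apply, LinearMap.sum_apply, _root_.map_smul, map_sum,
        ← Equiv.sum_comp (Equiv.mulLeft g)]
      congr 1
      refine Finset.sum_congr rfl fun q _ => ?_
      simp only [Representation.linHom_apply, LinearMap.comp_apply, Equiv.coe_mulLeft]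
      rw [rep_mul_apply (π.comp Q.subtype), _root_.mul_inv_rev, rep_mul_apply x,
        rep_inv_self_apply])

variable {x π}

theorem avg_apply (θ : X →ₗ[ℂ] W) (v : X) :
    (avg x π θ).1 v = (Fintype.card Q : ℂ)⁻¹ • ∑ q : Q, π q (θ (x q⁻¹ v)) := by
  change ((Fintype.card Q : ℂ)⁻¹ • ∑ q : Q, Representation.linHom x (π.comp Q.subtype) q) θ v = _
  rw [LinearMap.smul_apply, LinearMap.sum_apply, LinearMap.smul_apply, LinearMap.sum_apply]
  rfl

theorem card_inv_smul_sum {Z : Type*} [AddCommGroup Z] [Module ℂ Z] {ι : Type*} [Fintype ι]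
    [Nonempty ι] (z : Z) : (Fintype.card ι : ℂ)⁻¹ • ∑ _ : ι, z = z := by
  rw [Finset.sum_const, Finset.card_univ, ← Nat.cast_smul_eq_nsmul ℂ, smul_smul,
    inv_mul_cancel₀ (by exact_mod_cast Fintype.card_ne_zero), one_smul]

theorem avg_self (δ : equivariantMaps x (π.comp Q.subtype)) : avg x π δ.1 = δ := by
  apply Subtype.ext
  ext v
  rw [avg_apply]
  have : ∀ q : Q, π q (δ.1 (x q⁻¹ v)) = δ.1 v := fun q => by
    rw [δ.2, MonoidHom.comp_apply, ← rep_mul_apply]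
    simp
  simp only [this]
  exact card_inv_smul_sum _

theorem avg_translate (q : Q) (θ : X →ₗ[ℂ] W) :
    avg x π (π q ∘ₗ θ ∘ₗ x q⁻¹) = avg x π θ := by
  apply Subtype.ext
  ext v
  rw [avg_apply, avg_apply,
    ← Equiv.sum_comp (Equiv.mulRight q) fun p : Q => π p (θ (x p⁻¹ v))]
  congr 1
  refine Finset.sum_congr rfl fun p _ => ?_
  simp only [LinearMap.comp_apply, Equiv.coe_mulRight]
  rw [_root_.mul_inv_rev, rep_mul_apply x, Subgroup.coe_mul, rep_mul_apply π]

theorem avg_left (q : Q) (θ : X →ₗ[ℂ] W) :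
    avg x π (π q ∘ₗ θ) = avg x π (θ ∘ₗ x q) := by
  rw [← avg_translate q (θ ∘ₗ x q)]
  congr 1
  ext v
  simp only [LinearMap.comp_apply]
  rw [← rep_mul_apply x, mul_inv_cancel, rep_one_apply]

variable (x π) (ν : S →* G) (J : Representation ℂ S X)

/-- the operator on `Hom_Q(x, π)` attached to an element of `S` -/
def hecke (σ : S) : Module.End ℂ (equivariantMaps x (π.comp Q.subtype)) where
  toFun δ := avg x π (π (ν σ) ∘ₗ δ.1 ∘ₗ J σ⁻¹)
  map_add' δ δ' := by
    rw [← _root_.map_add]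
    congr 1
    ext v
    simp
  map_smul' z δ := by
    rw [RingHom.id_apply, ← _root_.map_smul]
    congr 1
    ext v
    simp

theorem hecke_apply (σ : S) (δ : equivariantMaps x (π.comp Q.subtype)) :
    hecke x π ν J σ δ = avg x π (π (ν σ) ∘ₗ δ.1 ∘ₗ J σ⁻¹) := rfl

theorem hecke_one : hecke x π ν J 1 = 1 := by
  ext1 δ
  rw [hecke_apply, Module.End.one_apply]
  conv_rhs => rw [← avg_self δ]
  congr 1
  ext v
  simp

theorem hecke_hecke_apply (σ τ : S) (δ : equivariantMaps x (π.comp Q.subtype)) :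
    hecke x π ν J σ (hecke x π ν J τ δ) = (Fintype.card Q : ℂ)⁻¹ • ∑ q : Q,
      avg x π (π (ν σ * q * ν τ) ∘ₗ δ.1 ∘ₗ (J τ⁻¹ ∘ₗ x q⁻¹ ∘ₗ J σ⁻¹)) := by
  rw [hecke_apply, ← map_sum, ← _root_.map_smul]
  congr 1
  ext v
  simp only [LinearMap.comp_apply, LinearMap.smul_apply, LinearMap.sum_apply]
  rw [hecke_apply, avg_apply, _root_.map_smul, map_sum]
  simp only [LinearMap.comp_apply, rep_mul_apply π]

variable (hJ : ∀ (σ : S) (A A' : Q), (A' : G) = ν σ * A * (ν σ)⁻¹ →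
  ∀ v, x A' (J σ v) = J σ (x A v))

include hJ

theorem hecke_mul_term (σ τ : S) (q₁ q₂ q₁' q₂' : Q)
    (h₁ : (q₁' : G) = ν σ * q₁ * (ν σ)⁻¹) (h₂ : (q₂ : G) = ν τ * q₂' * (ν τ)⁻¹)
    (δ : equivariantMaps x (π.comp Q.subtype)) :
    avg x π (π (ν σ * (q₁ * q₂ : Q) * ν τ) ∘ₗ δ.1 ∘ₗ (J τ⁻¹ ∘ₗ x (q₁ * q₂)⁻¹ ∘ₗ J σ⁻¹))
      = avg x π (π (ν σ * ν τ) ∘ₗ δ.1 ∘ₗ (J τ⁻¹ ∘ₗ J σ⁻¹)) := by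
  rw [← avg_translate q₁' (π (ν σ * ν τ) ∘ₗ δ.1 ∘ₗ (J τ⁻¹ ∘ₗ J σ⁻¹))]
  congr 1
  ext v
  simp only [LinearMap.comp_apply]
  have e1 : (ν σ * (q₁ * q₂ : Q) * ν τ : G) = q₁' * (ν σ * ν τ) * q₂' := by
    rw [h₁, Subgroup.coe_mul, h₂]
    group
  have e2 : x q₁'⁻¹ v = J σ (x q₁⁻¹ (J σ⁻¹ v)) := by
    rw [← hJ σ q₁⁻¹ q₁'⁻¹ (by rw [Subgroup.coe_inv, Subgroup.coe_inv, h₁]; group),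
      rep_self_inv_apply]
  have e3 : ∀ u, J τ⁻¹ (x q₂⁻¹ u) = x q₂'⁻¹ (J τ⁻¹ u) := fun u => by
    apply rep_injective J τ
    rw [rep_self_inv_apply, ← hJ τ q₂'⁻¹ q₂⁻¹
      (by rw [Subgroup.coe_inv, Subgroup.coe_inv, h₂]; group), rep_self_inv_apply]
  rw [e1, e2, rep_inv_self_apply, rep_mul_apply π, rep_mul_apply π, _root_.mul_inv_rev,
    rep_mul_apply x, e3]
  congr 2
  have := δ.2 q₂' (x q₂'⁻¹ (J τ⁻¹ (x q₁⁻¹ (J σ⁻¹ v))))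
  rw [rep_self_inv_apply] at this
  exact this.symm

theorem hecke_mul (σ τ : S)
    (h : ∀ q : Q, ∃ q₁ q₂ q₁' q₂' : Q, q = q₁ * q₂ ∧ (q₁' : G) = ν σ * q₁ * (ν σ)⁻¹ ∧
      (q₂ : G) = ν τ * q₂' * (ν τ)⁻¹) :
    hecke x π ν J σ * hecke x π ν J τ = hecke x π ν J (σ * τ) := by
  ext1 δ
  rw [Module.End.mul_apply, hecke_hecke_apply]
  have : ∀ q : Q, avg x π (π (ν σ * q * ν τ) ∘ₗ δ.1 ∘ₗ (J τ⁻¹ ∘ₗ x q⁻¹ ∘ₗ J σ⁻¹))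
      = hecke x π ν J (σ * τ) δ := fun q => by
    obtain ⟨q₁, q₂, q₁', q₂', rfl, h₁, h₂⟩ := h q
    rw [hecke_mul_term x π ν J hJ σ τ q₁ q₂ q₁' q₂' h₁ h₂ δ, hecke_apply,
      _root_.map_mul ν, _root_.mul_inv_rev, _root_.map_mul J]
    rfl
  simp only [this]
  exact card_inv_smul_sum _

/-- the square of a Hecke operator attached to an involution -/
theorem hecke_sq_apply (τ : S) (hτ : τ * τ = 1) (E : Q → Q)
    (h : ∀ q : Q, ∃ q₂ q₂' : Q, q = E q * q₂ ∧ x (E q) = 1 ∧ (q₂ : G) = ν τ * q₂' * (ν τ)⁻¹)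
    (δ : equivariantMaps x (π.comp Q.subtype)) :
    (hecke x π ν J τ * hecke x π ν J τ) δ = (Fintype.card Q : ℂ)⁻¹ • ∑ q : Q,
      avg x π (π (ν τ * E q * (ν τ)⁻¹) ∘ₗ δ.1) := by
  rw [Module.End.mul_apply, hecke_hecke_apply]
  congr 1
  refine Finset.sum_congr rfl fun q _ => ?_
  congr 1
  obtain ⟨q₂, q₂', hq, h1, h₂⟩ := h q
  ext v
  simp only [LinearMap.comp_apply]
  have e1 : (ν τ * q * ν τ : G) = ν τ * E q * (ν τ)⁻¹ * q₂' := by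
    have hν : ν τ * ν τ = 1 := by rw [← _root_.map_mul, hτ, _root_.map_one]
    have hν' : (ν τ)⁻¹ = ν τ := inv_eq_of_mul_eq_one_left hν
    rw [show ((q : Q) : G) = E q * q₂ by rw [← Subgroup.coe_mul, ← hq], h₂]
    calc ν τ * (E q * (ν τ * q₂' * (ν τ)⁻¹)) * ν τ = ν τ * E q * ν τ * q₂' := by group
      _ = ν τ * E q * (ν τ)⁻¹ * q₂' := by rw [hν']
  have e2 : x q⁻¹ = x q₂⁻¹ := by
    rw [hq, _root_.mul_inv_rev, _root_.map_mul]
    have : x (E q)⁻¹ = 1 := by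
      have := _root_.map_mul x (E q) (E q)⁻¹
      rwa [mul_inv_cancel, _root_.map_one, h1, one_mul, eq_comm] at this
    rw [this, mul_one]
  have e3 : ∀ u, J τ⁻¹ (x q₂⁻¹ u) = x q₂'⁻¹ (J τ⁻¹ u) := fun u => by
    apply rep_injective J τ
    rw [rep_self_inv_apply, ← hJ τ q₂'⁻¹ q₂⁻¹
      (by rw [Subgroup.coe_inv, Subgroup.coe_inv, h₂]; group), rep_self_inv_apply]
  have e4 : J τ⁻¹ (J τ⁻¹ v) = v := by
    rw [← rep_mul_apply, ← _root_.mul_inv_rev, hτ, inv_one, rep_one_apply]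
  rw [e2, e3, e4, e1, rep_mul_apply π _ q₂'.1]
  congr 1
  have := δ.2 q₂' (x q₂'⁻¹ v)
  rw [rep_self_inv_apply] at this
  exact this.symm

end Hecke

namespace Blocks

section Transvection

variable {F : Type*} [Field F] {N : ℕ} {B : Type*} [LinearOrder B] {k : B → ℕ}
  (D : Blocks N k)

theorem offdiag_mul_offdiag {a b : B} (h : a ≠ b) (z z' : Matrix (Fin (k a)) (Fin (k b)) F) :
    D.incl F a * z * (D.incl F b)ᵀ * (D.incl F a * z' * (D.incl F b)ᵀ) = 0 := by
  rw [Matrix.mul_assoc (D.incl F a * z), Matrix.mul_assoc (D.incl F a) z',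
    ← Matrix.mul_assoc (D.incl F b)ᵀ, D.inclT_mul_incl_of_ne h.symm, Matrix.zero_mul,
    Matrix.mul_zero]

/-- the block transvection `1 + E_a z E_bᵀ` -/
def elem {a b : B} (h : a ≠ b) (z : Matrix (Fin (k a)) (Fin (k b)) F) : GL (Fin N) F where
  val := 1 + D.incl F a * z * (D.incl F b)ᵀ
  inv := 1 - D.incl F a * z * (D.incl F b)ᵀ
  val_inv := by
    rw [add_mul, mul_sub, mul_sub, D.offdiag_mul_offdiag h]
    simp
  inv_val := by
    rw [sub_mul, mul_add, mul_add, D.offdiag_mul_offdiag h]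
    simp

theorem elem_val {a b : B} (h : a ≠ b) (z : Matrix (Fin (k a)) (Fin (k b)) F) :
    (D.elem h z).val = 1 + D.incl F a * z * (D.incl F b)ᵀ := rfl

theorem elem_inv_val {a b : B} (h : a ≠ b) (z : Matrix (Fin (k a)) (Fin (k b)) F) :
    ((D.elem h z)⁻¹).val = 1 - D.incl F a * z * (D.incl F b)ᵀ := rfl

theorem elem_zero {a b : B} (h : a ≠ b) : D.elem h (0 : Matrix _ _ F) = 1 := by
  apply Units.ext
  rw [elem_val, Matrix.mul_zero, Matrix.zero_mul, add_zero]
  rfl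

theorem lev_elem {a b : B} (h : a < b) (z : Matrix (Fin (k a)) (Fin (k b)) F) :
    D.Lev (D.elem h.ne z).val 1 := by
  rw [elem_val, ← add_zero (1 : ∀ b, Matrix (Fin (k b)) (Fin (k b)) F)]
  exact lev_one.add (lev_offdiag h z)

theorem lev_elem_inv {a b : B} (h : a < b) (z : Matrix (Fin (k a)) (Fin (k b)) F) :
    D.Lev ((D.elem h.ne z)⁻¹).val 1 := by
  have e : ((D.elem h.ne z)⁻¹).val = (D.elem h.ne (-z)).val := by
    rw [elem_inv_val, elem_val, Matrix.mul_neg, Matrix.neg_mul, sub_eq_add_neg]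
  rw [e]
  exact D.lev_elem h _

variable [Fintype B]

/-- A block triangular matrix can be cleared at one block from the left. -/
theorem exists_elem_mul {a b : B} (h : a < b) (q : GL (Fin N) F)
    (hq : BlockTriangular q.val D.blk) : ∃ (z : Matrix (Fin (k a)) (Fin (k b)) F)
      (q₂ : GL (Fin N) F), q = D.elem h.ne z * q₂ ∧ BlockTriangular q₂.val D.blk ∧
      ∀ x y, D.blk x = a → D.blk y = b → q₂.val x y = 0 := by
  obtain ⟨m, hm, hm'⟩ := D.exists_lev q hq
  set z := (D.incl F a)ᵀ * q.val * D.incl F b * ((m b)⁻¹).val with hz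
  refine ⟨z, (D.elem h.ne z)⁻¹ * q, by rw [mul_inv_cancel_left], ?_, fun x y hx hy => ?_⟩
  · exact ((D.lev_elem_inv h z).1).mul hq
  · obtain ⟨i, rfl⟩ := D.surj _ _ hx
    obtain ⟨j, rfl⟩ := D.surj _ _ hy
    refine (D.inclT_mul_mul_incl_apply ((D.elem h.ne z)⁻¹ * q).val i j).symm.trans ?_
    rw [Units.val_mul, elem_inv_val, Matrix.sub_mul, Matrix.one_mul,
      Matrix.mul_sub, Matrix.sub_mul]
    have : (D.incl F a)ᵀ * (D.incl F a * z * (D.incl F b)ᵀ * q.val) * D.incl F b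
        = (D.incl F a)ᵀ * q.val * D.incl F b := by
      calc _ = ((D.incl F a)ᵀ * D.incl F a) * z * ((D.incl F b)ᵀ * q.val * D.incl F b) := by
            simp only [Matrix.mul_assoc]
        _ = (D.incl F a)ᵀ * q.val * D.incl F b := by
            rw [D.inclT_mul_incl_self, hm.2, Matrix.one_mul, hz, Matrix.mul_assoc _ _ (m b).val,
              ← Units.val_mul, inv_mul_cancel, Units.val_one, Matrix.mul_one]
    rw [this, sub_self]
    rfl

/-- A block triangular matrix can be cleared at one block from the right. -/
theorem exists_mul_elem {a b : B} (h : a < b) (q : GL (Fin N) F)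
    (hq : BlockTriangular q.val D.blk) : ∃ (z : Matrix (Fin (k a)) (Fin (k b)) F)
      (q₂ : GL (Fin N) F), q = q₂ * D.elem h.ne z ∧ BlockTriangular q₂.val D.blk ∧
      ∀ x y, D.blk x = a → D.blk y = b → q₂.val x y = 0 := by
  obtain ⟨m, hm, hm'⟩ := D.exists_lev q hq
  set z := ((m a)⁻¹).val * ((D.incl F a)ᵀ * q.val * D.incl F b) with hz
  refine ⟨z, q * (D.elem h.ne z)⁻¹, by rw [inv_mul_cancel_right], ?_, fun x y hx hy => ?_⟩
  · exact hq.mul (D.lev_elem_inv h z).1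
  · obtain ⟨i, rfl⟩ := D.surj _ _ hx
    obtain ⟨j, rfl⟩ := D.surj _ _ hy
    refine (D.inclT_mul_mul_incl_apply (q * (D.elem h.ne z)⁻¹).val i j).symm.trans ?_
    rw [Units.val_mul, elem_inv_val, Matrix.mul_sub, Matrix.mul_one,
      Matrix.mul_sub, Matrix.sub_mul]
    have : (D.incl F a)ᵀ * (q.val * (D.incl F a * z * (D.incl F b)ᵀ)) * D.incl F b
        = (D.incl F a)ᵀ * q.val * D.incl F b := by
      calc _ = ((D.incl F a)ᵀ * q.val * D.incl F a) * z * ((D.incl F b)ᵀ * D.incl F b) := by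
            simp only [Matrix.mul_assoc]
        _ = (D.incl F a)ᵀ * q.val * D.incl F b := by
            rw [D.inclT_mul_incl_self, hm.2, Matrix.mul_one, hz, ← Matrix.mul_assoc (m a).val,
              ← Units.val_mul, mul_inv_cancel, Units.val_one, Matrix.one_mul]
    rw [this, sub_self]
    rfl

end Transvection

section BlockPerm

variable {N c r : ℕ} (D : Blocks N (fun _ : Fin c => r)) (F : Type*) [Field F]

/-- the identification of the indices with pairs (block, position) -/
def pairEquiv : Fin c × Fin r ≃ Fin N :=
  Equiv.ofBijective (fun p => D.enum p.1 p.2) <| by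
    refine ⟨fun p p' h => ?_, fun x => ?_⟩
    · have h1 : p.1 = p'.1 := by
        have := congrArg D.blk h
        rwa [D.blk_enum, D.blk_enum] at this
      obtain ⟨a, i⟩ := p
      obtain ⟨a', i'⟩ := p'
      obtain rfl : a = a' := h1
      exact congrArg _ (D.inj a h)
    · obtain ⟨i, hi⟩ := D.surj _ x rfl
      exact ⟨(_, i), hi⟩

/-- the permutation of the indices permuting the blocks -/
def blockPerm : Equiv.Perm (Fin c) →* Equiv.Perm (Fin N) where
  toFun σ := D.pairEquiv.permCongr (σ.prodCongr (Equiv.refl _))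
  map_one' := by
    ext x
    simp [Equiv.permCongr_apply, Equiv.prodCongr_apply]
  map_mul' σ τ := by
    ext x
    simp [Equiv.permCongr_apply, Equiv.prodCongr_apply, Prod.map]

theorem blockPerm_enum (σ : Equiv.Perm (Fin c)) (a : Fin c) (i : Fin r) :
    D.blockPerm σ (D.enum a i) = D.enum (σ a) i := by
  have h : D.enum a i = D.pairEquiv (a, i) := rfl
  rw [h]
  change D.pairEquiv.permCongr _ _ = _
  rw [Equiv.permCongr_apply, Equiv.symm_apply_apply]
  rfl

theorem blk_blockPerm (σ : Equiv.Perm (Fin c)) (x : Fin N) :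
    D.blk (D.blockPerm σ x) = σ (D.blk x) := by
  obtain ⟨i, hi⟩ := D.surj _ x rfl
  rw [← hi, blockPerm_enum, D.blk_enum, D.blk_enum]

/-- block permutation matrices -/
def blockMat : Equiv.Perm (Fin c) →* GL (Fin N) F := (permGL F N).comp D.blockPerm

variable {F}

theorem blockMat_mul_incl (σ : Equiv.Perm (Fin c)) (a : Fin c) :
    (D.blockMat F σ).val * D.incl F a = D.incl F (σ a) := by
  ext x i
  change ((permGL F N (D.blockPerm σ)).val * D.incl F a) x i = _
  rw [permGL_mul_apply, incl_apply, incl_apply, ← blockPerm_enum]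
  simp only [Equiv.Perm.inv_eq_iff_eq]

theorem inclT_mul_blockMat_inv (σ : Equiv.Perm (Fin c)) (a : Fin c) :
    (D.incl F a)ᵀ * ((D.blockMat F σ)⁻¹).val = (D.incl F (σ a))ᵀ := by
  rw [← blockMat_mul_incl, Matrix.transpose_mul]
  congr 1
  exact (permGL_transpose _).symm

theorem blockMat_conj_elem (σ : Equiv.Perm (Fin c)) {a b : Fin c} (h : a ≠ b)
    (z : Matrix (Fin r) (Fin r) F) :
    D.blockMat F σ * D.elem h z * (D.blockMat F σ)⁻¹ = D.elem (σ.injective.ne h) z := by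
  apply Units.ext
  rw [Units.val_mul, Units.val_mul, elem_val, elem_val, Matrix.mul_add, Matrix.add_mul,
    Matrix.mul_one, ← Units.val_mul, mul_inv_cancel, Units.val_one, ← blockMat_mul_incl,
    ← inclT_mul_blockMat_inv]
  simp only [Matrix.mul_assoc]

theorem blockMat_inv_conj_apply (σ : Equiv.Perm (Fin c)) (M : Matrix (Fin N) (Fin N) F)
    (x y : Fin N) :
    (((D.blockMat F σ)⁻¹).val * M * (D.blockMat F σ).val) x y
      = M (D.blockPerm σ x) (D.blockPerm σ y) :=
  permGL_inv_mul_mul_apply _ _ _ _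

theorem blockTriangular_swap_conj {a b : Fin c} (hab : b.val = a.val + 1)
    {M : Matrix (Fin N) (Fin N) F} (hM : BlockTriangular M D.blk)
    (h0 : ∀ x y, D.blk x = a → D.blk y = b → M x y = 0) :
    BlockTriangular (((D.blockMat F (Equiv.swap a b))⁻¹).val * M *
      (D.blockMat F (Equiv.swap a b)).val) D.blk := by
  intro x y hxy
  rw [blockMat_inv_conj_apply]
  by_cases h : D.blk x = b ∧ D.blk y = a
  · exact h0 _ _ (by rw [blk_blockPerm, h.1, Equiv.swap_apply_right])
      (by rw [blk_blockPerm, h.2, Equiv.swap_apply_left])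
  · refine hM ?_
    rw [blk_blockPerm, blk_blockPerm]
    simp only [Equiv.swap_apply_def, Fin.lt_def, Fin.ext_iff] at h hxy ⊢
    split_ifs <;> omega

theorem lev_blockMat_conj (σ : Equiv.Perm (Fin c)) {A A' : GL (Fin N) F}
    (h : A' = D.blockMat F σ * A * (D.blockMat F σ)⁻¹) (hA' : BlockTriangular A'.val D.blk)
    {m : Fin c → GL (Fin r) F} (hm : D.Lev A.val fun a => (m a).val) :
    D.Lev A'.val fun a => (m (σ⁻¹ a)).val := by
  refine ⟨hA', fun a => ?_⟩
  obtain ⟨b, rfl⟩ := σ.surjective a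
  rw [← hm.2, h, Units.val_mul, Units.val_mul]
  have e1 : (D.incl F (σ b))ᵀ * (D.blockMat F σ).val = (D.incl F b)ᵀ := by
    rw [← inclT_mul_blockMat_inv, Matrix.mul_assoc, ← Units.val_mul, inv_mul_cancel,
      Units.val_one, Matrix.mul_one]
  have e2 : ((D.blockMat F σ)⁻¹).val * D.incl F (σ b) = D.incl F b := by
    rw [← blockMat_mul_incl, ← Matrix.mul_assoc, ← Units.val_mul, inv_mul_cancel,
      Units.val_one, Matrix.one_mul]
  have e3 : σ⁻¹ (σ b) = b := by simp
  rw [e3]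
  calc _ = ((D.incl F (σ b))ᵀ * (D.blockMat F σ).val) * A.val *
        (((D.blockMat F σ)⁻¹).val * D.incl F (σ b)) := by simp only [Matrix.mul_assoc]
    _ = _ := by rw [e1, e2]

end BlockPerm

section LevRep

variable {F : Type*} [Field F] {N c : ℕ} {k : Fin c → ℕ} (D : Blocks N k)

/-- the projection of a block parabolic onto its Levi quotient -/
def toLevi : parabolic (F := F) D.blk →* ∀ a, GL (Fin (k a)) F :=
  leviProjPi D.blk D.enum D.inj D.blk_enum D.surj

theorem lev_toLevi (A : parabolic (F := F) D.blk) :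
    D.Lev A.1.val fun a => (D.toLevi A a).val :=
  ⟨A.2, fun a => by
    ext i j
    rw [D.inclT_mul_mul_incl_apply]
    rfl⟩

theorem toLevi_eq {A : parabolic (F := F) D.blk} {m : ∀ a, GL (Fin (k a)) F}
    (h : D.Lev A.1.val fun a => (m a).val) : D.toLevi A = m :=
  funext fun a => Units.ext (congrFun ((D.lev_toLevi A).unique h) a)

end LevRep

end Blocks

section PermTensor

/-- permutation of the factors of a tensor power -/
def permTensor (c : ℕ) (V : Type*) [AddCommGroup V] [Module ℂ V] :
    Representation ℂ (Equiv.Perm (Fin c)) (⨂[ℂ] _ : Fin c, V) where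
  toFun σ := (PiTensorProduct.reindex ℂ (fun _ => V) σ).toLinearMap
  map_one' := by
    ext v
    simp only [LinearMap.compMultilinearMap_apply, LinearEquiv.coe_coe,
      PiTensorProduct.reindex_tprod]
    rfl
  map_mul' σ τ := by
    ext v
    simp only [LinearMap.compMultilinearMap_apply, LinearEquiv.coe_coe,
      PiTensorProduct.reindex_tprod, Module.End.mul_apply]
    rfl

theorem permTensor_tprod {c : ℕ} {V : Type*} [AddCommGroup V] [Module ℂ V]
    (σ : Equiv.Perm (Fin c)) (v : Fin c → V) :
    permTensor c V σ (PiTensorProduct.tprod ℂ v) = PiTensorProduct.tprod ℂ fun i => v (σ⁻¹ i) :=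
  PiTensorProduct.reindex_tprod _ _

theorem exists_mul_mul_self {F : Type*} [Field F] {r : ℕ} (z : Matrix (Fin r) (Fin r) F) :
    ∃ p : Matrix (Fin r) (Fin r) F, z * p * z = z := by
  obtain ⟨g, hg⟩ := (Matrix.toLin' z).rangeRestrict.exists_rightInverse_of_surjective
    (LinearMap.range_rangeRestrict _)
  obtain ⟨G, hG⟩ := LinearMap.exists_extend g
  refine ⟨LinearMap.toMatrix' G, ?_⟩
  apply Matrix.toLin'.injective
  rw [Matrix.toLin'_mul, Matrix.toLin'_mul, Matrix.toLin'_toMatrix']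
  refine LinearMap.ext fun x => ?_
  have h1 : G (Matrix.toLin' z x) = g ((Matrix.toLin' z).rangeRestrict x) := by
    rw [← hG]
    rfl
  have h2 := congrArg Subtype.val (LinearMap.congr_fun hg ((Matrix.toLin' z).rangeRestrict x))
  rw [LinearMap.comp_apply, LinearMap.comp_apply, h1]
  exact h2

end PermTensor

namespace Blocks

section Mat

variable {F : Type*} [Field F] {N c r : ℕ} (D : Blocks N (fun _ : Fin c => r))

/-- the matrix with a single block -/
def mat (a b : Fin c) (z : Matrix (Fin r) (Fin r) F) : Matrix (Fin N) (Fin N) F :=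
  D.incl F a * z * (D.incl F b)ᵀ

theorem mat_mul_mat (a b d : Fin c) (z z' : Matrix (Fin r) (Fin r) F) :
    D.mat a b z * D.mat b d z' = D.mat a d (z * z') := by
  unfold mat
  calc _ = D.incl F a * z * ((D.incl F b)ᵀ * D.incl F b) * z' * (D.incl F d)ᵀ := by
        simp only [Matrix.mul_assoc]
    _ = _ := by rw [D.inclT_mul_incl_self, Matrix.mul_one, Matrix.mul_assoc (D.incl F a)]

theorem mat_mul_mat_of_ne {b b' : Fin c} (h : b ≠ b') (a d : Fin c)
    (z z' : Matrix (Fin r) (Fin r) F) : D.mat a b z * D.mat b' d z' = 0 := by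
  unfold mat
  calc _ = D.incl F a * z * ((D.incl F b)ᵀ * D.incl F b') * z' * (D.incl F d)ᵀ := by
        simp only [Matrix.mul_assoc]
    _ = _ := by rw [D.inclT_mul_incl_of_ne h]; simp

theorem mat_add (a b : Fin c) (z z' : Matrix (Fin r) (Fin r) F) :
    D.mat a b (z + z') = D.mat a b z + D.mat a b z' := by
  rw [mat, Matrix.mul_add, Matrix.add_mul]; rfl

theorem mat_neg (a b : Fin c) (z : Matrix (Fin r) (Fin r) F) :
    D.mat a b (-z) = -D.mat a b z := by
  rw [mat, Matrix.mul_neg, Matrix.neg_mul]; rfl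

theorem mat_sub (a b : Fin c) (z z' : Matrix (Fin r) (Fin r) F) :
    D.mat a b (z - z') = D.mat a b z - D.mat a b z' := by
  rw [sub_eq_add_neg, mat_add, mat_neg, ← sub_eq_add_neg]

theorem mat_zero (a b : Fin c) : D.mat a b (0 : Matrix (Fin r) (Fin r) F) = 0 := by
  rw [mat, Matrix.mul_zero, Matrix.zero_mul]

theorem blockMat_mul_mat (σ : Equiv.Perm (Fin c)) (a b : Fin c) (z : Matrix (Fin r) (Fin r) F) :
    (D.blockMat F σ).val * D.mat a b z = D.mat (σ a) b z := by
  rw [mat, mat, ← Matrix.mul_assoc, ← Matrix.mul_assoc, blockMat_mul_incl]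

theorem sum_mat_one : ∑ a, D.mat a a (1 : Matrix (Fin r) (Fin r) F) = 1 := by
  simp only [mat, Matrix.mul_one]
  exact D.sum_incl_mul_inclT

theorem blockMat_swap_val {a b : Fin c} (h : a ≠ b) :
    (D.blockMat F (Equiv.swap a b)).val
      = 1 - D.mat a a 1 - D.mat b b 1 + D.mat a b 1 + D.mat b a 1 := by
  have h1 : (D.blockMat F (Equiv.swap a b)).val - 1
      = (D.mat b a 1 - D.mat a a 1) + (D.mat a b 1 - D.mat b b 1) := by
    conv_lhs => rw [← Matrix.mul_one (D.blockMat F (Equiv.swap a b)).val, ← D.sum_mat_one]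
    rw [Finset.mul_sum, ← Finset.sum_sub_distrib]
    rw [Finset.sum_eq_add a b h]
    · rw [blockMat_mul_mat, blockMat_mul_mat, Equiv.swap_apply_left, Equiv.swap_apply_right]
    · intro x _ hx
      rw [blockMat_mul_mat, Equiv.swap_apply_of_ne_of_ne hx.1 hx.2, sub_self]
    · simp
    · simp
  rw [sub_eq_iff_eq_add] at h1
  rw [h1]
  abel

theorem lev_mat_self (a : Fin c) (z : Matrix (Fin r) (Fin r) F) :
    D.Lev (D.mat a a z) (Pi.single a z) := D.lev_single a z

theorem lev_mat_of_lt {a b : Fin c} (h : a < b) (z : Matrix (Fin r) (Fin r) F) :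
    D.Lev (D.mat a b z) 0 := D.lev_offdiag h z

theorem blockMat_conj_diag (σ : Equiv.Perm (Fin c)) (m : ∀ _ : Fin c, GL (Fin r) F) :
    D.blockMat F σ * D.diag m * (D.blockMat F σ)⁻¹ = D.diag fun a => m (σ⁻¹ a) := by
  apply Units.ext
  rw [Units.val_mul, Units.val_mul, diag_val, diag_val, Finset.mul_sum, Finset.sum_mul,
    ← Equiv.sum_comp σ fun a => D.incl F a * (m (σ⁻¹ a)).val * (D.incl F a)ᵀ]
  refine Finset.sum_congr rfl fun a _ => ?_
  have h : σ⁻¹ (σ a) = a := by simp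
  rw [← inclT_mul_blockMat_inv, ← blockMat_mul_incl, h]
  simp only [Matrix.mul_assoc]

end Mat

end Blocks

namespace Blocks

section PowRep

variable {F : Type*} [Field F] {N c r : ℕ} (D : Blocks N (fun _ : Fin c => r))
  {V : Type*} [AddCommGroup V] [Module ℂ V]
  (ρ : Representation ℂ (GL (Fin r) F) V)

/-- the inflation of a tensor power to the block parabolic -/
def powRep : Representation ℂ (parabolic (F := F) D.blk) (⨂[ℂ] _ : Fin c, V) :=
  (piTensorRep fun _ => ρ).comp D.toLevi

variable {D ρ}

theorem powRep_of_lev {A : parabolic (F := F) D.blk} {m : ∀ _ : Fin c, GL (Fin r) F}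
    (h : D.Lev A.1.val fun a => (m a).val) : D.powRep ρ A = piTensorRep (fun _ => ρ) m := by
  rw [powRep, MonoidHom.comp_apply, D.toLevi_eq h]

theorem powRep_of_lev_one {A : parabolic (F := F) D.blk} (h : D.Lev A.1.val 1) :
    D.powRep ρ A = 1 := by
  rw [powRep_of_lev (m := 1) h, _root_.map_one]

theorem piTensorRep_permTensor (σ : Equiv.Perm (Fin c)) (m : ∀ _ : Fin c, GL (Fin r) F)
    (v : ⨂[ℂ] _ : Fin c, V) :
    piTensorRep (fun _ => ρ) (fun a => m (σ⁻¹ a)) (permTensor c V σ v)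
      = permTensor c V σ (piTensorRep (fun _ => ρ) m v) := by
  refine LinearMap.congr_fun (f := piTensorRep (fun _ => ρ) (fun a => m (σ⁻¹ a)) ∘ₗ
    permTensor c V σ) (g := permTensor c V σ ∘ₗ piTensorRep (fun _ => ρ) m) ?_ v
  ext u
  simp only [LinearMap.compMultilinearMap_apply, LinearMap.comp_apply, permTensor_tprod,
    piTensorRep_tprod]

theorem powRep_permTensor (σ : Equiv.Perm (Fin c)) (A A' : parabolic (F := F) D.blk)
    (h : (A' : GL (Fin N) F) = D.blockMat F σ * A * (D.blockMat F σ)⁻¹) (v : ⨂[ℂ] _ : Fin c, V) :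
    D.powRep ρ A' (permTensor c V σ v) = permTensor c V σ (D.powRep ρ A v) := by
  rw [powRep_of_lev (D.lev_blockMat_conj σ h A'.2 (D.lev_toLevi A)),
    powRep_of_lev (D.lev_toLevi A), piTensorRep_permTensor]

variable {W : Type*} [AddCommGroup W] [Module ℂ W] {π : Representation ℂ (GL (Fin N) F) W}

variable (D) in
/-- block diagonal matrices as elements of the block parabolic -/
def diagP (m : ∀ _ : Fin c, GL (Fin r) F) : parabolic (F := F) D.blk :=
  ⟨D.diag m, (D.diag_lev m).1⟩

theorem powRep_diagP (m : ∀ _ : Fin c, GL (Fin r) F) :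
    D.powRep ρ (D.diagP m) = piTensorRep (fun _ => ρ) m := powRep_of_lev (D.diag_lev m)

theorem exists_avg_blockMat [Fintype F] [Fintype (parabolic (F := F) D.blk)]
    [FiniteDimensional ℂ V] (hρ : IsIrred ρ)
    (σ : Equiv.Perm (Fin c)) (Y : Module.End ℂ (⨂[ℂ] _ : Fin c, V)) :
    ∃ z : ℂ, ∀ δ : equivariantMaps (D.powRep ρ) (π.comp (parabolic D.blk).subtype),
      avg (D.powRep ρ) π (π (D.blockMat F σ) ∘ₗ δ.1 ∘ₗ Y)
        = z • hecke (D.powRep ρ) π (D.blockMat F) (permTensor c V) σ δ := by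
  classical
  let R : Representation ℂ (∀ _ : Fin c, GL (Fin r) F) (⨂[ℂ] _ : Fin c, V) :=
    piTensorRep fun _ => ρ
  let Y' : Module.End ℂ (⨂[ℂ] _ : Fin c, V) := Y ∘ₗ permTensor c V σ
  let T : Module.End ℂ (⨂[ℂ] _ : Fin c, V) :=
    (Fintype.card (∀ _ : Fin c, GL (Fin r) F) : ℂ)⁻¹ • ∑ m, R m ∘ₗ Y' ∘ₗ R m⁻¹
  have hT : ∀ g v, T (R g v) = R g (T v) := fun g v => by
    simp only [T, LinearMap.smul_apply, LinearMap.sum_apply, LinearMap.comp_apply,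
      _root_.map_smul, map_sum]
    rw [← Equiv.sum_comp (Equiv.mulLeft g)]
    congr 1
    refine Finset.sum_congr rfl fun m _ => ?_
    rw [Equiv.coe_mulLeft, _root_.mul_inv_rev, rep_mul_apply R m⁻¹, rep_inv_self_apply,
      rep_mul_apply]
  obtain ⟨z, hz⟩ := piTensorRep_scalar (fun _ => hρ) T hT
  refine ⟨z, fun δ => ?_⟩
  have key : ∀ m, avg (D.powRep ρ) π (π (D.blockMat F σ) ∘ₗ δ.1 ∘ₗ Y)
      = avg (D.powRep ρ) π (π (D.blockMat F σ) ∘ₗ δ.1 ∘ₗ (R m ∘ₗ Y' ∘ₗ R m⁻¹) ∘ₗ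
        permTensor c V σ⁻¹) := fun m => by
    rw [← avg_translate (D.diagP fun a => m (σ⁻¹ a))]
    congr 1
    refine LinearMap.ext fun u => ?_
    simp only [LinearMap.comp_apply, Y']
    have h1 : D.powRep ρ (D.diagP fun a => m (σ⁻¹ a))⁻¹ u
        = permTensor c V σ (R m⁻¹ (permTensor c V σ⁻¹ u)) := by
      apply rep_injective (D.powRep ρ) (D.diagP fun a => m (σ⁻¹ a))
      rw [rep_self_inv_apply, powRep_diagP, piTensorRep_permTensor]
      change _ = permTensor c V σ (R m (R m⁻¹ _))
      rw [rep_self_inv_apply, rep_self_inv_apply]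
    have h2 : (D.diagP (fun a => m (σ⁻¹ a)) : GL (Fin N) F)
        = D.blockMat F σ * D.diag m * (D.blockMat F σ)⁻¹ := (D.blockMat_conj_diag σ m).symm
    rw [h1, h2, ← rep_mul_apply π, inv_mul_cancel_right, rep_mul_apply π]
    congr 1
    have h3 := δ.2 (D.diagP m) (Y (permTensor c V σ (R m⁻¹ (permTensor c V σ⁻¹
      u))))
    rw [powRep_diagP] at h3
    exact h3.symm
  rw [← card_inv_smul_sum (ι := ∀ _ : Fin c, GL (Fin r) F) (avg (D.powRep ρ) π _)]
  rw [Finset.sum_congr rfl fun m _ => key m, ← map_sum, ← _root_.map_smul, hecke_apply,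
    ← _root_.map_smul]
  congr 1
  refine LinearMap.ext fun u => ?_
  have h4 := hz (permTensor c V σ⁻¹ u)
  simp only [T, LinearMap.smul_apply, LinearMap.sum_apply] at h4
  simp only [LinearMap.comp_apply, LinearMap.smul_apply, LinearMap.sum_apply] at h4 ⊢
  rw [← map_sum, ← map_sum, ← _root_.map_smul, ← _root_.map_smul, h4, _root_.map_smul,
    _root_.map_smul]

end PowRep

end Blocks

namespace Blocks

section Quadratic

variable {F : Type*} [Field F] {N c r : ℕ} {D : Blocks N (fun _ : Fin c => r)}
  {V : Type*} [AddCommGroup V] [Module ℂ V] {ρ : Representation ℂ (GL (Fin r) F) V}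
  {W : Type*} [AddCommGroup W] [Module ℂ W] {π : Representation ℂ (GL (Fin N) F) W}

theorem apply_of_lev_one (δ : equivariantMaps (D.powRep ρ) (π.comp (parabolic D.blk).subtype))
    {E : GL (Fin N) F} (hE : D.Lev E.val 1) (v : ⨂[ℂ] _ : Fin c, V) : π E (δ.1 v) = δ.1 v := by
  have h := δ.2 ⟨E, hE.1⟩ v
  rw [powRep_of_lev_one (A := ⟨E, hE.1⟩) hE, Module.End.one_apply] at h
  exact h.symm

variable [Fintype F] [Fintype (parabolic (F := F) D.blk)]

theorem avg_elem_singular (hc : IsCuspidal ρ) {a b : Fin c} (h : a < b)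
    (z : Matrix (Fin r) (Fin r) F) (hz : z ≠ 0) (hz' : ¬ IsUnit z)
    (δ : equivariantMaps (D.powRep ρ) (π.comp (parabolic D.blk).subtype)) :
    avg (D.powRep ρ) π (π (D.elem h.ne' z) ∘ₗ δ.1) = 0 := by
  obtain ⟨p, hp⟩ := exists_mul_mul_self z
  have hK : LinearMap.ker (Matrix.toLin' z) ≠ ⊥ := fun hk => hz' <| by
    rw [LinearMap.ker_eq_bot, Matrix.toLin'_apply', Matrix.coe_mulVecLin,
      Matrix.mulVec_injective_iff_isUnit] at hk
    exact hk
  have hK' : LinearMap.ker (Matrix.toLin' z) ≠ ⊤ := fun hk => hz <| by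
    rw [LinearMap.ker_eq_top] at hk
    exact Matrix.toLin'.injective (hk.trans (_root_.map_zero _).symm)
  refine hc.eq_zero_of_unip (LinearMap.ker (Matrix.toLin' z)) hK hK'
    (avg (D.powRep ρ) π ∘ₗ LinearMap.compRight ℂ (π (D.elem h.ne' z) ∘ₗ δ.1) ∘ₗ
      tensorSlot (V := fun _ => V) a) _
    fun u n hu hn hn' => ?_
  have hzn : z * n = 0 := by
    apply Matrix.toLin'.injective
    refine LinearMap.ext fun x => ?_
    rw [Matrix.toLin'_mul, _root_.map_zero, LinearMap.comp_apply, LinearMap.zero_apply]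
    exact hn' x
  have hnp : n * p * z = n := by
    apply Matrix.toLin'.injective
    refine LinearMap.ext fun x => ?_
    have h1 : p *ᵥ (z *ᵥ x) - x ∈ LinearMap.ker (Matrix.toLin' z) := by
      rw [LinearMap.mem_ker, Matrix.toLin'_apply, Matrix.mulVec_sub, Matrix.mulVec_mulVec,
        Matrix.mulVec_mulVec, hp, sub_self]
    have h2 := hn _ h1
    rw [Matrix.mulVec_sub, sub_eq_zero] at h2
    rw [Matrix.toLin'_apply, Matrix.toLin'_apply, ← h2, Matrix.mulVec_mulVec,
      Matrix.mulVec_mulVec]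
  set E : GL (Fin N) F := D.elem h.ne (-(n * p)) with hE
  set A : GL (Fin N) F := D.elem h.ne' z * E * (D.elem h.ne' z)⁻¹ with hA
  have hAv : A.val = 1 + D.mat a a n + D.mat a b (-(n * p)) := by
    have e1 : (D.elem h.ne' z).val = 1 + D.mat b a z := rfl
    have e2 : ((D.elem h.ne' z)⁻¹).val = 1 - D.mat b a z := rfl
    have e3 : E.val = 1 + D.mat a b (-(n * p)) := rfl
    rw [hA, Units.val_mul, Units.val_mul, e1, e2, e3]
    simp only [Matrix.mul_add, Matrix.add_mul, Matrix.mul_sub, Matrix.mul_one,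
      Matrix.one_mul, mat_mul_mat, D.mat_mul_mat_of_ne h.ne]
    have e4 : z * -(n * p) = 0 := by rw [Matrix.mul_neg, ← Matrix.mul_assoc, hzn]; simp
    have e5 : -(n * p) * z = -n := by rw [Matrix.neg_mul, hnp]
    rw [e4, e5]
    simp only [Matrix.zero_mul, mat_zero, mat_neg]
    abel
  have hAl : D.Lev A.val fun x => ((Pi.mulSingle a u : ∀ _ : Fin c, GL (Fin r) F) x).val := by
    refine D.lev_mulSingle a ?_
    rw [hAv, hu, add_sub_cancel_left]
    exact ((lev_one.add (D.lev_mat_self a n)).add (D.lev_mat_of_lt h _)).congr (add_zero _)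
  have h1 : π (D.elem h.ne' z) ∘ₗ δ.1 = π A ∘ₗ π (D.elem h.ne' z) ∘ₗ δ.1 := by
    refine LinearMap.ext fun v => ?_
    rw [LinearMap.comp_apply, LinearMap.comp_apply, LinearMap.comp_apply, ← rep_mul_apply π, hA,
      inv_mul_cancel_right, rep_mul_apply π, apply_of_lev_one δ (D.lev_elem h _)]
  have h2 := avg_left (x := D.powRep ρ) (π := π) ⟨A, hAl.1⟩ (π (D.elem h.ne' z) ∘ₗ δ.1)
  rw [powRep_of_lev (A := ⟨A, hAl.1⟩) hAl, piTensorRep_mulSingle] at h2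
  exact h2.symm.trans (congrArg _ h1.symm)

theorem exists_avg_elem_unit [FiniteDimensional ℂ V] (hρ : IsIrred ρ) {a b : Fin c} (h : a < b)
    (z : GL (Fin r) F) : ∃ β : ℂ, ∀ δ : equivariantMaps (D.powRep ρ) (π.comp (parabolic D.blk).subtype),
    avg (D.powRep ρ) π (π (D.elem h.ne' z.val) ∘ₗ δ.1) = β • hecke (D.powRep ρ) π
      (D.blockMat F) (permTensor c V) (Equiv.swap a b) δ := by
  set E : GL (Fin N) F := D.elem h.ne z⁻¹.val with hE
  set S : GL (Fin N) F := D.blockMat F (Equiv.swap a b) with hS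
  set A : GL (Fin N) F := S⁻¹ * E⁻¹ * D.elem h.ne' z.val with hA
  have hSS : S * S = 1 := by
    rw [hS, ← _root_.map_mul, Equiv.swap_mul_self, _root_.map_one]
  have hS1 : S⁻¹ = S := inv_eq_of_mul_eq_one_left hSS
  have hAv : A.val = 1 + (D.mat a a (z.val - 1) + D.mat b b (-z⁻¹.val - 1)) + D.mat a b 1 := by
    have e1 : (D.elem h.ne' z.val).val = 1 + D.mat b a z.val := rfl
    have e2 : (E⁻¹).val = 1 - D.mat a b z⁻¹.val := rfl
    rw [hA, hS1, Units.val_mul, Units.val_mul, e1, e2, Matrix.mul_assoc]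
    have e3 : (1 - D.mat a b z⁻¹.val) * (1 + D.mat b a z.val)
        = 1 + D.mat b a z.val - D.mat a b z⁻¹.val - D.mat a a 1 := by
      simp only [Matrix.mul_add, Matrix.sub_mul, Matrix.mul_one, Matrix.one_mul, mat_mul_mat]
      rw [← Units.val_mul, inv_mul_cancel, Units.val_one]
      abel
    rw [e3, Matrix.mul_sub, Matrix.mul_sub, Matrix.mul_add, Matrix.mul_one, hS, blockMat_mul_mat,
      blockMat_mul_mat, blockMat_mul_mat, Equiv.swap_apply_left, Equiv.swap_apply_right,
      D.blockMat_swap_val h.ne, mat_sub, mat_sub, mat_neg]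
    abel
  have hAl : D.Lev A.val fun x =>
      ((Pi.mulSingle a z * Pi.mulSingle b (-z⁻¹) : ∀ _ : Fin c, GL (Fin r) F) x).val := by
    refine Lev.congr (y := 1 + (Pi.single a (z.val - 1) + Pi.single b (-z⁻¹.val - 1)) + 0) ?_ ?_
    · rw [hAv]
      exact (lev_one.add ((D.lev_mat_self a _).add (D.lev_mat_self b _))).add (D.lev_mat_of_lt h _)
    · funext x
      by_cases hxa : x = a
      · subst hxa
        simp [Pi.single_eq_of_ne h.ne, Pi.mulSingle_eq_of_ne h.ne]
      · by_cases hxb : x = b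
        · subst hxb
          simp [Pi.single_eq_of_ne h.ne', Pi.mulSingle_eq_of_ne h.ne']
        · simp [Pi.single_eq_of_ne hxa, Pi.single_eq_of_ne hxb, Pi.mulSingle_eq_of_ne hxa,
            Pi.mulSingle_eq_of_ne hxb]
  obtain ⟨β, hβ⟩ := exists_avg_blockMat (π := π) (D := D) hρ (Equiv.swap a b)
    (piTensorRep (fun _ => ρ) (Pi.mulSingle a z * Pi.mulSingle b (-z⁻¹) : ∀ _ : Fin c, GL (Fin r) F))
  refine ⟨β, fun δ => ?_⟩
  rw [← hβ]
  have hEl := D.lev_elem (F := F) h z⁻¹.val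
  have h1 : π (D.elem h.ne' z.val) ∘ₗ δ.1 = π E ∘ₗ (π S ∘ₗ δ.1 ∘ₗ piTensorRep (fun _ => ρ)
      (Pi.mulSingle a z * Pi.mulSingle b (-z⁻¹) : ∀ _ : Fin c, GL (Fin r) F)) := by
    refine LinearMap.ext fun v => ?_
    simp only [LinearMap.comp_apply]
    rw [← powRep_of_lev (A := ⟨A, hAl.1⟩) hAl, δ.2]
    change _ = π E (π S (π A _))
    rw [← rep_mul_apply π, ← rep_mul_apply π, hA]
    congr 2
    group
  rw [h1, avg_left ⟨E, hEl.1⟩, powRep_of_lev_one (A := ⟨E, hEl.1⟩) hEl]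
  rfl

theorem exists_avg_elem [FiniteDimensional ℂ V] (hρ : IsIrred ρ) (hc : IsCuspidal ρ)
    {a b : Fin c} (h : a < b) (z : Matrix (Fin r) (Fin r) F) :
    ∃ α β : ℂ, ∀ δ : equivariantMaps (D.powRep ρ) (π.comp (parabolic D.blk).subtype),
    avg (D.powRep ρ) π (π (D.elem h.ne' z) ∘ₗ δ.1) = α • δ + β • hecke (D.powRep ρ) π
      (D.blockMat F) (permTensor c V) (Equiv.swap a b) δ := by
  by_cases hz : z = 0
  · refine ⟨1, 0, fun δ => ?_⟩
    rw [hz, elem_zero, _root_.map_one, zero_smul, add_zero, one_smul]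
    exact avg_self δ
  by_cases hu : IsUnit z
  · obtain ⟨u, rfl⟩ := hu
    obtain ⟨β, hβ⟩ := exists_avg_elem_unit (π := π) (D := D) hρ h u
    exact ⟨0, β, fun δ => by rw [hβ, zero_smul, zero_add]⟩
  · exact ⟨0, 0, fun δ => by rw [avg_elem_singular hc h z hz hu]; simp⟩

end Quadratic

end Blocks

section PermTrace

open MulOpposite

theorem eq_one_of_no_descent {c : ℕ} (σ : Equiv.Perm (Fin c))
    (h : ∀ a b : Fin c, b.val = a.val + 1 → σ a < σ b) : σ = 1 := by
  cases c with
  | zero => exact Subsingleton.elim _ _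
  | succ c =>
    have hσ : StrictMono σ :=
      Fin.strictMono_iff_lt_succ.2 fun i => h i.castSucc i.succ (by simp)
    exact Equiv.ext fun i => DFunLike.congr_fun (Subsingleton.elim
      (hσ.orderIsoOfSurjective σ σ.surjective) (OrderIso.refl _)) i

theorem sum_mul_swap_gt {c : ℕ} (σ : Equiv.Perm (Fin c)) {a b : Fin c} (hab : a < b)
    (h : σ b < σ a) :
    ∑ i, i.val * (σ i).val < ∑ i, i.val * ((σ * Equiv.swap a b) i).val := by
  have key : ∀ τ : Equiv.Perm (Fin c), ∑ i, i.val * (τ i).val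
      = (∑ i ∈ (Finset.univ.erase a).erase b, i.val * (τ i).val) + b.val * (τ b).val
        + a.val * (τ a).val := fun τ => by
    rw [Finset.sum_erase_add _ _ (by simp [hab.ne']), Finset.sum_erase_add _ _ (by simp)]
  rw [key, key, Equiv.Perm.mul_apply, Equiv.Perm.mul_apply, Equiv.swap_apply_left,
    Equiv.swap_apply_right]
  have e : ∑ i ∈ (Finset.univ.erase a).erase b, i.val * ((σ * Equiv.swap a b) i).val
      = ∑ i ∈ (Finset.univ.erase a).erase b, i.val * (σ i).val := by
    refine Finset.sum_congr rfl fun i hi => ?_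
    rw [Finset.mem_erase, Finset.mem_erase] at hi
    rw [Equiv.Perm.mul_apply, Equiv.swap_apply_of_ne_of_ne hi.2.1 hi.1]
  rw [e]
  have h1 : a.val < b.val := hab
  have h2 : (σ b).val < (σ a).val := h
  nlinarith

variable {A : Type*} [Ring A] [Algebra ℂ A] {c : ℕ} {H : Equiv.Perm (Fin c) → A}

/-- A trace is invariant under `σ ↦ σ⁻¹` on the standard basis of a Hecke algebra of type `A`. -/
theorem trace_inv_eq (h1 : H 1 = 1)
    (hr : ∀ w (a b : Fin c), b.val = a.val + 1 → w a < w b →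
      H w * H (Equiv.swap a b) = H (w * Equiv.swap a b))
    (hl : ∀ w (a b : Fin c), b.val = a.val + 1 → w⁻¹ a < w⁻¹ b →
      H (Equiv.swap a b) * H w = H (Equiv.swap a b * w))
    (hq : ∀ a b : Fin c, b.val = a.val + 1 → ∃ α β : ℂ,
      H (Equiv.swap a b) * H (Equiv.swap a b) = α • 1 + β • H (Equiv.swap a b))
    (τ : A →ₗ[ℂ] ℂ) (hτ : ∀ x y, τ (x * y) = τ (y * x)) (σ : Equiv.Perm (Fin c)) :
    τ (H σ) = τ (H σ⁻¹) := by
  let T : ℕ → A := fun i => if h : i + 1 < c then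
    H (Equiv.swap ⟨i, by omega⟩ ⟨i + 1, h⟩) else 0
  have hT : ∀ i (h : i + 1 < c), T i = H (Equiv.swap ⟨i, by omega⟩ ⟨i + 1, h⟩) :=
    fun i h => dif_pos h
  have hT0 : ∀ i, ¬ i + 1 < c → T i = 0 := fun i h => dif_neg h
  have hcomm : ∀ i j, i + 2 ≤ j → T i * T j = T j * T i := fun i j hij => by
    by_cases hj : j + 1 < c
    · have hi : i + 1 < c := by omega
      have fix : ∀ p q x : Fin c, x ≠ p → x ≠ q → Equiv.swap p q x = x := fun p q x =>
        Equiv.swap_apply_of_ne_of_ne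
      rw [hT i hi, hT j hj, hr _ _ _ rfl, hr _ _ _ rfl]
      · congr 1
        have e := Equiv.swap_apply_apply (Equiv.swap (⟨i, by omega⟩ : Fin c) ⟨i + 1, hi⟩)
          ⟨j, by omega⟩ ⟨j + 1, hj⟩
        rw [fix, fix] at e
        · rw [eq_mul_inv_iff_mul_eq] at e
          exact e.symm
        all_goals rw [Ne, Fin.ext_iff]; simp only; omega
      · rw [fix, fix]
        · rw [Fin.lt_def]; simp only; omega
        all_goals rw [Ne, Fin.ext_iff]; simp only; omega
      · rw [fix, fix]
        · rw [Fin.lt_def]; simp only; omega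
        all_goals rw [Ne, Fin.ext_iff]; simp only; omega
    · rw [hT0 j hj, mul_zero, zero_mul]
  have hbraid : ∀ i, T i * T (i + 1) * T i = T (i + 1) * T i * T (i + 1) := fun i => by
    by_cases hj : i + 1 + 1 < c
    · have hi : i + 1 < c := by omega
      rw [hT i hi, hT (i + 1) hj]
      set a : Fin c := ⟨i, by omega⟩ with ha
      set b : Fin c := ⟨i + 1, hi⟩ with hb
      set d : Fin c := ⟨i + 1 + 1, hj⟩ with hd
      have hab : a < b := by rw [Fin.lt_def]; simp only [ha, hb]; omega
      have hbd : b < d := by rw [Fin.lt_def]; simp only [hd, hb]; omega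
      have had := hab.trans hbd
      have s1a : Equiv.swap a b a = b := Equiv.swap_apply_left _ _
      have s1b : Equiv.swap a b b = a := Equiv.swap_apply_right _ _
      have s1d : Equiv.swap a b d = d := Equiv.swap_apply_of_ne_of_ne had.ne' hbd.ne'
      have s2a : Equiv.swap b d a = a := Equiv.swap_apply_of_ne_of_ne hab.ne had.ne
      have s2b : Equiv.swap b d b = d := Equiv.swap_apply_left _ _
      have s2d : Equiv.swap b d d = b := Equiv.swap_apply_right _ _
      rw [hr (Equiv.swap a b) b d rfl (by rw [s1b, s1d]; exact had),
        hr _ a b rfl (by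
          rw [Equiv.Perm.mul_apply, Equiv.Perm.mul_apply, s2a, s2b, s1a, s1d]; exact hbd),
        hr (Equiv.swap b d) a b rfl (by rw [s2a, s2b]; exact had),
        hr _ b d rfl (by
          rw [Equiv.Perm.mul_apply, Equiv.Perm.mul_apply, s1b, s1d, s2a, s2d]; exact hab)]
      congr 1
      have e1 := Equiv.swap_apply_apply (Equiv.swap a b) b d
      have e2 := Equiv.swap_apply_apply (Equiv.swap b d) a b
      rw [Equiv.swap_inv] at e1 e2
      rw [← e1, ← e2, s1b, s1d, s2a, s2b]
    · rw [hT0 (i + 1) hj, mul_zero, zero_mul, zero_mul]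
  have hquad : ∀ i, ∃ α β : ℂ, T i * T i = α • 1 + β • T i := fun i => by
    by_cases hi : i + 1 < c
    · rw [hT i hi]
      exact hq _ _ rfl
    · exact ⟨0, 0, by rw [hT0 i hi]; simp⟩
  set T' : ℕ → A × Aᵐᵒᵖ := fun i => (T i, op (T i)) with hT'
  have hmul := tower_mul_tower (T := T') (fun i j h =>
      Prod.ext (hcomm i j h) (unop_injective (hcomm i j h).symm))
    (fun i => Prod.ext (hbraid i) (unop_injective (by simpa [hT', mul_assoc] using hbraid i)))
    (fun i => by
      obtain ⟨α, β, h⟩ := hquad i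
      exact ⟨α, β, Prod.ext h (unop_injective h)⟩) c
  suffices hmem : ∀ (n : ℕ) (σ : Equiv.Perm (Fin c)),
      c * (c * c) < (∑ i, i.val * (σ i).val) + n → ((H σ, op (H σ⁻¹)) : A × Aᵐᵒᵖ) ∈ tower T' c from
    trace_eq_of_mem_tower hcomm hbraid hquad c τ (fun h _ x _ => ⟨hτ _ _, hτ _ _⟩) _
      (hmem (c * (c * c) + 1) σ (by omega))
  intro n
  induction n with
  | zero =>
    intro σ hσ
    exfalso
    refine absurd hσ (not_lt.2 ?_)
    calc ∑ i, i.val * (σ i).val ≤ ∑ _ : Fin c, c * c :=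
          Finset.sum_le_sum fun i _ => Nat.mul_le_mul i.2.le (σ i).2.le
      _ = c * (c * c) := by simp
  | succ n ih =>
    intro σ hσ
    by_cases hd : ∀ a b : Fin c, b.val = a.val + 1 → σ a < σ b
    · rw [eq_one_of_no_descent σ hd, inv_one, h1]
      exact Submodule.one_le.1 (one_le_tower T' c)
    · push Not at hd
      obtain ⟨a, b, hab, hle⟩ := hd
      have hlt : a < b := by rw [Fin.lt_def]; omega
      have hlt' : σ b < σ a := lt_of_le_of_ne hle (σ.injective.ne hlt.ne')
      have hsum := sum_mul_swap_gt σ hlt hlt'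
      have hw := ih (σ * Equiv.swap a b) (by omega)
      have hc : a.val + 1 < c := hab ▸ b.2
      have hTa : T a.val = H (Equiv.swap a b) := by
        rw [hT a.val hc]
        congr 2
        exact Fin.ext hab.symm
      have hs : T' a.val ∈ tower T' c := tower_mono T' (by omega : a.val + 1 ≤ c)
        (span_le_tower_succ T' a.val (Submodule.mem_span_singleton_self _))
      have hp := hmul (Submodule.mul_mem_mul hw hs)
      have e1 : H (σ * Equiv.swap a b) * T a.val = H σ := by
        rw [hTa, hr _ a b hab]
        · rw [mul_assoc, Equiv.swap_mul_self, mul_one]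
        · rw [Equiv.Perm.mul_apply, Equiv.Perm.mul_apply, Equiv.swap_apply_left,
            Equiv.swap_apply_right]
          exact hlt'
      have e2 : T a.val * H (σ * Equiv.swap a b)⁻¹ = H σ⁻¹ := by
        rw [hTa, hl _ a b hab]
        · rw [_root_.mul_inv_rev, Equiv.swap_inv, ← mul_assoc, Equiv.swap_mul_self, one_mul]
        · rw [inv_inv, Equiv.Perm.mul_apply, Equiv.Perm.mul_apply, Equiv.swap_apply_left,
            Equiv.swap_apply_right]
          exact hlt'
      have e3 : ((H (σ * Equiv.swap a b), op (H (σ * Equiv.swap a b)⁻¹)) : A × Aᵐᵒᵖ) * T' a.val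
          = (H σ, op (H σ⁻¹)) :=
        Prod.ext e1 (unop_injective e2)
      rwa [e3] at hp

end PermTrace

namespace Blocks

section HeckeAlgebra

variable {F : Type*} [Field F] {N c r : ℕ} {D : Blocks N (fun _ : Fin c => r)}
  {V : Type*} [AddCommGroup V] [Module ℂ V] {ρ : Representation ℂ (GL (Fin r) F) V}
  {W : Type*} [AddCommGroup W] [Module ℂ W] {π : Representation ℂ (GL (Fin N) F) W}

theorem blockMat_swap_inv (a b : Fin c) :
    (D.blockMat F (Equiv.swap a b))⁻¹ = D.blockMat F (Equiv.swap a b) := by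
  rw [← map_inv, Equiv.swap_inv]

theorem blockMat_swap_conj_elem {a b : Fin c} (h : a < b) (z : Matrix (Fin r) (Fin r) F) :
    D.blockMat F (Equiv.swap a b) * D.elem h.ne z * (D.blockMat F (Equiv.swap a b))⁻¹
      = D.elem h.ne' z := by
  rw [blockMat_conj_elem]
  apply Units.ext
  rw [elem_val, elem_val, Equiv.swap_apply_left, Equiv.swap_apply_right]

theorem swap_conj_mem {a b : Fin c} (hab : b.val = a.val + 1) {q : GL (Fin N) F}
    (hq : BlockTriangular q.val D.blk) (h0 : ∀ x y, D.blk x = a → D.blk y = b → q.val x y = 0) :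
    (D.blockMat F (Equiv.swap a b))⁻¹ * q * D.blockMat F (Equiv.swap a b)
      ∈ parabolic (F := F) D.blk :=
  D.blockTriangular_swap_conj hab hq h0

variable [Fintype F] [Fintype (parabolic (F := F) D.blk)]

omit [Fintype F] in
theorem hecke_mul_swap {w : Equiv.Perm (Fin c)} {a b : Fin c} (hab : b.val = a.val + 1)
    (hw : w a < w b) :
    hecke (D.powRep ρ) π (D.blockMat F) (permTensor c V) w *
      hecke (D.powRep ρ) π (D.blockMat F) (permTensor c V) (Equiv.swap a b)
      = hecke (D.powRep ρ) π (D.blockMat F) (permTensor c V) (w * Equiv.swap a b) := by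
  have h : a < b := by rw [Fin.lt_def]; omega
  refine hecke_mul _ _ _ _ powRep_permTensor w _ fun q => ?_
  obtain ⟨z, q₂, hq, hq₂, h0⟩ := D.exists_elem_mul h q.1 q.2
  refine ⟨⟨D.elem h.ne z, (D.lev_elem h z).1⟩, ⟨q₂, hq₂⟩, ⟨D.elem hw.ne z, (D.lev_elem hw z).1⟩,
    ⟨_, swap_conj_mem hab hq₂ h0⟩, Subtype.ext hq, (D.blockMat_conj_elem w h.ne z).symm, ?_⟩
  simp only
  group

omit [Fintype F] in
theorem hecke_swap_mul {w : Equiv.Perm (Fin c)} {a b : Fin c} (hab : b.val = a.val + 1)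
    (hw : w⁻¹ a < w⁻¹ b) :
    hecke (D.powRep ρ) π (D.blockMat F) (permTensor c V) (Equiv.swap a b) *
      hecke (D.powRep ρ) π (D.blockMat F) (permTensor c V) w
      = hecke (D.powRep ρ) π (D.blockMat F) (permTensor c V) (Equiv.swap a b * w) := by
  have h : a < b := by rw [Fin.lt_def]; omega
  refine hecke_mul _ _ _ _ powRep_permTensor _ w fun q => ?_
  obtain ⟨z, q₂, hq, hq₂, h0⟩ := D.exists_mul_elem h q.1 q.2
  refine ⟨⟨q₂, hq₂⟩, ⟨D.elem h.ne z, (D.lev_elem h z).1⟩, ⟨_, swap_conj_mem hab hq₂ h0⟩,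
    ⟨D.elem hw.ne z, (D.lev_elem hw z).1⟩, Subtype.ext hq, ?_, ?_⟩
  · simp only
    rw [blockMat_swap_inv]
  · simp only
    have := D.blockMat_conj_elem w⁻¹ h.ne z
    rw [← this, map_inv]
    group

theorem hecke_swap_sq [FiniteDimensional ℂ V] (hρ : IsIrred ρ) (hc : IsCuspidal ρ)
    {a b : Fin c} (hab : b.val = a.val + 1) : ∃ α β : ℂ,
    hecke (D.powRep ρ) π (D.blockMat F) (permTensor c V) (Equiv.swap a b) *
      hecke (D.powRep ρ) π (D.blockMat F) (permTensor c V) (Equiv.swap a b)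
      = α • 1 + β • hecke (D.powRep ρ) π (D.blockMat F) (permTensor c V) (Equiv.swap a b) := by
  have h : a < b := by rw [Fin.lt_def]; omega
  choose z q₂ hq hq₂ h0 using fun q : parabolic (F := F) D.blk => D.exists_elem_mul h q.1 q.2
  choose α β hαβ using fun z : Matrix (Fin r) (Fin r) F =>
    exists_avg_elem (π := π) (D := D) hρ hc h z
  refine ⟨(Fintype.card (parabolic (F := F) D.blk) : ℂ)⁻¹ * ∑ q, α (z q),
    (Fintype.card (parabolic (F := F) D.blk) : ℂ)⁻¹ * ∑ q, β (z q), LinearMap.ext fun δ => ?_⟩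
  rw [hecke_sq_apply (D.powRep ρ) π _ _ powRep_permTensor _ (Equiv.swap_mul_self a b)
    (fun q => ⟨D.elem h.ne (z q), (D.lev_elem h (z q)).1⟩) fun q =>
      ⟨⟨q₂ q, hq₂ q⟩, ⟨_, swap_conj_mem hab (hq₂ q) (h0 q)⟩, Subtype.ext (hq q),
        powRep_of_lev_one (D.lev_elem h (z q)), by simp only; group⟩]
  simp only [blockMat_swap_conj_elem h, hαβ]
  rw [Finset.sum_add_distrib, ← Finset.sum_smul, ← Finset.sum_smul, smul_add, smul_smul, smul_smul]
  rfl

/-- the Hecke operators of a permutation and of its inverse have the same trace -/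
theorem trace_hecke_inv [FiniteDimensional ℂ V] (hρ : IsIrred ρ) (hc : IsCuspidal ρ)
    (σ : Equiv.Perm (Fin c)) :
    LinearMap.trace ℂ _ (hecke (D.powRep ρ) π (D.blockMat F) (permTensor c V) σ)
      = LinearMap.trace ℂ _ (hecke (D.powRep ρ) π (D.blockMat F) (permTensor c V) σ⁻¹) := by
  have h1 := hecke_one (D.powRep ρ) π (D.blockMat F) (permTensor c V)
  have hr := fun (w : Equiv.Perm (Fin c)) (a b : Fin c) (hab : b.val = a.val + 1) (hw : w a < w b) =>
    hecke_mul_swap (D := D) (ρ := ρ) (π := π) hab hw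
  have hl := fun (w : Equiv.Perm (Fin c)) (a b : Fin c) (hab : b.val = a.val + 1) (hw : w⁻¹ a < w⁻¹ b) =>
    hecke_swap_mul (D := D) (ρ := ρ) (π := π) hab hw
  have hq := fun (a b : Fin c) (hab : b.val = a.val + 1) =>
    hecke_swap_sq (D := D) (π := π) hρ hc hab
  generalize hecke (D.powRep ρ) π (D.blockMat F) (permTensor c V) = H at *
  have hτ := fun x y : Module.End ℂ
    (equivariantMaps (D.powRep ρ) (π.comp (parabolic (F := F) D.blk).subtype)) =>
    LinearMap.trace_mul_comm ℂ x y
  generalize LinearMap.trace ℂ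
    (equivariantMaps (D.powRep ρ) (π.comp (parabolic (F := F) D.blk).subtype)) = τ at *
  exact trace_inv_eq (H := H) h1 hr hl hq τ hτ σ

end HeckeAlgebra

end Blocks

section DualBasis

variable {Q : Type*} [Group Q] [Fintype Q] {X W : Type*} [AddCommGroup X] [Module ℂ X]
  [AddCommGroup W] [Module ℂ W] [FiniteDimensional ℂ X] [FiniteDimensional ℂ W]
  {x : Representation ℂ Q X} {y : Representation ℂ Q W}

/-- If the equivariant endomorphisms of `x` are scalars, then `Hom_Q(x, y)` and `Hom_Q(y, x)` have
dual bases for the composition pairing. -/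
theorem exists_dual_basis [Nontrivial X]
    (hx : ∀ T : X →ₗ[ℂ] X, (∀ q v, T (x q v) = x q (T v)) → ∃ z : ℂ, ∀ v, T v = z • v) :
    ∃ (n : ℕ) (δ : Module.Basis (Fin n) ℂ (equivariantMaps x y)) (δ' : Fin n → equivariantMaps y x),
      ∀ i j v, (δ' i).1 ((δ j).1 v) = (if j = i then (1 : ℂ) else 0) • v := by
  have hd : (Module.finrank ℂ X : ℂ) ≠ 0 := by
    exact_mod_cast (Module.finrank_pos (R := ℂ) (M := X)).ne'
  let B : equivariantMaps x y →ₗ[ℂ] equivariantMaps y x →ₗ[ℂ] ℂ :=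
    LinearMap.mk₂ ℂ (fun δ δ' => (Module.finrank ℂ X : ℂ)⁻¹ * LinearMap.trace ℂ X (δ'.1 ∘ₗ δ.1))
      (fun _ _ _ => by simp [LinearMap.comp_add, mul_add])
      (fun _ _ _ => by simp [LinearMap.comp_smul, mul_left_comm])
      (fun _ _ _ => by simp [LinearMap.add_comp, mul_add])
      (fun _ _ _ => by simp [LinearMap.smul_comp, mul_left_comm])
  have hB : ∀ δ δ' v, (δ' : equivariantMaps y x).1 ((δ : equivariantMaps x y).1 v)
      = B δ δ' • v := by
    intro δ δ' v
    obtain ⟨z, hz⟩ := hx (δ'.1 ∘ₗ δ.1) fun q v => by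
      rw [LinearMap.comp_apply, δ.2 q, δ'.2 q, LinearMap.comp_apply]
    have e : δ'.1 ∘ₗ δ.1 = z • LinearMap.id := LinearMap.ext hz
    have e' : B δ δ' = z := by
      change (Module.finrank ℂ X : ℂ)⁻¹ * LinearMap.trace ℂ X (δ'.1 ∘ₗ δ.1) = z
      rw [e, _root_.map_smul, LinearMap.trace_id, smul_eq_mul, mul_left_comm, inv_mul_cancel₀ hd,
        mul_one]
    rw [e', ← hz v]
    rfl
  have hinj : Function.Injective B := by
    refine (injective_iff_map_eq_zero B).2 fun δ hδ => ?_
    obtain ⟨ε, hε, h⟩ := exists_equivariant_pseudoinverse x y δ.1 δ.2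
    refine Subtype.ext (LinearMap.ext fun v => ?_)
    rw [← h v, show ε (δ.1 v) = B δ ⟨ε, hε⟩ • v from hB δ ⟨ε, hε⟩ v, hδ]
    simp
  have hsurj := LinearMap.flip_surjective_iff₁.2 hinj
  let b := Module.finBasis ℂ (equivariantMaps x y)
  choose δ' hδ' using fun i => hsurj (b.coord i)
  refine ⟨_, b, δ', fun i j v => ?_⟩
  rw [hB, ← LinearMap.flip_apply, hδ', Module.Basis.coord_apply, Module.Basis.repr_self,
    Finsupp.single_apply]

omit [Fintype Q] [FiniteDimensional ℂ X] [FiniteDimensional ℂ W] in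
/-- the trace of an endomorphism of `Hom_Q(x, y)` in terms of dual bases -/
theorem sum_dual_basis_apply {n : ℕ} {δ : Module.Basis (Fin n) ℂ (equivariantMaps x y)}
    {δ' : Fin n → equivariantMaps y x}
    (h : ∀ i j v, (δ' i).1 ((δ j).1 v) = (if j = i then (1 : ℂ) else 0) • v)
    (T : Module.End ℂ (equivariantMaps x y)) (v : X) :
    ∑ i, (δ' i).1 ((T (δ i)).1 v) = LinearMap.trace ℂ _ T • v := by
  rw [LinearMap.trace_eq_matrix_trace ℂ δ, Matrix.trace, Finset.sum_smul]
  refine Finset.sum_congr rfl fun i _ => ?_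
  rw [Matrix.diag_apply, LinearMap.toMatrix_apply]
  conv_lhs => rw [← δ.sum_repr (T (δ i))]
  rw [Submodule.coe_sum, LinearMap.sum_apply, map_sum, Finset.sum_eq_single i]
  · rw [Submodule.coe_smul, LinearMap.smul_apply, _root_.map_smul, h, if_pos rfl, one_smul]
  · intro j _ hj
    rw [Submodule.coe_smul, LinearMap.smul_apply, _root_.map_smul, h, if_neg hj, zero_smul,
      smul_zero]
  · simp

omit [FiniteDimensional ℂ X] [FiniteDimensional ℂ W] in
theorem nonempty_of_dual_basis {n : ℕ} (δ : Module.Basis (Fin n) ℂ (equivariantMaps x y))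
    (ε : W →ₗ[ℂ] X) (hε : ∀ q v, ε (y q v) = x q (ε v)) (h : ε ≠ 0) : n ≠ 0 := by
  rintro rfl
  obtain ⟨η, hη, h'⟩ := exists_equivariant_pseudoinverse y x ε hε
  refine h (LinearMap.ext fun v => ?_)
  have e : (⟨η, hη⟩ : equivariantMaps x y) = 0 :=
    (δ.ext_elem_iff.2 fun i => i.elim0)
  have e' : η = 0 := congrArg Subtype.val e
  rw [← h' v, e']
  simp

end DualBasis

section TensorForm

variable {ι : Type*} {V V' : ι → Type*} [∀ a, AddCommGroup (V a)] [∀ a, Module ℂ (V a)]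
  [∀ a, AddCommGroup (V' a)] [∀ a, Module ℂ (V' a)] [Fintype ι]

/-- the product of bilinear forms on a tensor product -/
def tensorBilin (β : ∀ a, V a →ₗ[ℂ] V' a →ₗ[ℂ] ℂ) :
    (⨂[ℂ] a, V a) →ₗ[ℂ] (⨂[ℂ] a, V' a) →ₗ[ℂ] ℂ :=
  (PiTensorProduct.map₂ β).compr₂ (tensorForm fun _ => LinearMap.id)

theorem tensorBilin_tprod (β : ∀ a, V a →ₗ[ℂ] V' a →ₗ[ℂ] ℂ) (v : ∀ a, V a) (v' : ∀ a, V' a) :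
    tensorBilin β (PiTensorProduct.tprod ℂ v) (PiTensorProduct.tprod ℂ v')
      = ∏ a, β a (v a) (v' a) := by
  rw [tensorBilin, LinearMap.compr₂_apply, PiTensorProduct.map₂_tprod_tprod, tensorForm_tprod]
  rfl

omit [Fintype ι] in
/-- Bilinear maps on tensor products are determined by their values on pure tensors. -/
theorem tensor_ext₂ {ι' : Type*} {V' : ι' → Type*} [∀ a, AddCommGroup (V' a)]
    [∀ a, Module ℂ (V' a)] {M : Type*} [AddCommGroup M] [Module ℂ M]
    {B B' : (⨂[ℂ] a, V a) →ₗ[ℂ] (⨂[ℂ] a, V' a) →ₗ[ℂ] M}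
    (h : ∀ v v', B (PiTensorProduct.tprod ℂ v) (PiTensorProduct.tprod ℂ v')
      = B' (PiTensorProduct.tprod ℂ v) (PiTensorProduct.tprod ℂ v')) : B = B' := by
  refine PiTensorProduct.ext (MultilinearMap.ext fun v => ?_)
  refine PiTensorProduct.ext (MultilinearMap.ext fun v' => ?_)
  exact h v v'

end TensorForm

namespace Blocks

section BlockMat

variable {F : Type*} [Field F] {N c r : ℕ} {D : Blocks N (fun _ : Fin c => r)}

/-- A permutation preserving the blocks is a product of a block permutation and a permutation
inside the blocks. -/
theorem exists_blockMat_mul {w : Equiv.Perm (Fin N)}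
    (hw : ∀ x y, D.blk x = D.blk y → D.blk (w x) = D.blk (w y)) :
    ∃ (σ : Equiv.Perm (Fin c)) (p : parabolic (F := F) D.blk),
      permGL F N w = D.blockMat F σ * p := by
  obtain ⟨σ, hσ⟩ : ∃ σ : Equiv.Perm (Fin c), ∀ x, D.blk (w x) = σ (D.blk x) := by
    rcases Nat.eq_zero_or_pos r with rfl | hr
    · exact ⟨1, fun x => by
        obtain ⟨i, _⟩ := D.surj _ x rfl
        exact i.elim0⟩
    · have hi : Function.Injective fun a => D.blk (w (D.enum a ⟨0, hr⟩)) := by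
        intro a b hab
        have := perm_preserves_inv hw _ _ hab
        simpa [D.blk_enum] using this
      refine ⟨Equiv.ofBijective _ (Finite.injective_iff_bijective.1 hi), fun x => ?_⟩
      exact hw _ _ (D.blk_enum _ _).symm
  refine ⟨σ, ⟨permGL F N ((D.blockPerm σ)⁻¹ * w), fun i j hij => ?_⟩, ?_⟩
  · rw [permGL_apply, if_neg]
    rintro rfl
    have e : D.blk (((D.blockPerm σ)⁻¹ * w) j) = D.blk j := by
      rw [← map_inv, Equiv.Perm.mul_apply, blk_blockPerm, hσ, Equiv.Perm.inv_def,
        Equiv.symm_apply_apply]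
    exact absurd (e ▸ hij) (lt_irrefl _)
  · change _ = permGL F N (D.blockPerm σ) * _
    rw [← _root_.map_mul, mul_inv_cancel_left]

end BlockMat

end Blocks

namespace Blocks

section Primary

variable {F : Type*} [Field F] {N c r : ℕ} {D : Blocks N (fun _ : Fin c => r)}
  {V : Type*} [AddCommGroup V] [Module ℂ V] {ρ : Representation ℂ (GL (Fin r) F) V}
  {W : Type*} [AddCommGroup W] [Module ℂ W] {π : Representation ℂ (GL (Fin N) F) W}

theorem powRep_scalar [Fintype F] [FiniteDimensional ℂ V] (hρ : IsIrred ρ)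
    (T : Module.End ℂ (⨂[ℂ] _ : Fin c, V))
    (hT : ∀ m v, T (D.powRep ρ (D.diagP m) v) = D.powRep ρ (D.diagP m) (T v)) :
    ∃ z : ℂ, ∀ v, T v = z • v := by
  classical
  refine piTensorRep_scalar (fun _ => hρ) T fun m v => ?_
  simpa only [powRep_diagP] using hT m v

theorem apply_hecke [Fintype F] [Fintype (parabolic (F := F) D.blk)] [FiniteDimensional ℂ V]
    (hρ : IsIrred ρ)
    (δ : equivariantMaps (D.powRep ρ) (π.comp (parabolic (F := F) D.blk).subtype))
    (δ' : equivariantMaps (π.comp (parabolic (F := F) D.blk).subtype) (D.powRep ρ))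
    (σ : Equiv.Perm (Fin c)) (v : ⨂[ℂ] _ : Fin c, V) :
    δ'.1 ((hecke (D.powRep ρ) π (D.blockMat F) (permTensor c V) σ δ).1 v)
      = δ'.1 (π (D.blockMat F σ) (δ.1 (permTensor c V σ⁻¹ v))) := by
  obtain ⟨z, hz⟩ := powRep_scalar (D := D) hρ
    (δ'.1 ∘ₗ π (D.blockMat F σ) ∘ₗ δ.1 ∘ₗ permTensor c V σ⁻¹) fun m v => by
      obtain ⟨A, hA⟩ : ∃ A : parabolic (F := F) D.blk, (A : GL (Fin N) F)
          = D.blockMat F σ⁻¹ * (D.diagP m : parabolic (F := F) D.blk).1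
            * (D.blockMat F σ⁻¹)⁻¹ :=
        ⟨D.diagP fun a => m (σ⁻¹⁻¹ a), (D.blockMat_conj_diag σ⁻¹ m).symm⟩
      simp only [LinearMap.comp_apply]
      rw [← powRep_permTensor σ⁻¹ (D.diagP m) A hA, δ.2 A]
      change δ'.1 (π (D.blockMat F σ) (π A.1 _)) = _
      rw [← rep_mul_apply π, hA, map_inv]
      have e : D.blockMat F σ * ((D.blockMat F σ)⁻¹ * (D.diagP m : parabolic (F := F) D.blk).1
            * (D.blockMat F σ)⁻¹⁻¹) = (D.diagP m : parabolic (F := F) D.blk).1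
            * D.blockMat F σ := by group
      rw [e, rep_mul_apply π]
      exact δ'.2 (D.diagP m) _
  have hz' : ∀ v, δ'.1 (π (D.blockMat F σ) (δ.1 (permTensor c V σ⁻¹ v))) = z • v := hz
  rw [hz', hecke_apply, avg_apply, _root_.map_smul, map_sum]
  have hq : ∀ q : parabolic (F := F) D.blk, δ'.1 (π q
      ((π (D.blockMat F σ) ∘ₗ δ.1 ∘ₗ permTensor c V σ⁻¹) (D.powRep ρ q⁻¹ v))) = z • v := fun q => by
    refine (δ'.2 q _).trans ?_
    simp only [LinearMap.comp_apply]
    rw [hz', _root_.map_smul, rep_self_inv_apply]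
  simp only [hq]
  exact card_inv_smul_sum _

theorem preserves_of_powRep [Fintype F] (hc : IsCuspidal ρ) (φ : GL (Fin N) F → ⨂[ℂ] _ : Fin c, V)
    (h1 : ∀ (q : parabolic (F := F) D.blk) g, φ (q * g) = D.powRep ρ q (φ g))
    (h2 : ∀ g u : GL (Fin N) F, D.Lev u.val 1 → φ (g * u) = φ g)
    (w : Equiv.Perm (Fin N)) (hw : φ (permGL F N w) ≠ 0) :
    ∀ x y, D.blk x = D.blk y → D.blk (w x) = D.blk (w y) := by
  have hS : ∀ (b : Fin c) (h : GL (Fin r) F),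
      piTensorRep (fun _ : Fin c => ρ) (Pi.mulSingle b h) = tensorSlot (V := fun _ => V) b (ρ h) :=
    fun b h => piTensorRep_mulSingle (fun _ : Fin c => ρ) b h
  have h1' : ∀ (A g : GL (Fin N) F) (m : Fin c → GL (Fin r) F),
      D.Lev A.val (fun b => (m b).val) → φ (A * g) = piTensorRep (fun _ : Fin c => ρ) m (φ g) :=
    fun A g m hA => (h1 ⟨A, hA.1⟩ g).trans (by rw [powRep_of_lev (D := D) (A := ⟨A, hA.1⟩) hA])
  exact preserves_of_equivariant (D := D) (ρ := fun _ => ρ) (R := piTensorRep fun _ : Fin c => ρ)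
    (S := fun b => tensorSlot (V := fun _ => V) b) (fun _ => hc) hS φ h1' h2 w hw

/-- Let `π` be an irreducible representation admitting a nonzero equivariant map to a power of a
self-dual cuspidal representation. Then `π` is self-dual. -/
theorem selfDual_of_powRep [Fintype F] [FiniteDimensional ℂ V] [FiniteDimensional ℂ W]
    (hρ : IsIrred ρ) (hc : IsCuspidal ρ) (hd : RepIso ρ ρ.dual) (hπ : IsIrred π)
    (ε : W →ₗ[ℂ] ⨂[ℂ] _ : Fin c, V)
    (hε : ∀ (q : parabolic (F := F) D.blk) v, ε (π q v) = D.powRep ρ q (ε v)) (h0 : ε ≠ 0) :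
    RepIso π π.dual := by
  classical
  have : Fintype (parabolic (F := F) D.blk) := Fintype.ofFinite _
  obtain ⟨u, hu⟩ := hρ.1
  have : Nontrivial (⨂[ℂ] _ : Fin c, V) :=
    ⟨_, 0, tprod_ne_zero fun _ : Fin c => hu⟩
  obtain ⟨n, δ, δ', hδ⟩ := exists_dual_basis (x := D.powRep ρ)
    (y := π.comp (parabolic (F := F) D.blk).subtype)
    fun T hT => powRep_scalar hρ T fun m v => hT _ v
  have hn : n ≠ 0 := nonempty_of_dual_basis δ ε hε h0
  obtain ⟨T, hT⟩ := hd
  let β : (⨂[ℂ] _ : Fin c, V) →ₗ[ℂ] (⨂[ℂ] _ : Fin c, V) →ₗ[ℂ] ℂ :=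
    tensorBilin fun _ => T.toLinearMap
  have hβR : ∀ (q : parabolic (F := F) D.blk) v v',
      β (D.powRep ρ q v) (D.powRep ρ q v') = β v v' := fun q v v' => by
    have e : β.compl₁₂ (D.powRep ρ q) (D.powRep ρ q) = β := tensor_ext₂ fun v v' => by
      rw [LinearMap.compl₁₂_apply, powRep, MonoidHom.comp_apply, piTensorRep_tprod,
        piTensorRep_tprod, tensorBilin_tprod, tensorBilin_tprod]
      refine Finset.prod_congr rfl fun a _ => ?_
      simp only [LinearEquiv.coe_coe]
      rw [hT, dual_rep_apply, rep_inv_self_apply]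
    exact LinearMap.congr_fun₂ e v v'
  have hβJ : ∀ σ v v', β (permTensor c V σ v) (permTensor c V σ v') = β v v' := fun σ v v' => by
    have e : β.compl₁₂ (permTensor c V σ) (permTensor c V σ) = β := tensor_ext₂ fun v v' => by
      rw [LinearMap.compl₁₂_apply, permTensor_tprod, permTensor_tprod, tensorBilin_tprod,
        tensorBilin_tprod]
      exact Equiv.prod_comp σ⁻¹ fun a => T.toLinearMap (v a) (v' a)
    exact LinearMap.congr_fun₂ e v v'
  obtain ⟨x₁, x₀, hx⟩ : ∃ x₁ x₀, β x₁ x₀ ≠ 0 := by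
    obtain ⟨v, hv⟩ := T.surjective (Module.Projective.exists_dual_ne_zero ℂ hu).choose
    refine ⟨PiTensorProduct.tprod ℂ fun _ => v, PiTensorProduct.tprod ℂ fun _ => u, ?_⟩
    rw [tensorBilin_tprod, Finset.prod_ne_zero_iff]
    intro a _
    simp only [LinearEquiv.coe_coe]
    rw [hv]
    exact (Module.Projective.exists_dual_ne_zero ℂ hu).choose_spec
  let Ψ : GL (Fin N) F → Module.End ℂ (⨂[ℂ] _ : Fin c, V) := fun g =>
    ∑ i, (δ' i).1 ∘ₗ π g ∘ₗ (δ i).1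
  have hΨ : ∀ g v, Ψ g v = ∑ i, (δ' i).1 (π g ((δ i).1 v)) := fun g v => by
    simp [Ψ]
  have hl : ∀ (q : parabolic (F := F) D.blk) g v, Ψ (q * g) v = D.powRep ρ q (Ψ g v) :=
    fun q g v => by
      rw [hΨ, hΨ, map_sum]
      refine Finset.sum_congr rfl fun i _ => ?_
      rw [rep_mul_apply]
      exact (δ' i).2 q _
  have hr : ∀ (q : parabolic (F := F) D.blk) g v, Ψ (g * q) v = Ψ g (D.powRep ρ q v) :=
    fun q g v => by
      rw [hΨ, hΨ]
      refine Finset.sum_congr rfl fun i _ => ?_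
      rw [rep_mul_apply, (δ i).2 q]
      rfl
  have hσ : ∀ σ v, Ψ (D.blockMat F σ) v = LinearMap.trace ℂ _
      (hecke (D.powRep ρ) π (D.blockMat F) (permTensor c V) σ) • permTensor c V σ v :=
    fun σ v => by
      rw [← sum_dual_basis_apply hδ, hΨ]
      refine Finset.sum_congr rfl fun i _ => ?_
      rw [apply_hecke hρ, rep_inv_self_apply]
  have hzero : ∀ w, (¬ ∀ x y, D.blk x = D.blk y → D.blk (w x) = D.blk (w y)) → ∀ v,
      Ψ (permGL F N w) v = 0 := fun w hw v => by
    by_contra hne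
    refine hw (preserves_of_powRep hc (fun g => Ψ g v) (fun q g => hl q g v) (fun g u hu => ?_)
      w hne)
    refine (hr ⟨u, hu.1⟩ g v).trans ?_
    rw [powRep_of_lev_one (A := ⟨u, hu.1⟩) hu]
    rfl
  have hadj : ∀ (q : parabolic (F := F) D.blk) v v',
      β v (D.powRep ρ q v') = β (D.powRep ρ q⁻¹ v) v' := fun q v v' => by
    rw [← hβR q⁻¹, rep_inv_self_apply]
  have hmul : ∀ (q q' : parabolic (F := F) D.blk) g,
      (∀ v v', β v (Ψ g v') = β (Ψ g⁻¹ v) v') →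
      ∀ v v', β v (Ψ (q * g * q') v') = β (Ψ (q * g * q')⁻¹ v) v' := fun q q' g h v v' => by
    rw [hr, hl, hadj, h, hadj, _root_.mul_inv_rev, _root_.mul_inv_rev]
    have e1 := hl q'⁻¹ (g⁻¹ * (q : GL (Fin N) F)⁻¹) v
    have e2 := hr q⁻¹ g⁻¹ v
    rw [Subgroup.coe_inv] at e1 e2
    rw [e1, e2]
  have hsymm : ∀ g v v', β v (Ψ g v') = β (Ψ g⁻¹ v) v' := by
    intro g
    obtain ⟨w, b₁, b₂, hb₁, hb₂, rfl⟩ := bruhat g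
    refine hmul ⟨b₁, blockTriangular_of_id D.mono hb₁⟩ ⟨b₂, blockTriangular_of_id D.mono hb₂⟩ _ ?_
    by_cases hw : ∀ x y, D.blk x = D.blk y → D.blk (w x) = D.blk (w y)
    · obtain ⟨σ, p, hp⟩ := exists_blockMat_mul (F := F) hw
      rw [hp]
      have := hmul 1 p (D.blockMat F σ) fun v v' => by
        rw [← map_inv, hσ, hσ, ← trace_hecke_inv hρ hc σ, _root_.map_smul, _root_.map_smul,
          LinearMap.smul_apply, ← hβJ σ (permTensor c V σ⁻¹ v), rep_self_inv_apply]
      simpa only [OneMemClass.coe_one, _root_.one_mul] using this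
    · intro v v'
      rw [hzero w hw, ← map_inv, hzero w⁻¹ fun h => hw ?_, map_zero, map_zero]
      · rfl
      · simpa only [inv_inv] using perm_preserves_inv h
  refine hπ.selfDual_of_coef (fun g => β x₁ (Ψ g x₀)) (fun i => β x₁ ∘ₗ (δ' i).1)
    (fun i => (δ i).1 x₀) (fun i => β.flip x₀ ∘ₗ (δ' i).1) (fun i => (δ i).1 x₁)
    (fun g => ?_) (fun g => ?_) ?_
  · rw [hΨ, map_sum]
    rfl
  · rw [hsymm, hΨ, map_sum, LinearMap.sum_apply]
    rfl
  · have e : Ψ 1 x₀ = (n : ℂ) • x₀ := by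
      rw [hΨ]
      simp only [_root_.map_one, Module.End.one_apply, hδ, if_pos, one_smul, Finset.sum_const,
        Finset.card_univ, Fintype.card_fin]
      rw [← Nat.cast_smul_eq_nsmul ℂ]
    rw [e, _root_.map_smul, smul_eq_mul]
    exact mul_ne_zero (Nat.cast_ne_zero.2 hn) hx

end Primary

end Blocks

section Frobenius

variable {G : Type*} [Group G] {P : Subgroup G} {X W : Type*} [AddCommGroup X] [Module ℂ X]
  [AddCommGroup W] [Module ℂ W]

/-- A representation occurring in an induced representation has a nonzero equivariant map to the
inducing representation. -/
theorem OccursIn.exists_equivariant {x : Representation ℂ P X} {π : Representation ℂ G W}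
    (hπ : IsIrred π) (h : OccursIn π (IndRep P x)) :
    ∃ ε : W →ₗ[ℂ] X, (∀ (p : P) w, ε (π p w) = x p (ε w)) ∧ ε ≠ 0 := by
  obtain ⟨ι, hι, hιπ⟩ := h
  let ε : W →ₗ[ℂ] X := LinearMap.proj (1 : G) ∘ₗ (IndCarrier P x).subtype ∘ₗ ι
  have hε : ∀ g w, ε (π g w) = (ι w).1 g := fun g w => by
    change (ι (π g w)).1 1 = _
    rw [hιπ]
    change (ι w).1 (1 * g) = _
    rw [_root_.one_mul]
  refine ⟨ε, fun p w => ?_, fun h0 => ?_⟩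
  · rw [hε, ← mul_one (p : G), (ι w).2 p 1]
    rfl
  · obtain ⟨w, hw⟩ := hπ.1
    refine hw (hι ?_)
    rw [map_zero]
    refine Subtype.ext (funext fun g => ?_)
    rw [← hε, h0]
    rfl

theorem IsPrimary.exists_powRep {F : Type*} [Field F] {r c : ℕ} {V : Type*} [AddCommGroup V]
    [Module ℂ V] {ρ : Representation ℂ (GL (Fin r) F) V}
    {π : Representation ℂ (GL (Fin (r * c)) F) W} (hπ : IsIrred π) (h : IsPrimary ρ π) :
    ∃ (D : Blocks (r * c) (fun _ : Fin c => r)) (ε : W →ₗ[ℂ] ⨂[ℂ] _ : Fin c, V),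
      (∀ (q : parabolic (F := F) D.blk) w, ε (π q w) = D.powRep ρ q (ε w)) ∧ ε ≠ 0 := by
  obtain ⟨f, e, hf, he, hmem, hsurj, h⟩ := h
  exact ⟨⟨f, e, hf, fun a => (he a).injective, hmem, hsurj⟩, h.exists_equivariant hπ⟩

end Frobenius

section DualTo

variable {V V' V'' : Type*} [AddCommGroup V] [Module ℂ V] [AddCommGroup V'] [Module ℂ V']
  [AddCommGroup V''] [Module ℂ V''] {F : Type*} [Field F]

/-- the relation of being dual, for representations of general linear groups -/
def DualTo {a b : ℕ} (ρ : Representation ℂ (GL (Fin a) F) V)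
    (ρ' : Representation ℂ (GL (Fin b) F) V') : Prop :=
  ∃ h : a = b, RepIso ρ.dual (ρ'.comp (castGL h).toMonoidHom)

theorem comp_castGL_rfl {a : ℕ} (h : a = a) (ρ : Representation ℂ (GL (Fin a) F) V) :
    ρ.comp (castGL h).toMonoidHom = ρ :=
  MonoidHom.ext fun g => congrArg ρ (castGL_rfl h g)

theorem dualTo_iff {a : ℕ} {ρ : Representation ℂ (GL (Fin a) F) V}
    {ρ' : Representation ℂ (GL (Fin a) F) V'} : DualTo ρ ρ' ↔ RepIso ρ.dual ρ' :=
  ⟨fun ⟨h, e⟩ => by rwa [comp_castGL_rfl] at e, fun e => ⟨rfl, by rwa [comp_castGL_rfl]⟩⟩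

theorem DualTo.symm [FiniteDimensional ℂ V] {a b : ℕ} {ρ : Representation ℂ (GL (Fin a) F) V}
    {ρ' : Representation ℂ (GL (Fin b) F) V'} (h : DualTo ρ ρ') : DualTo ρ' ρ := by
  obtain ⟨rfl, -⟩ := id h
  rw [dualTo_iff] at h ⊢
  exact h.symm.dual.trans (RepIso.dual_dual ρ).symm

theorem DualTo.repIso [FiniteDimensional ℂ V] {a b b' : ℕ}
    {ρ : Representation ℂ (GL (Fin a) F) V} {ρ' : Representation ℂ (GL (Fin b) F) V'}
    {ρ'' : Representation ℂ (GL (Fin b') F) V''} (h : DualTo ρ ρ') (h' : DualTo ρ ρ'') :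
    ∃ e : b = b', RepIso ρ' (ρ''.comp (castGL e).toMonoidHom) := by
  obtain ⟨rfl, -⟩ := id h
  obtain ⟨rfl, -⟩ := id h'
  rw [dualTo_iff] at h h'
  refine ⟨rfl, ?_⟩
  rw [comp_castGL_rfl]
  exact h.symm.trans h'

end DualTo

theorem IsIrred.selfDual_of_subsingleton {G V : Type*} [Group G] [AddCommGroup V] [Module ℂ V]
    [FiniteDimensional ℂ V] [Subsingleton G] {π : Representation ℂ G V} (h : IsIrred π) :
    RepIso π π.dual := by
  have : Fintype G := Fintype.ofFinite G
  obtain ⟨v, hv⟩ := h.1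
  obtain ⟨l, hl⟩ := Module.Projective.exists_dual_ne_zero ℂ hv
  refine h.selfDual_of_coef (fun _ => l v) (fun _ : Unit => l) (fun _ => v) (fun _ : Unit => l)
    (fun _ => v) (fun g => ?_) (fun g => ?_) hl
  · rw [Subsingleton.elim g 1]
    simp
  · rw [Subsingleton.elim g⁻¹ 1]
    simp

namespace Blocks

section Refine

variable {N t : ℕ} {r c : Fin t → ℕ} (D : Blocks N (fun i => r i * c i))
  (hD : ∀ i, Monotone (D.enum i)) (E : ∀ i, Blocks (r i * c i) (fun _ : Fin (c i) => r i))

/-- the position of an index inside its block -/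
def pos (x : Fin N) : Fin (r (D.blk x) * c (D.blk x)) := (D.surj _ x rfl).choose

theorem enum_pos (x : Fin N) : D.enum _ (D.pos x) = x := (D.surj _ x rfl).choose_spec

/-- the block of an index in the subdivision of the blocks -/
def refineBlk (x : Fin N) : Σₗ i, Fin (c i) := toLex ⟨D.blk x, (E (D.blk x)).blk (D.pos x)⟩

theorem refineBlk_enum (i : Fin t) (x : Fin (r i * c i)) :
    D.refineBlk E (D.enum i x) = toLex ⟨i, (E i).blk x⟩ := by
  have key : ∀ (j : Fin t) (y : Fin (r j * c j)), j = i → D.enum j y = D.enum i x →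
      (toLex ⟨j, (E j).blk y⟩ : Σₗ i, Fin (c i)) = toLex ⟨i, (E i).blk x⟩ := by
    rintro j y rfl h
    rw [D.inj j h]
  exact key _ _ (D.blk_enum i x) (D.enum_pos _)

include hD in
theorem monotone_refineBlk : Monotone (D.refineBlk E) := by
  intro x y hxy
  obtain ⟨i, a, rfl⟩ : ∃ i a, D.enum i a = x := ⟨_, _, D.enum_pos x⟩
  obtain ⟨j, b, rfl⟩ : ∃ i a, D.enum i a = y := ⟨_, _, D.enum_pos y⟩
  rw [refineBlk_enum, refineBlk_enum, Sigma.Lex.le_def]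
  have h := D.mono hxy
  rw [D.blk_enum, D.blk_enum] at h
  rcases h.lt_or_eq with h | rfl
  · exact Or.inl h
  · refine Or.inr ⟨rfl, (E i).mono ?_⟩
    by_contra hab
    have := hD i (not_le.1 hab).le
    have := D.inj i (le_antisymm this hxy)
    exact hab this.ge

/-- the subdivision of the blocks -/
def refine : Blocks N (fun b : Σₗ i, Fin (c i) => r b.1) where
  blk := D.refineBlk E
  enum b x := D.enum b.1 ((E b.1).enum b.2 x)
  mono := D.monotone_refineBlk hD E
  inj b := (D.inj _).comp ((E b.1).inj b.2)
  blk_enum b x := by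
    rw [refineBlk_enum, (E b.1).blk_enum]
    rfl
  surj b x h := by
    obtain ⟨i, a, rfl⟩ : ∃ i a, D.enum i a = x := ⟨_, _, D.enum_pos x⟩
    rw [refineBlk_enum] at h
    subst h
    obtain ⟨y, hy⟩ := (E i).surj _ a rfl
    exact ⟨y, congrArg (D.enum i) hy⟩

variable {D hD E} {F : Type*} [Field F]

theorem blockTriangular_of_refine {A : Matrix (Fin N) (Fin N) F}
    (h : BlockTriangular A (D.refine hD E).blk) : BlockTriangular A D.blk :=
  fun _ _ hxy => h (Sigma.Lex.lt_def.2 (Or.inl hxy))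

theorem lev_of_refine {A : GL (Fin N) F} {m : ∀ b : Σₗ i, Fin (c i), GL (Fin (r b.1)) F}
    (h : (D.refine hD E).Lev A.val fun b => (m b).val) {Y : ∀ i, GL (Fin (r i * c i)) F}
    (hY : D.Lev A.val fun i => (Y i).val) (i : Fin t) :
    (E i).Lev (Y i).val fun a => (m (toLex ⟨i, a⟩)).val := by
  have e : ∀ x y, (Y i).val x y = A.val (D.enum i x) (D.enum i y) := fun x y =>
    (congrFun₂ (hY.2 i) x y).symm.trans (D.inclT_mul_mul_incl_apply A.val x y)
  refine ⟨fun x y hxy => ?_, fun a => ?_⟩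
  · rw [e]
    refine h.1 ?_
    change D.refineBlk E _ < D.refineBlk E _
    rw [refineBlk_enum, refineBlk_enum]
    exact Sigma.Lex.lt_def.2 (Or.inr ⟨rfl, hxy⟩)
  · ext x y
    rw [inclT_mul_mul_incl_apply, e]
    exact ((D.refine hD E).inclT_mul_mul_incl_apply (b := toLex ⟨i, a⟩) (b' := toLex ⟨i, a⟩)
      A.val x y).symm.trans (congrFun₂ (h.2 (toLex ⟨i, a⟩)) x y)

end Refine

end Blocks

namespace Blocks

section Nested

variable {F : Type*} [Field F] {N t : ℕ} {r c : Fin t → ℕ}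
  {Vρ : Fin t → Type*} [∀ i, AddCommGroup (Vρ i)] [∀ i, Module ℂ (Vρ i)]
  (ρ : ∀ i, Representation ℂ (GL (Fin (r i)) F) (Vρ i))

/-- families indexed by the refined blocks, as iterated families -/
def nestFam : (∀ b : Σₗ i, Fin (c i), GL (Fin (r b.1)) F) →*
    ∀ i, Fin (c i) → GL (Fin (r i)) F where
  toFun m i a := m (toLex ⟨i, a⟩)
  map_one' := rfl
  map_mul' _ _ := rfl

theorem nestFam_mulSingle (i : Fin t) (a : Fin (c i)) (h : GL (Fin (r i)) F) :
    nestFam (F := F) (r := r) (c := c) (Pi.mulSingle (toLex ⟨i, a⟩) h)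
      = Pi.mulSingle i (Pi.mulSingle a h) := by
  funext j b
  by_cases hj : j = i
  · subst hj
    rw [Pi.mulSingle_eq_same]
    by_cases hb : b = a
    · subst hb
      rw [Pi.mulSingle_eq_same]
      exact Pi.mulSingle_eq_same _ _
    · rw [Pi.mulSingle_eq_of_ne hb]
      refine Pi.mulSingle_eq_of_ne (fun hab => hb ?_) _
      exact eq_of_heq (Sigma.mk.inj hab).2
  · rw [Pi.mulSingle_eq_of_ne hj]
    exact Pi.mulSingle_eq_of_ne (fun hab => hj (congrArg Sigma.fst hab)) _

variable (c) in
/-- the representation of the Levi subgroup of the refined blocks, on iterated tensor powers -/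
def nestRep : (∀ b : Σₗ i, Fin (c i), GL (Fin (r b.1)) F) →*
    Module.End ℂ (⨂[ℂ] i, ⨂[ℂ] _ : Fin (c i), Vρ i) :=
  (piTensorRep fun i => piTensorRep fun _ : Fin (c i) => ρ i).comp nestFam

variable (c Vρ) in
/-- the action of endomorphisms on a slot of the iterated tensor powers -/
def nestSlot (b : Σₗ i, Fin (c i)) : Module.End ℂ (Vρ b.1) →ₗ[ℂ]
    Module.End ℂ (⨂[ℂ] i, ⨂[ℂ] _ : Fin (c i), Vρ i) :=
  (tensorSlot (V := fun i => ⨂[ℂ] _ : Fin (c i), Vρ i) b.1).comp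
    (tensorSlot (V := fun _ : Fin (c b.1) => Vρ b.1) b.2)

theorem nestRep_mulSingle (b : Σₗ i, Fin (c i)) (h : GL (Fin (r b.1)) F) :
    nestRep c ρ (Pi.mulSingle b h) = nestSlot c Vρ b (ρ b.1 h) := by
  rw [nestRep, MonoidHom.comp_apply]
  refine (congrArg _ (nestFam_mulSingle b.1 b.2 h)).trans ?_
  rw [piTensorRep_mulSingle, piTensorRep_mulSingle]
  rfl

variable {ρ} {D : Blocks N (fun i => r i * c i)} {hD : ∀ i, Monotone (D.enum i)}
  {E : ∀ i, Blocks (r i * c i) (fun _ : Fin (c i) => r i)}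
  {W : Fin t → Type*} [∀ i, AddCommGroup (W i)] [∀ i, Module ℂ (W i)]
  {π : ∀ i, Representation ℂ (GL (Fin (r i * c i)) F) (W i)}
  {ε : ∀ i, W i →ₗ[ℂ] ⨂[ℂ] _ : Fin (c i), Vρ i}

theorem map_piTensorRep_of_refine
    (hε : ∀ i (q : parabolic (F := F) (E i).blk) w, ε i (π i q w) = (E i).powRep (ρ i) q (ε i w))
    (A : parabolic (F := F) D.blk) {m : ∀ b : Σₗ i, Fin (c i), GL (Fin (r b.1)) F}
    (h : (D.refine hD E).Lev A.1.val fun b => (m b).val) (y : ⨂[ℂ] i, W i) :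
    PiTensorProduct.map ε (piTensorRep π (D.toLevi A) y)
      = nestRep c ρ m (PiTensorProduct.map ε y) := by
  refine LinearMap.congr_fun (f := PiTensorProduct.map ε ∘ₗ piTensorRep π (D.toLevi A))
    (g := nestRep c ρ m ∘ₗ PiTensorProduct.map ε) ?_ y
  refine PiTensorProduct.ext (MultilinearMap.ext fun v => ?_)
  rw [LinearMap.compMultilinearMap_apply, LinearMap.compMultilinearMap_apply,
    LinearMap.comp_apply, LinearMap.comp_apply, nestRep, MonoidHom.comp_apply, piTensorRep_tprod,
    PiTensorProduct.map_tprod, PiTensorProduct.map_tprod, piTensorRep_tprod]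
  congr 1
  funext i
  have hl : (E i).Lev (D.toLevi A i).val fun a => (nestFam m i a).val :=
    lev_of_refine h (D.lev_toLevi A) i
  rw [hε i ⟨D.toLevi A i, hl.1⟩ (v i), powRep_of_lev hl]

/-- A vector of the induced representation distinguished by the centralizer of an involution gives
an invariant vector of the inducing representation for a conjugate of the involution lying in
a translate of the Borel subgroup by a permutation matrix. -/
theorem exists_invariant [Fintype F] (hπ : ∀ i, IsIrred (π i)) (hD : ∀ i, Monotone (D.enum i))
    (hε : ∀ i (q : parabolic (F := F) (E i).blk) w, ε i (π i q w) = (E i).powRep (ρ i) q (ε i w))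
    (hε0 : ∀ i, ε i ≠ 0) {A : GL (Fin N) F} (hA : A ^ 2 = 1)
    (h : HasInvVec (IndRep (parabolic D.blk) ((piTensorRep π).comp D.toLevi))
      (Subgroup.centralizer {A} : Set (GL (Fin N) F))) :
    ∃ (w : Equiv.Perm (Fin N)) (q : GL (Fin N) F) (y : ⨂[ℂ] i, W i),
      BlockTriangular q.val id ∧ (permGL F N w * q) * (permGL F N w * q) = 1 ∧
      PiTensorProduct.map ε y ≠ 0 ∧
      ∀ B : parabolic (F := F) D.blk, B.1 * (permGL F N w * q) = (permGL F N w * q) * B.1 →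
        piTensorRep π (D.toLevi B) y = y := by
  classical
  obtain ⟨φ, hφ, hinv⟩ := h
  obtain ⟨g₀, hg₀⟩ : ∃ g, φ.1 g ≠ 0 := by
    by_contra! hcon
    exact hφ (Subtype.ext (funext hcon))
  obtain ⟨m, hm⟩ := exists_map_piTensorRep_ne_zero hπ ε hε0 _ hg₀
  have hφP : ∀ (p : parabolic (F := F) D.blk) g, φ.1 (p * g) = piTensorRep π (D.toLevi p) (φ.1 g) :=
    fun p g => φ.2 p g
  set g₁ := D.diag m * g₀ with hg₁
  have h₁ : φ.1 g₁ = piTensorRep π m (φ.1 g₀) := by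
    have := hφP ⟨D.diag m, (D.diag_lev m).1⟩ g₀
    rwa [D.toLevi_eq (A := ⟨D.diag m, (D.diag_lev m).1⟩) (D.diag_lev m)] at this
  obtain ⟨w, b₁, b₂, hb₁, hb₂, hw⟩ := bruhat (g₁ * A * g₁⁻¹)
  have hP : BlockTriangular b₁.val (D.refine hD E).blk :=
    blockTriangular_of_id (D.refine hD E).mono hb₁
  obtain ⟨m₁, -, hm₁⟩ := exists_lev b₁ hP
  have hP' : BlockTriangular b₁⁻¹.val D.blk := blockTriangular_of_refine hm₁.1
  have hX : permGL F N w * (b₂ * b₁) = (b₁⁻¹ * g₁) * A * (b₁⁻¹ * g₁)⁻¹ := by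
    have : permGL F N w = b₁⁻¹ * (g₁ * A * g₁⁻¹) * b₂⁻¹ := by
      rw [hw]
      group
    rw [this]
    group
  refine ⟨w, b₂ * b₁, φ.1 (b₁⁻¹ * g₁), ?_, ?_, ?_, ?_⟩
  · rw [Units.val_mul]
    exact hb₂.mul hb₁
  · rw [hX]
    have hAA : A * A = 1 := by rw [← pow_two, hA]
    calc (b₁⁻¹ * g₁) * A * (b₁⁻¹ * g₁)⁻¹ * ((b₁⁻¹ * g₁) * A * (b₁⁻¹ * g₁)⁻¹)
        = (b₁⁻¹ * g₁) * (A * A) * (b₁⁻¹ * g₁)⁻¹ := by group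
      _ = 1 := by rw [hAA]; group
  · rw [hφP ⟨b₁⁻¹, hP'⟩ g₁, map_piTensorRep_of_refine (ρ := ρ) hε ⟨b₁⁻¹, hP'⟩ hm₁]
    intro h0
    have h0' := (rep_injective (π := nestRep c ρ) (fun b => (m₁ b)⁻¹)) (h0.trans (map_zero _).symm)
    rw [h₁] at h0'
    exact hm h0'
  · intro B hB
    rw [hX] at hB
    rw [← hφP B]
    have hc : (b₁⁻¹ * g₁)⁻¹ * B.1 * (b₁⁻¹ * g₁) ∈ (Subgroup.centralizer {A} : Set (GL (Fin N) F)) := by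
      rw [SetLike.mem_coe, Subgroup.mem_centralizer_singleton_iff]
      generalize b₁⁻¹ * g₁ = g at hB ⊢
      have e : B.1 = g * A * g⁻¹ * B.1 * (g * A * g⁻¹)⁻¹ := by
        rw [eq_mul_inv_iff_mul_eq, hB]
      calc g⁻¹ * B.1 * g * A = g⁻¹ * (B.1 * (g * A * g⁻¹)) * g := by group
        _ = A * (g⁻¹ * B.1 * g) := by rw [hB]; group
    have := congrFun (congrArg Subtype.val (hinv _ hc)) (b₁⁻¹ * g₁)
    change φ.1 ((b₁⁻¹ * g₁) * ((b₁⁻¹ * g₁)⁻¹ * B.1 * (b₁⁻¹ * g₁))) = _ at this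
    rw [← this]
    group

end Nested

end Blocks

/-- A permutation respecting the fibres of `f` induces a permutation of the target of `f`. -/
theorem exists_perm_of_preserves {α B : Type*} [Finite α] [Finite B] (f : α → B)
    (w : Equiv.Perm α) (h : ∀ x y, f x = f y → f (w x) = f (w y)) :
    ∃ σ : Equiv.Perm B, (∀ x, σ (f x) = f (w x)) ∧ ∀ b, (∀ x, f x ≠ b) → σ b = b := by
  classical
  have hinv := perm_preserves_inv h
  let s : B → B := fun b => if hb : ∃ x, f x = b then f (w hb.choose) else b
  have hs : ∀ x, s (f x) = f (w x) := fun x => by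
    have hb : ∃ y, f y = f x := ⟨x, rfl⟩
    simp only [s, dif_pos hb]
    exact h _ _ hb.choose_spec
  have hs' : ∀ b, (∀ x, f x ≠ b) → s b = b := fun b hb => dif_neg (by simpa using hb)
  have hsi : Function.Injective s := by
    intro b b' hbb
    by_cases hb : ∃ x, f x = b <;> by_cases hb' : ∃ x, f x = b'
    · obtain ⟨x, rfl⟩ := hb
      obtain ⟨x', rfl⟩ := hb'
      rw [hs, hs] at hbb
      simpa using hinv _ _ hbb
    · obtain ⟨x, rfl⟩ := hb
      rw [hs, hs' b' (by simpa using hb')] at hbb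
      exact absurd ⟨_, hbb⟩ hb'
    · obtain ⟨x', rfl⟩ := hb'
      rw [hs, hs' b (by simpa using hb)] at hbb
      exact absurd ⟨_, hbb.symm⟩ hb
    · rwa [hs' b (by simpa using hb), hs' b' (by simpa using hb')] at hbb
  exact ⟨Equiv.ofBijective s (Finite.injective_iff_bijective.1 hsi), hs, hs'⟩

namespace Blocks

section Duality

variable {F : Type*} [Field F] [Fintype F] {N t : ℕ} {r c : Fin t → ℕ}
  {Vρ : Fin t → Type*} [∀ i, AddCommGroup (Vρ i)] [∀ i, Module ℂ (Vρ i)]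
  [∀ i, FiniteDimensional ℂ (Vρ i)]
  {ρ : ∀ i, Representation ℂ (GL (Fin (r i)) F) (Vρ i)}
  {D : Blocks N (fun i => r i * c i)}
  {E : ∀ i, Blocks (r i * c i) (fun _ : Fin (c i) => r i)}
  {W : Fin t → Type*} [∀ i, AddCommGroup (W i)] [∀ i, Module ℂ (W i)]
  [∀ i, FiniteDimensional ℂ (W i)]
  {π : ∀ i, Representation ℂ (GL (Fin (r i * c i)) F) (W i)}
  {ε : ∀ i, W i →ₗ[ℂ] ⨂[ℂ] _ : Fin (c i), Vρ i}

theorem nestRep_dualTo_of_invariant (h2 : (2 : F) ≠ 0) {k : Fin t → ℕ} {D : Blocks N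
      (fun b : Σₗ i, Fin (k i) => r b.1)}
    (hρi : ∀ i, IsIrred (ρ i)) (hρc : ∀ i, IsCuspidal (ρ i)) (w : Equiv.Perm (Fin N))
    (X q : GL (Fin N) F) (hX : X = permGL F N w * q) (hq : BlockTriangular q.val D.blk)
    (hXX : X * X = 1) {v : ⨂[ℂ] i, ⨂[ℂ] _ : Fin (k i), Vρ i} (hv : v ≠ 0)
    (hinv : ∀ (A : GL (Fin N) F) m, D.Lev A.val (fun b => (m b).val) → A * X = X * A →
      nestRep k ρ m v = v) (x : Fin N) :
    DualTo (ρ (D.blk (w x)).1) (ρ (D.blk x).1) := by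
  have hS : ∀ b h, nestRep k ρ (Pi.mulSingle b h) = nestSlot k Vρ b (ρ b.1 h) :=
    nestRep_mulSingle ρ
  have hw := preserves_of_invariant (D := D) (ρ := fun b => ρ b.1) (R := nestRep k ρ)
    (S := nestSlot k Vρ) (fun b => hρc b.1) hS w X q hX hq hXX hv hinv
  have hw' : ∀ y, D.blk (w y) = D.blk (w x) ↔ D.blk y = D.blk x := fun y =>
    ⟨fun h => by simpa using perm_preserves_inv hw _ _ h, hw y x⟩
  by_cases hb : D.blk (w x) = D.blk x
  · rw [hb] at hw' ⊢
    have := selfDual_of_invariant (D := D) (ρ := fun b => ρ b.1) (R := nestRep k ρ)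
      (S := nestSlot k Vρ) h2 (hρi _) (hρc _) hS hw' X q hX hq hXX hv hinv
    exact dualTo_iff.2 this.symm
  · exact repIso_dual_of_invariant (D := D) (ρ := fun b => ρ b.1) (R := nestRep k ρ)
      (S := nestSlot k Vρ) (hρi _) (hρi _) hS hb hw' X q hX hq hXX hv hinv

theorem exists_perm_dualTo (h2 : (2 : F) ≠ 0) (hρi : ∀ i, IsIrred (ρ i))
    (hρc : ∀ i, IsCuspidal (ρ i))
    (hdistinct : ∀ i j (_ : i ≠ j) (hr : r i = r j),
      ¬ RepIso (ρ i) ((ρ j).comp (castGL hr).toMonoidHom))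
    (hπ : ∀ i, IsIrred (π i)) (hD : ∀ i, Monotone (D.enum i))
    (hε : ∀ i (q : parabolic (F := F) (E i).blk) w, ε i (π i q w) = (E i).powRep (ρ i) q (ε i w))
    (hε0 : ∀ i, ε i ≠ 0) {A : GL (Fin N) F} (hA : A ^ 2 = 1)
    (h : HasInvVec (IndRep (parabolic D.blk) ((piTensorRep π).comp D.toLevi))
      (Subgroup.centralizer {A} : Set (GL (Fin N) F))) :
    ∃ σ : Equiv.Perm (Fin t), ∀ i, DualTo (π (σ i)) (π i) := by
  obtain ⟨w, q, y, hq, hXX, hy, hinv⟩ := exists_invariant (ρ := ρ) (E := E) hπ hD hε hε0 hA h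
  have hqE : BlockTriangular q.val (D.refine hD E).blk :=
    blockTriangular_of_id (D.refine hD E).mono hq
  have hqD : BlockTriangular q.val D.blk := blockTriangular_of_id D.mono hq
  have hdual : ∀ x, DualTo (ρ (D.blk (w x))) (ρ (D.blk x)) := by
    refine nestRep_dualTo_of_invariant (D := D.refine hD E) h2 hρi hρc w _ q rfl hqE hXX hy
      fun B m hB hBX => ?_
    rw [← map_piTensorRep_of_refine (ρ := ρ) hε ⟨B, blockTriangular_of_refine hB.1⟩ hB,
      hinv ⟨B, blockTriangular_of_refine hB.1⟩ hBX]
  have hw : ∀ x z, D.blk x = D.blk z → D.blk (w x) = D.blk (w z) := by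
    intro x z hxz
    by_contra hne
    have h1 := (hdual x).symm
    rw [hxz] at h1
    obtain ⟨e, he⟩ := h1.repIso (hdual z).symm
    exact hdistinct _ _ hne e he
  have hinv' : ∀ (B : GL (Fin N) F) m, D.Lev B.val (fun b => (m b).val) →
      B * (permGL F N w * q) = (permGL F N w * q) * B → piTensorRep π m y = y := by
    intro B m hB hBX
    rw [← D.toLevi_eq (A := ⟨B, hB.1⟩) hB]
    exact hinv ⟨B, hB.1⟩ hBX
  have hy' : y ≠ 0 := fun h0 => hy (by rw [h0, map_zero])
  obtain ⟨σ, hσ, hσ'⟩ := exists_perm_of_preserves D.blk w hw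
  refine ⟨σ, fun i => ?_⟩
  by_cases hi : ∃ x, D.blk x = i
  · obtain ⟨x, rfl⟩ := hi
    have hw' : ∀ z, D.blk (w z) = D.blk (w x) ↔ D.blk z = D.blk x := fun z =>
      ⟨fun h => by simpa using perm_preserves_inv hw _ _ h, hw z x⟩
    rw [hσ]
    by_cases hb : D.blk (w x) = D.blk x
    · rw [hb]
      have hd := hdual x
      rw [hb] at hd
      exact dualTo_iff.2 (selfDual_of_powRep (hρi _) (hρc _) (dualTo_iff.1 hd).symm (hπ _) _
        (hε _) (hε0 _)).symm
    · exact repIso_dual_of_invariant (D := D) (ρ := π) (R := piTensorRep π)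
        (S := fun b => tensorSlot (V := W) b) (hπ _) (hπ _) (piTensorRep_mulSingle π) hb hw' _ q rfl hqD hXX hy' hinv'
  · rw [hσ' i (by simpa using hi)]
    have he : IsEmpty (Fin (r i * c i)) := ⟨fun x => hi ⟨D.enum i x, D.blk_enum i x⟩⟩
    have : Subsingleton (GL (Fin (r i * c i)) F) :=
      ⟨fun g h => Units.ext (Subsingleton.elim _ _)⟩
    exact dualTo_iff.2 (hπ i).selfDual_of_subsingleton.symm

end Duality

end Blocks

section Induced

variable {G : Type*} [Group G] {P : Subgroup G} {Y : Type*} [AddCommGroup Y] [Module ℂ Y]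
  (x : Representation ℂ P Y)

theorem indRep_apply (g : G) (φ : IndCarrier P x) (h : G) : (IndRep P x g φ).1 h = φ.1 (h * g) :=
  rfl

open Classical in
/-- the element of the induced representation supported on the subgroup, with a given value at
the identity -/
def indSingle : Y →ₗ[ℂ] IndCarrier P x where
  toFun y := ⟨fun g => if h : g ∈ P then x ⟨g, h⟩ y else 0, fun p g => by
    beta_reduce
    by_cases h : g ∈ P
    · rw [dif_pos (P.mul_mem p.2 h), dif_pos h, ← rep_mul_apply x]
      rfl
    · rw [dif_neg (fun h' => h ((P.mul_mem_cancel_left p.2).1 h')), dif_neg h, map_zero]⟩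
  map_add' y y' := by
    refine Subtype.ext (funext fun g => ?_)
    change (if h : g ∈ P then x ⟨g, h⟩ (y + y') else 0) = (if h : g ∈ P then x ⟨g, h⟩ y else 0)
      + if h : g ∈ P then x ⟨g, h⟩ y' else 0
    split_ifs
    · exact map_add _ _ _
    · exact (add_zero _).symm
  map_smul' z y := by
    refine Subtype.ext (funext fun g => ?_)
    change (if h : g ∈ P then x ⟨g, h⟩ (z • y) else 0) = z • if h : g ∈ P then x ⟨g, h⟩ y else 0
    split_ifs
    · exact map_smul _ _ _
    · exact (smul_zero _).symm

theorem indSingle_apply_of_mem (p : P) (y : Y) : (indSingle x y).1 p = x p y :=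
  dif_pos p.2

theorem indSingle_apply_of_notMem {g : G} (h : g ∉ P) (y : Y) : (indSingle x y).1 g = 0 :=
  dif_neg h

theorem indRep_indSingle (p : P) (y : Y) : IndRep P x p (indSingle x y) = indSingle x (x p y) := by
  refine Subtype.ext (funext fun g => ?_)
  rw [indRep_apply]
  by_cases h : g ∈ P
  · lift g to P using h
    rw [indSingle_apply_of_mem, ← P.coe_mul, indSingle_apply_of_mem, rep_mul_apply x]
  · rw [indSingle_apply_of_notMem x h,
      indSingle_apply_of_notMem x fun h' => h ((P.mul_mem_cancel_right p.2).1 h')]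

theorem card_smul_eq_sum_indSingle [Fintype G] [Fintype P] (φ : IndCarrier P x) :
    Fintype.card P • φ = ∑ g, IndRep P x g⁻¹ (indSingle x (φ.1 g)) := by
  classical
  refine Subtype.ext (funext fun h => ?_)
  have e : (∑ g, IndRep P x g⁻¹ (indSingle x (φ.1 g)) : IndCarrier P x).1 h
      = ∑ g, (indSingle x (φ.1 g)).1 (h * g⁻¹) := by
    rw [AddSubmonoidClass.coe_finsetSum, Finset.sum_apply]
    rfl
  have e' : ∀ g, (indSingle x (φ.1 (g⁻¹ * h))).1 (h * (g⁻¹ * h)⁻¹)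
      = if g ∈ P then φ.1 h else 0 := fun g => by
    rw [_root_.mul_inv_rev, inv_inv, mul_inv_cancel_left]
    split_ifs with hg
    · lift g to P using hg
      rw [indSingle_apply_of_mem, ← P.coe_inv, φ.2, rep_self_inv_apply]
    · exact indSingle_apply_of_notMem x hg _
  rw [e, ← Equiv.sum_comp ((Equiv.inv G).trans (Equiv.mulRight h))]
  change _ = ∑ g : G, (indSingle x (φ.1 (g⁻¹ * h))).1 (h * (g⁻¹ * h)⁻¹)
  simp only [e']
  rw [← Finset.sum_filter, Finset.sum_const, ← Fintype.card_subtype]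
  exact congrArg (· • φ.1 h) (Fintype.card_congr (Equiv.refl _))

/-- A criterion for the irreducibility of an induced representation. -/
theorem isIrred_indRep [Fintype G] (hY : ∃ y : Y, y ≠ 0)
    (hx : ∀ T : Y →ₗ[ℂ] Y, (∀ p y, T (x p y) = x p (T y)) → ∃ z : ℂ, ∀ y, T y = z • y)
    (h : ∀ Φ : G → Module.End ℂ Y, (∀ (p : P) g y, Φ (p * g) y = x p (Φ g y)) →
      (∀ (p : P) g y, Φ (g * p) y = Φ g (x p y)) → ∀ g, g ∉ P → Φ g = 0) :
    IsIrred (IndRep P x) := by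
  classical
  obtain ⟨y₀, hy₀⟩ := hY
  have h1 : ∀ y, (indSingle x y).1 1 = y := fun y =>
    (indSingle_apply_of_mem x 1 y).trans (rep_one_apply x y)
  refine isIrred_of_scalar _ ⟨indSingle x y₀, fun h0 => hy₀ ?_⟩ fun T hT => ?_
  · rw [← h1 y₀, h0]
    rfl
  · let Φ : G → Module.End ℂ Y := fun g =>
      { toFun := fun y => (T (indSingle x y)).1 g
        map_add' := fun y y' => by rw [map_add, map_add]; rfl
        map_smul' := fun z y => by rw [map_smul, map_smul]; rfl }
    have hl : ∀ (p : P) g y, Φ (p * g) y = x p (Φ g y) := fun p g y => (T (indSingle x y)).2 p g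
    have hr : ∀ (p : P) g y, Φ (g * p) y = Φ g (x p y) := fun p g y => by
      change (IndRep P x p (T (indSingle x y))).1 g = (T (indSingle x (x p y))).1 g
      rw [← hT, indRep_indSingle]
    obtain ⟨z, hz⟩ := hx (Φ 1) fun p y => by
      rw [← hr, ← hl, one_mul, mul_one]
    have hs : ∀ y, T (indSingle x y) = z • indSingle x y := fun y => by
      refine Subtype.ext (funext fun g => ?_)
      change Φ g y = z • (indSingle x y).1 g
      by_cases hg : g ∈ P
      · lift g to P using hg
        rw [indSingle_apply_of_mem, ← map_smul, ← hz, ← hl, mul_one]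
      · rw [indSingle_apply_of_notMem x hg, h Φ hl hr g hg, smul_zero, LinearMap.zero_apply]
    refine ⟨z, fun φ => ?_⟩
    have hc : (Fintype.card P : ℂ) ≠ 0 := Nat.cast_ne_zero.2 Fintype.card_ne_zero
    refine smul_right_injective _ hc ?_
    simp only
    rw [smul_comm, ← map_smul, Nat.cast_smul_eq_nsmul,
      card_smul_eq_sum_indSingle, map_sum, Finset.smul_sum]
    exact Finset.sum_congr rfl fun g _ => by rw [hT, hs, map_smul]

end Induced

namespace Blocks

section Intertwiner

variable {F : Type*} [Field F] [Finite F] {N : ℕ} {B : Type*} [LinearOrder B] [Fintype B]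
  {k : B → ℕ} {D : Blocks N k} {V : B → Type*} [∀ b, AddCommGroup (V b)] [∀ b, Module ℂ (V b)]
  [∀ b, FiniteDimensional ℂ (V b)]
  {ρ : ∀ b, Representation ℂ (GL (Fin (k b)) F) (V b)}
  {Z : Type*} [AddCommGroup Z] [Module ℂ Z]
  {R : (∀ b, GL (Fin (k b)) F) →* Module.End ℂ Z}
  {S : ∀ b, Module.End ℂ (V b) →ₗ[ℂ] Module.End ℂ Z}

/-- An averaging argument: an operator intertwining two slots yields an isomorphism. -/
theorem repIso_of_slots {G : Type*} [Group G] [Finite G] {V₁ V₂ : Type*} [AddCommGroup V₁]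
    [Module ℂ V₁] [FiniteDimensional ℂ V₁] [AddCommGroup V₂] [Module ℂ V₂]
    [FiniteDimensional ℂ V₂] {ρ₁ : Representation ℂ G V₁} {ρ₂ : Representation ℂ G V₂}
    (h₁ : IsIrred ρ₁) (h₂ : IsIrred ρ₂) (S₁ : Module.End ℂ V₁ →ₗ[ℂ] Module.End ℂ Z)
    (S₂ : Module.End ℂ V₂ →ₗ[ℂ] Module.End ℂ Z) {T : Module.End ℂ Z} (hT : T ≠ 0)
    (h : ∀ g, S₁ (ρ₁ g) * T * S₂ (ρ₂ g⁻¹) = T) : RepIso ρ₁ ρ₂ := by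
  have : Fintype G := Fintype.ofFinite G
  by_contra hcon
  have h0 := sum_mul_eq_zero_of_coef (E := fun g => ρ₁ g) (E' := fun g => ρ₂ g⁻¹)
    (fun l l' v v' => by
      by_contra hne
      exact hcon (h₁.repIso_of_sum_ne_zero h₂ l l' v v' hne))
    (LinearMap.mul ℂ (Module.End ℂ Z) ∘ₗ LinearMap.mulRight ℂ T) S₁ S₂
  simp only [LinearMap.comp_apply, LinearMap.mul_apply', LinearMap.mulRight_apply, h,
    Finset.sum_const, Finset.card_univ] at h0
  rw [← Nat.cast_smul_eq_nsmul ℂ, smul_eq_zero] at h0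
  exact h0.elim (fun h2 => Fintype.card_ne_zero (Nat.cast_eq_zero.1 h2)) hT

theorem repIso_of_intertwiner {b c : B} (hi : IsIrred (ρ b)) (hi' : IsIrred (ρ c))
    (hS : ∀ b h, R (Pi.mulSingle b h) = S b (ρ b h)) {w : Equiv.Perm (Fin N)}
    (hw : ∀ x, D.blk (w x) = b ↔ D.blk x = c) (Ψ : GL (Fin N) F → Module.End ℂ Z)
    (hl : ∀ (A g : GL (Fin N) F) m, D.Lev A.val (fun b => (m b).val) → Ψ (A * g) = R m * Ψ g)
    (hr : ∀ (A g : GL (Fin N) F) m, D.Lev A.val (fun b => (m b).val) → Ψ (g * A) = Ψ g * R m)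
    (h0 : Ψ (permGL F N w) ≠ 0) :
    ∃ h : k b = k c, RepIso (ρ b) ((ρ c).comp (castGL h).toMonoidHom) := by
  obtain ⟨θ, θ', h1, h2, e1, e2⟩ := exists_perm_lift (F := F) hw
  refine repIso_castGL θ θ' h1 h2 (repIso_of_slots (Z := Z) hi
    (hi'.comp _ (conjGL_surjective θ θ' h1 h2)) (S b) (S c) h0 fun g => ?_)
  change S b (ρ b g) * _ * S c (ρ c (conjGL θ θ' h1 h2 g⁻¹)) = _
  rw [← hS, ← hS]
  have hA : D.Lev (1 + D.incl F b * (g.val - 1) * (D.incl F b)ᵀ) (fun a =>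
      ((Pi.mulSingle b g : ∀ b, GL (Fin (k b)) F) a).val) :=
    D.lev_mulSingle b (lev_one.add (lev_single b _))
  obtain ⟨A, hAv⟩ := D.lev_units hA
  rw [← hAv] at hA
  have hA' : D.Lev ((permGL F N w)⁻¹ * A * permGL F N w).val (fun a =>
      ((Pi.mulSingle c (conjGL θ θ' h1 h2 g) : ∀ b, GL (Fin (k b)) F) a).val) := by
    have e : ((permGL F N w)⁻¹ * A * permGL F N w).val
        = 1 + D.incl F c * ((conjGL θ θ' h1 h2 g).val - 1) * (D.incl F c)ᵀ := by
      rw [Units.val_mul, Units.val_mul, hAv, Matrix.mul_add, Matrix.add_mul, Matrix.mul_one,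
        Units.inv_mul, conjGL_val]
      congr 1
      calc _ = (((permGL F N w)⁻¹).val * D.incl F b) * (g.val - 1) * ((D.incl F b)ᵀ *
              (permGL F N w).val) := by simp only [Matrix.mul_assoc]
        _ = D.incl F c * (θ' * (g.val - 1) * θ) * (D.incl F c)ᵀ := by
          rw [e1, e2]
          simp only [Matrix.mul_assoc]
        _ = _ := by rw [Matrix.mul_sub, Matrix.sub_mul, Matrix.mul_one, h2]
    rw [e]
    exact D.lev_mulSingle c (lev_one.add (lev_single c _))
  rw [← hl A _ _ hA]
  have e3 : A * permGL F N w = permGL F N w * ((permGL F N w)⁻¹ * A * permGL F N w) := by group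
  rw [e3, hr _ _ _ hA', mul_assoc, ← map_mul, ← Pi.mulSingle_mul, ← map_mul, mul_inv_cancel,
    map_one, Pi.mulSingle_one, map_one, mul_one]

end Intertwiner

end Blocks

namespace Blocks

section Irreducible

variable {F : Type*} [Field F] {N t : ℕ} {r c : Fin t → ℕ}
  {Vρ : Fin t → Type*} [∀ i, AddCommGroup (Vρ i)] [∀ i, Module ℂ (Vρ i)]
  {ρ : ∀ i, Representation ℂ (GL (Fin (r i)) F) (Vρ i)}
  {D : Blocks N (fun i => r i * c i)} {hD : ∀ i, Monotone (D.enum i)}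
  {E : ∀ i, Blocks (r i * c i) (fun _ : Fin (c i) => r i)}
  {W : Fin t → Type*} [∀ i, AddCommGroup (W i)] [∀ i, Module ℂ (W i)]
  {π : ∀ i, Representation ℂ (GL (Fin (r i * c i)) F) (W i)}
  {ε : ∀ i, W i →ₗ[ℂ] ⨂[ℂ] _ : Fin (c i), Vρ i}
  {δ : ∀ i, (⨂[ℂ] _ : Fin (c i), Vρ i) →ₗ[ℂ] W i}

theorem map_nestRep_of_refine
    (hδ : ∀ i (q : parabolic (F := F) (E i).blk) w, δ i ((E i).powRep (ρ i) q w) = π i q (δ i w))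
    (A : parabolic (F := F) D.blk) {m : ∀ b : Σₗ i, Fin (c i), GL (Fin (r b.1)) F}
    (h : (D.refine hD E).Lev A.1.val fun b => (m b).val)
    (y : ⨂[ℂ] i, ⨂[ℂ] _ : Fin (c i), Vρ i) :
    PiTensorProduct.map δ (nestRep c ρ m y)
      = piTensorRep π (D.toLevi A) (PiTensorProduct.map δ y) := by
  refine LinearMap.congr_fun (f := PiTensorProduct.map δ ∘ₗ nestRep c ρ m)
    (g := piTensorRep π (D.toLevi A) ∘ₗ PiTensorProduct.map δ) ?_ y
  refine PiTensorProduct.ext (MultilinearMap.ext fun v => ?_)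
  rw [LinearMap.compMultilinearMap_apply, LinearMap.compMultilinearMap_apply,
    LinearMap.comp_apply, LinearMap.comp_apply, nestRep, MonoidHom.comp_apply, piTensorRep_tprod,
    PiTensorProduct.map_tprod, PiTensorProduct.map_tprod, piTensorRep_tprod]
  congr 1
  funext i
  have hl : (E i).Lev (D.toLevi A i).val fun a => (nestFam m i a).val :=
    lev_of_refine h (D.lev_toLevi A) i
  rw [← hδ i ⟨D.toLevi A i, hl.1⟩ (v i), powRep_of_lev hl]

theorem piTensorRep_toLevi_scalar [Finite F] [∀ i, FiniteDimensional ℂ (W i)]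
    (hπ : ∀ i, IsIrred (π i)) (T : Module.End ℂ (⨂[ℂ] i, W i))
    (hT : ∀ (p : parabolic (F := F) D.blk) y,
      T (piTensorRep π (D.toLevi p) y) = piTensorRep π (D.toLevi p) (T y)) :
    ∃ z : ℂ, ∀ y, T y = z • y := by
  have (i : Fin t) : Fintype (GL (Fin (r i * c i)) F) := Fintype.ofFinite _
  refine piTensorRep_scalar hπ T fun m y => ?_
  rw [← D.toLevi_eq (A := ⟨D.diag m, (D.diag_lev m).1⟩) (D.diag_lev m)]
  exact hT _ y

variable [∀ i, FiniteDimensional ℂ (Vρ i)] [∀ i, FiniteDimensional ℂ (W i)]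

/-- An operator valued function on the general linear group, equivariant on both sides under the
parabolic subgroup of the refined blocks, is supported on the block triangular matrices. -/
theorem eq_zero_of_nestRep_equivariant [Finite F] (hρi : ∀ i, IsIrred (ρ i))
    (hρc : ∀ i, IsCuspidal (ρ i))
    (hdistinct : ∀ i j (_ : i ≠ j) (hr : r i = r j),
      ¬ RepIso (ρ i) ((ρ j).comp (castGL hr).toMonoidHom))
    (Ψ : GL (Fin N) F → Module.End ℂ (⨂[ℂ] i, ⨂[ℂ] _ : Fin (c i), Vρ i))
    (hl : ∀ (A g : GL (Fin N) F) m, (D.refine hD E).Lev A.val (fun b => (m b).val) →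
      Ψ (A * g) = nestRep c ρ m * Ψ g)
    (hr : ∀ (A g : GL (Fin N) F) m, (D.refine hD E).Lev A.val (fun b => (m b).val) →
      Ψ (g * A) = Ψ g * nestRep c ρ m) {g : GL (Fin N) F} (hg : ¬ BlockTriangular g.val D.blk) :
    Ψ g = 0 := by
  by_contra hne
  obtain ⟨w, b₁, b₂, hb₁, hb₂, rfl⟩ := bruhat g
  have hP₁ : BlockTriangular b₁.val (D.refine hD E).blk :=
    blockTriangular_of_id (D.refine hD E).mono hb₁
  have hP₂ : BlockTriangular b₂.val (D.refine hD E).blk :=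
    blockTriangular_of_id (D.refine hD E).mono hb₂
  obtain ⟨m₁, hm₁, -⟩ := exists_lev b₁ hP₁
  obtain ⟨m₂, hm₂, -⟩ := exists_lev b₂ hP₂
  have hw0 : Ψ (permGL F N w) ≠ 0 := fun h0 => hne (by
    rw [hr _ _ _ hm₂, hl _ _ _ hm₁, h0, mul_zero, zero_mul])
  obtain ⟨v, hv⟩ : ∃ v, Ψ (permGL F N w) v ≠ 0 := by
    by_contra! hcon
    exact hw0 (LinearMap.ext hcon)
  have hS : ∀ b h, nestRep c ρ (Pi.mulSingle b h) = nestSlot c Vρ b (ρ b.1 h) :=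
    nestRep_mulSingle ρ
  have h1 : ∀ (A g : GL (Fin N) F) m, (D.refine hD E).Lev A.val (fun b => (m b).val) →
      Ψ (A * g) v = nestRep c ρ m (Ψ g v) := fun A g m hA => by
    rw [hl A g m hA, Module.End.mul_apply]
  have h2 : ∀ g u : GL (Fin N) F, (D.refine hD E).Lev u.val 1 → Ψ (g * u) v = Ψ g v :=
    fun g u hu => by
      rw [hr u g 1 hu, map_one, mul_one]
  have hpres := preserves_of_equivariant (D := D.refine hD E) (ρ := fun b => ρ b.1)
    (R := nestRep c ρ) (S := nestSlot c Vρ) (fun b => hρc b.1) hS (fun g => Ψ g v) h1 h2 w hv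
  have hfix : ∀ x, D.blk (w x) = D.blk x := by
    intro x
    by_contra hx
    have hw' : ∀ y, (D.refine hD E).blk (w y) = (D.refine hD E).blk (w x) ↔
        (D.refine hD E).blk y = (D.refine hD E).blk x := fun y =>
      ⟨fun h => by simpa using perm_preserves_inv hpres _ _ h, hpres y x⟩
    obtain ⟨e, he⟩ := repIso_of_intertwiner (D := D.refine hD E) (ρ := fun b => ρ b.1)
      (R := nestRep c ρ) (S := nestSlot c Vρ) (hρi _) (hρi _) hS hw' Ψ hl hr hw0
    exact hdistinct _ _ hx e he
  refine hg ?_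
  rw [Units.val_mul, Units.val_mul]
  refine ((blockTriangular_of_id D.mono hb₁).mul fun x y hxy => ?_).mul
    (blockTriangular_of_id D.mono hb₂)
  rw [permGL_apply, if_neg]
  rintro rfl
  rw [hfix] at hxy
  exact lt_irrefl _ hxy

theorem isIrred_indRep_parabolic [Finite F] (hρi : ∀ i, IsIrred (ρ i))
    (hρc : ∀ i, IsCuspidal (ρ i))
    (hdistinct : ∀ i j (_ : i ≠ j) (hr : r i = r j),
      ¬ RepIso (ρ i) ((ρ j).comp (castGL hr).toMonoidHom))
    (hπ : ∀ i, IsIrred (π i)) (hD : ∀ i, Monotone (D.enum i))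
    (hε : ∀ i (q : parabolic (F := F) (E i).blk) w, ε i (π i q w) = (E i).powRep (ρ i) q (ε i w))
    (hε0 : ∀ i, ε i ≠ 0) :
    IsIrred (IndRep (parabolic (F := F) D.blk) ((piTensorRep π).comp D.toLevi)) := by
  classical
  have : Fintype (GL (Fin N) F) := Fintype.ofFinite _
  have (i : Fin t) : Fintype (GL (Fin (r i * c i)) F) := Fintype.ofFinite _
  have (i : Fin t) : Fintype (parabolic (F := F) (E i).blk) := Fintype.ofFinite _
  choose u hu using fun i => (hπ i).1
  choose δ hδ hεδ using fun i => exists_equivariant_pseudoinverse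
    ((π i).comp (parabolic (F := F) (E i).blk).subtype) ((E i).powRep (ρ i)) (ε i) (hε i)
  have hδ0 : ∀ i, δ i ≠ 0 := fun i h0 => hε0 i (LinearMap.ext fun v => by
    rw [← hεδ, h0, LinearMap.zero_apply, map_zero, LinearMap.zero_apply])
  refine isIrred_indRep _ ⟨_, tprod_ne_zero hu⟩
    (fun T hT => piTensorRep_toLevi_scalar (D := D) hπ T hT) fun Φ hl hr g hg => ?_
  by_contra hne
  obtain ⟨h', hh'⟩ := exists_comp_piTensorRep_map_ne_zero hπ δ hδ0 (Φ g) hne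
  obtain ⟨y, hy⟩ : ∃ y, Φ g (piTensorRep π h' (PiTensorProduct.map δ y)) ≠ 0 := by
    by_contra! hcon
    exact hh' (LinearMap.ext hcon)
  obtain ⟨h, hh⟩ := exists_map_piTensorRep_ne_zero hπ ε hε0 _ hy
  let Ψ : GL (Fin N) F → Module.End ℂ (⨂[ℂ] i, ⨂[ℂ] _ : Fin (c i), Vρ i) :=
    fun g => PiTensorProduct.map ε ∘ₗ Φ g ∘ₗ PiTensorProduct.map δ
  have hd : ∀ (m : ∀ i, GL (Fin (r i * c i)) F) (z : ⨂[ℂ] i, W i),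
      ((piTensorRep π).comp D.toLevi) ⟨D.diag m, (D.diag_lev m).1⟩ z = piTensorRep π m z :=
    fun m z => by
      rw [MonoidHom.comp_apply, D.toLevi_eq (A := ⟨D.diag m, (D.diag_lev m).1⟩) (D.diag_lev m)]
  have hΨ : Ψ (D.diag h * g * D.diag h') y ≠ 0 := by
    change PiTensorProduct.map ε (Φ (D.diag h * g * D.diag h') (PiTensorProduct.map δ y)) ≠ 0
    have e1 := hr ⟨D.diag h', (D.diag_lev h').1⟩ (D.diag h * g) (PiTensorProduct.map δ y)
    have e2 := hl ⟨D.diag h, (D.diag_lev h).1⟩ g (piTensorRep π h' (PiTensorProduct.map δ y))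
    rw [hd] at e1 e2
    rwa [e1, e2]
  refine hΨ (LinearMap.congr_fun (eq_zero_of_nestRep_equivariant (D := D) (hD := hD) (E := E)
    hρi hρc hdistinct Ψ (fun A g m hA => LinearMap.ext fun v => ?_)
    (fun A g m hA => LinearMap.ext fun v => ?_) fun hbt => hg ?_) y)
  · rw [Module.End.mul_apply]
    change PiTensorProduct.map ε (Φ (A * g) (PiTensorProduct.map δ v))
      = nestRep c ρ m (PiTensorProduct.map ε (Φ g (PiTensorProduct.map δ v)))
    rw [← map_piTensorRep_of_refine (ρ := ρ) hε ⟨A, blockTriangular_of_refine hA.1⟩ hA]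
    exact congrArg _ (hl ⟨A, blockTriangular_of_refine hA.1⟩ g _)
  · rw [Module.End.mul_apply]
    change PiTensorProduct.map ε (Φ (g * A) (PiTensorProduct.map δ v))
      = PiTensorProduct.map ε (Φ g (PiTensorProduct.map δ (nestRep c ρ m v)))
    rw [map_nestRep_of_refine (ρ := ρ) hδ ⟨A, blockTriangular_of_refine hA.1⟩ hA]
    exact congrArg _ (hr ⟨A, blockTriangular_of_refine hA.1⟩ g _)
  · have e : g = (D.diag h)⁻¹ * (D.diag h * g * D.diag h') * (D.diag h')⁻¹ := by group
    rw [e]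
    exact (parabolic (F := F) D.blk).mul_mem ((parabolic (F := F) D.blk).mul_mem
      ((parabolic (F := F) D.blk).inv_mem (D.diag_lev h).1) hbt)
      ((parabolic (F := F) D.blk).inv_mem (D.diag_lev h').1)

end Irreducible

end Blocks

section SelfDual

variable {G : Type*} [Group G] {P : Subgroup G} {Y : Type*} [AddCommGroup Y] [Module ℂ Y]
  (x : Representation ℂ P Y)

/-- the bilinear form on an induced representation attached to a bilinear form on the inducing
representation and to a group element -/
def indForm [Fintype G] (κ : Y →ₗ[ℂ] Y →ₗ[ℂ] ℂ) (w : G) :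
    IndCarrier P x →ₗ[ℂ] IndCarrier P x →ₗ[ℂ] ℂ :=
  LinearMap.mk₂ ℂ (fun φ φ' => ∑ g, κ (φ.1 g) (φ'.1 (w * g)))
    (fun φ₁ φ₂ φ' => by
      rw [← Finset.sum_add_distrib]
      exact Finset.sum_congr rfl fun g _ => LinearMap.map_add₂ κ _ _ _)
    (fun z φ φ' => by
      rw [Finset.smul_sum]
      exact Finset.sum_congr rfl fun g _ => LinearMap.map_smul₂ κ _ _ _)
    (fun φ φ₁ φ₂ => by
      rw [← Finset.sum_add_distrib]
      exact Finset.sum_congr rfl fun g _ => map_add _ _ _)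
    (fun z φ φ' => by
      rw [Finset.smul_sum]
      exact Finset.sum_congr rfl fun g _ => map_smul _ _ _)

theorem indForm_apply [Fintype G] (κ : Y →ₗ[ℂ] Y →ₗ[ℂ] ℂ) (w : G) (φ φ' : IndCarrier P x) :
    indForm x κ w φ φ' = ∑ g, κ (φ.1 g) (φ'.1 (w * g)) := rfl

/-- An irreducible induced representation is self-dual if the inducing representation is paired
with itself compatibly with conjugation by a group element. -/
theorem IsIrred.selfDual_indRep [Fintype G] [FiniteDimensional ℂ Y] (hirr : IsIrred (IndRep P x))
    (κ : Y →ₗ[ℂ] Y →ₗ[ℂ] ℂ) (w : G)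
    (hκ : ∀ p p' : P, (p' : G) = w * p * w⁻¹ → ∀ y y', κ (x p y) (x p' y') = κ y y')
    (h0 : κ ≠ 0) : RepIso (IndRep P x).dual (IndRep P x) := by
  classical
  refine hirr.repIso_dual hirr (indForm x κ w) (fun g φ φ' => ?_) fun hB => h0 ?_
  · rw [indForm_apply, indForm_apply, ← Equiv.sum_comp (Equiv.mulRight g)
      (fun h => κ (φ.1 h) (φ'.1 (w * h)))]
    exact Finset.sum_congr rfl fun h _ => by
      rw [indRep_apply, indRep_apply, mul_assoc]
      rfl
  · ext y y'
    have h := LinearMap.congr_fun₂ hB (indSingle x y) (IndRep P x w⁻¹ (indSingle x y'))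
    rw [indForm_apply] at h
    have hg : ∀ g, κ ((indSingle x y).1 g) ((IndRep P x w⁻¹ (indSingle x y')).1 (w * g))
        = if g ∈ P ∧ w * g * w⁻¹ ∈ P then κ y y' else 0 := fun g => by
      rw [indRep_apply]
      by_cases h₁ : g ∈ P
      · by_cases h₂ : w * g * w⁻¹ ∈ P
        · rw [if_pos ⟨h₁, h₂⟩]
          exact (congrArg₂ (fun a b => κ a b) (indSingle_apply_of_mem x ⟨g, h₁⟩ y)
            (indSingle_apply_of_mem x ⟨w * g * w⁻¹, h₂⟩ y')).trans (hκ _ _ rfl y y')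
        · rw [if_neg fun h => h₂ h.2, indSingle_apply_of_notMem x h₂, map_zero]
      · rw [if_neg fun h => h₁ h.1, indSingle_apply_of_notMem x h₁, map_zero, LinearMap.zero_apply]
    simp only [hg] at h
    rw [← Finset.sum_filter, Finset.sum_const, ← Nat.cast_smul_eq_nsmul ℂ, LinearMap.zero_apply,
      LinearMap.zero_apply, smul_eq_zero] at h
    refine h.resolve_left fun hc => ?_
    rw [Nat.cast_eq_zero, Finset.card_eq_zero] at hc
    exact Finset.notMem_empty (1 : G) (hc ▸ Finset.mem_filter.2 ⟨Finset.mem_univ _, P.one_mem, by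
      rw [mul_one, mul_inv_cancel]
      exact P.one_mem⟩)

end SelfDual

theorem DualTo.exists_pairing {F : Type*} [Field F] {a b : ℕ} {V V' : Type*} [AddCommGroup V]
    [Module ℂ V] [AddCommGroup V'] [Module ℂ V'] {π : Representation ℂ (GL (Fin a) F) V}
    {π' : Representation ℂ (GL (Fin b) F) V'} (h : DualTo π π') (hne : ∃ v : V, v ≠ 0) :
    ∃ (hab : a = b) (κ : V →ₗ[ℂ] V' →ₗ[ℂ] ℂ),
      (∀ g v v', κ (π g v) (π' (castGL hab g) v') = κ v v') ∧ ∃ v v', κ v v' ≠ 0 := by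
  obtain ⟨hab, e, he⟩ := h
  refine ⟨hab, e.symm.toLinearMap.flip, fun g v v' => ?_, ?_⟩
  · obtain ⟨l, rfl⟩ := e.surjective v'
    change e.symm (π' (castGL hab g) (e l)) (π g v) = e.symm (e l) v
    have h2 : π' (castGL hab g) (e l) = e (π.dual g l) := (he g l).symm
    rw [h2, e.symm_apply_apply, e.symm_apply_apply, dual_rep_apply, rep_inv_self_apply]
  · obtain ⟨v, hv⟩ := hne
    obtain ⟨l, hl⟩ := Module.Projective.exists_dual_ne_zero ℂ hv
    refine ⟨v, e l, ?_⟩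
    change e.symm (e l) v ≠ 0
    rwa [e.symm_apply_apply]

namespace Blocks

section SelfDual

variable {N t : ℕ} {k : Fin t → ℕ} (D : Blocks N k)

/-- the blocks as a decomposition of the index set -/
def sigmaEquiv : (Σ i, Fin (k i)) ≃ Fin N :=
  Equiv.ofBijective (fun p => D.enum p.1 p.2) ⟨fun p p' h => by
    obtain ⟨i, a⟩ := p
    obtain ⟨i', a'⟩ := p'
    obtain rfl : i = i' := by
      rw [← D.blk_enum i a, ← D.blk_enum i' a']
      exact congrArg D.blk h
    exact congrArg (Sigma.mk i) (D.inj i h), fun x => (D.surj _ x rfl).elim fun a ha => ⟨⟨_, a⟩, ha⟩⟩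

theorem exists_perm_enum (σ : Equiv.Perm (Fin t)) (h : ∀ i, k i = k (σ i)) :
    ∃ w : Equiv.Perm (Fin N), ∀ i a, w (D.enum i a) = D.enum (σ i) (finCongr (h i) a) :=
  ⟨(D.sigmaEquiv.symm.trans (Equiv.sigmaCongr σ fun i => finCongr (h i))).trans D.sigmaEquiv,
    fun i a => by
      change D.sigmaEquiv (Equiv.sigmaCongr σ (fun i => finCongr (h i))
        (D.sigmaEquiv.symm (D.sigmaEquiv ⟨i, a⟩))) = _
      rw [Equiv.symm_apply_apply]
      rfl⟩

variable {D}
variable {F : Type*} [Field F] {W : Fin t → Type*} [∀ i, AddCommGroup (W i)]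
  [∀ i, Module ℂ (W i)] [∀ i, FiniteDimensional ℂ (W i)]
  {π : ∀ i, Representation ℂ (GL (Fin (k i)) F) (W i)}

theorem selfDual_indRep_parabolic [Finite F] (hπ : ∀ i, IsIrred (π i)) (σ : Equiv.Perm (Fin t))
    (hσ : ∀ i, DualTo (π i) (π (σ i)))
    (hirr : IsIrred (IndRep (parabolic (F := F) D.blk) ((piTensorRep π).comp D.toLevi))) :
    RepIso (IndRep (parabolic (F := F) D.blk) ((piTensorRep π).comp D.toLevi)).dual
      (IndRep (parabolic (F := F) D.blk) ((piTensorRep π).comp D.toLevi)) := by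
  classical
  have : Fintype (GL (Fin N) F) := Fintype.ofFinite _
  choose hk κ hκ u u' hu using fun i => (hσ i).exists_pairing (hπ i).1
  obtain ⟨w, hw⟩ := D.exists_perm_enum σ hk
  let ψ : (⨂[ℂ] i, W i) ≃ₗ[ℂ] ⨂[ℂ] i, W (σ i) := PiTensorProduct.reindex ℂ W σ.symm
  let K : (⨂[ℂ] i, W i) →ₗ[ℂ] (⨂[ℂ] i, W i) →ₗ[ℂ] ℂ :=
    (tensorBilin (V := W) (V' := fun i => W (σ i)) κ).compl₂ ψ.toLinearMap
  have hK : ∀ v v', K (PiTensorProduct.tprod ℂ v) (PiTensorProduct.tprod ℂ v')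
      = ∏ i, κ i (v i) (v' (σ i)) := fun v v' => by
    have hψ : ψ (PiTensorProduct.tprod ℂ v') = PiTensorProduct.tprod ℂ fun i => v' (σ i) :=
      PiTensorProduct.reindex_tprod σ.symm v'
    rw [LinearMap.compl₂_apply, LinearEquiv.coe_coe, hψ]
    exact tensorBilin_tprod (V := W) (V' := fun i => W (σ i)) κ _ _
  refine hirr.selfDual_indRep _ K (permGL F N w) (fun p p' hpp => ?_) fun h0 => ?_
  · have hm : ∀ i, D.toLevi p' (σ i) = castGL (hk i) (D.toLevi p i) := fun i => by
      refine Units.ext ?_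
      ext a b
      have h₁ := congrFun₂ ((D.lev_toLevi p').2 (σ i)) a b
      have h₂ := congrFun₂ ((D.lev_toLevi p).2 i) ((finCongr (hk i)).symm a)
        ((finCongr (hk i)).symm b)
      rw [D.inclT_mul_mul_incl_apply] at h₁ h₂
      refine h₁.symm.trans (Eq.trans ?_ h₂)
      have e : p.1 = (permGL F N w)⁻¹ * p'.1 * permGL F N w := by
        rw [hpp]
        group
      rw [e, Units.val_mul, Units.val_mul, permGL_inv_mul_mul_apply, hw, hw,
        Equiv.apply_symm_apply, Equiv.apply_symm_apply]
    refine fun y y' => LinearMap.congr_fun₂ (f := K.compl₁₂ (piTensorRep π (D.toLevi p))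
      (piTensorRep π (D.toLevi p'))) (g := K) (tensor_ext₂ fun v v' => ?_) y y'
    rw [LinearMap.compl₁₂_apply, piTensorRep_tprod, piTensorRep_tprod, hK, hK]
    refine Finset.prod_congr rfl fun i _ => ?_
    rw [hm, hκ]
  · have h1 := LinearMap.congr_fun₂ h0 (PiTensorProduct.tprod ℂ u)
      (ψ.symm (PiTensorProduct.tprod ℂ u'))
    rw [LinearMap.compl₂_apply, LinearEquiv.coe_coe, LinearEquiv.apply_symm_apply] at h1
    have h2 := (tensorBilin_tprod (V := W) (V' := fun i => W (σ i)) κ u u').symm.trans h1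
    exact Finset.prod_ne_zero_iff.2 (fun i _ => hu i) h2

end SelfDual

end Blocks

end Development

/-- Let `ρ₀, …, ρ_{t-1}` be pairwise non-isomorphic cuspidal irreducible representations,
`π_i` a `ρ_i`-primary irreducible representation, and suppose the parabolic induction
`π₀ × ⋯ × π_{t-1}` has a nonzero vector invariant under the centralizer of an `A` with
`A² = I`. Then each `π_i` is self-dual or dual to some `π_j`, `j ≠ i`, and consequently
`(π₀ × ⋯ × π_{t-1})* ≅ π₀ × ⋯ × π_{t-1}`. -/
theorem statement11 (q : ℕ) (hq : IsPrimePow q) (hqodd : Odd q)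
    (F : Type) [Field F] [Fintype F] (hF : Fintype.card F = q)
    (t : ℕ) (r c : Fin t → ℕ)
    (Vρ : Fin t → Type) [∀ i, AddCommGroup (Vρ i)] [∀ i, Module ℂ (Vρ i)]
    [∀ i, FiniteDimensional ℂ (Vρ i)]
    (ρ : ∀ i, Representation ℂ (GL (Fin (r i)) F) (Vρ i))
    (hρi : ∀ i, IsIrred (ρ i)) (hρc : ∀ i, IsCuspidal (ρ i))
    (hdistinct : ∀ i j (_ : i ≠ j) (hr : r i = r j),
      ¬ RepIso (ρ i) ((ρ j).comp (castGL hr).toMonoidHom))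
    (W : Fin t → Type) [∀ i, AddCommGroup (W i)] [∀ i, Module ℂ (W i)]
    [∀ i, FiniteDimensional ℂ (W i)]
    (π : ∀ i, Representation ℂ (GL (Fin (r i * c i)) F) (W i))
    (hπi : ∀ i, IsIrred (π i)) (hπprim : ∀ i, IsPrimary (ρ i) (π i))
    -- the standard composition of `N` into blocks of sizes `r i * c i`
    (N : ℕ) (f : Fin N → Fin t) (e : ∀ i, Fin (r i * c i) → Fin N)
    (hf : Monotone f) (he : ∀ i, StrictMono (e i))
    (hmem : ∀ i x, f (e i x) = i) (hsurj : ∀ i j, f j = i → ∃ x, e i x = j)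
    (A : GL (Fin N) F) (hA : A ^ 2 = 1)
    (hdist : HasInvVec
      (parabolicInd f e (fun i => (he i).injective) hmem hsurj π)
      (Subgroup.centralizer {A} : Set (GL (Fin N) F))) :
    (∀ i, RepIso (π i) (π i).dual ∨
      ∃ j, j ≠ i ∧ ∃ hr : r j * c j = r i * c i,
        RepIso ((π i).dual) ((π j).comp (castGL hr.symm).toMonoidHom)) ∧
    RepIso (parabolicInd f e (fun i => (he i).injective) hmem hsurj π).dual
      (parabolicInd f e (fun i => (he i).injective) hmem hsurj π) := by
  have h2 : (2 : F) ≠ 0 := fun h => by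
    have hc : ringChar F = 2 := by
      by_contra hne
      exact Ring.two_ne_zero hne h
    exact Nat.not_even_iff_odd.2 hqodd (hF ▸ Nat.even_iff.2 (FiniteField.even_card_iff_char_two.1 hc))
  let D : Blocks N (fun i => r i * c i) := ⟨f, e, hf, fun i => (he i).injective, hmem, hsurj⟩
  choose E ε hε hε0 using fun i => (hπprim i).exists_powRep (hπi i)
  have hD : ∀ i, Monotone (D.enum i) := fun i => (he i).monotone
  obtain ⟨σ, hσ⟩ := D.exists_perm_dualTo h2 hρi hρc hdistinct hπi hD hε hε0 hA hdist
  refine ⟨fun i => ?_, Blocks.selfDual_indRep_parabolic hπi σ (fun i => (hσ i).symm)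
    (Blocks.isIrred_indRep_parabolic hρi hρc hdistinct hπi hD hε hε0)⟩
  have h := (hσ i).symm
  by_cases hi : σ i = i
  · rw [hi] at h
    exact Or.inl (dualTo_iff.1 h).symm
  · obtain ⟨hr, h⟩ := h
    exact Or.inr ⟨σ i, hi, hr.symm, h⟩


end Paper
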